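/- Let S be a non-empty countable set and let μ be a transient partially exchangeable probability measure on S^ℕ. The following are equivalent: (1) μ is an extreme point of the convex set 𝒫(S) of partially exchangeable probability measures on S^ℕ; (2) μ is supported on a set of sequences with constant initial state and constant transition numbers; (3) μ is equal to the law of the sequence of vertices visited by a random path distributed as the unique proper Gibbs measure on Eulerian paths from o to ∞ on some sourced Eulerian digraph (G,o) whose vertex set is a subset of S. -/

import Mathlib

open MeasureTheory Filter Set
open scoped ENNReal

namespace DF

/-! ### Sequences over a countable state space -/

variable {S : Type}

/-- The number of transitions from `u` to `v` among the first `n` steps of the sequence `x`. -/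
noncomputable def transCount (x : ℕ → S) (n : ℕ) (u v : S) : ℕ :=
  Set.ncard {i : ℕ | i < n ∧ x i = u ∧ x (i + 1) = v}

/-- The equivalence `(x₀,…,xₙ) ≃ (y₀,…,yₙ)` of finite sequences: same initial state and the same
transition counts between every ordered pair of states. -/
def FinEquiv (x y : ℕ → S) (n : ℕ) : Prop :=
  x 0 = y 0 ∧ ∀ u v : S, transCount x n u v = transCount y n u v

/-- The equivalence `x ≃ y` of infinite sequences: they eventually agree and their initial
segments up to that point are `≃`-equivalent. -/
def InfEquiv (x y : ℕ → S) : Prop :=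
  ∃ N : ℕ, (∀ n : ℕ, N ≤ n → x n = y n) ∧ FinEquiv x y N

/-- The transition numbers `M(u,v) = #{i ≥ 0 : (xᵢ, xᵢ₊₁) = (u,v)}` of an infinite sequence. -/
noncomputable def transNum (x : ℕ → S) (u v : S) : ℕ∞ :=
  Set.encard {i : ℕ | x i = u ∧ x (i + 1) = v}

/-- The sigma-algebra on `S^ℕ` generated by the transition numbers. -/
noncomputable def transSigma (S : Type) : MeasurableSpace (ℕ → S) :=
  ⨆ u : S, ⨆ v : S, MeasurableSpace.comap (fun x => transNum x u v) (⊤ : MeasurableSpace ℕ∞)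

/-- The tail sigma-algebra `⋂ₙ σ(Xₙ, Xₙ₊₁, …)` on `S^ℕ`. -/
def tailSigma (S : Type) [MeasurableSpace S] : MeasurableSpace (ℕ → S) :=
  ⨅ n : ℕ, MeasurableSpace.comap (fun (x : ℕ → S) (i : ℕ) => x (i + n))
    (inferInstance : MeasurableSpace (ℕ → S))

/-- A measure on `S^ℕ` is partially exchangeable if any two `≃`-equivalent finite initial
segments have the same probability. -/
def PartiallyExchangeable [MeasurableSpace S] (μ : Measure (ℕ → S)) : Prop :=
  ∀ (n : ℕ) (x y : ℕ → S), FinEquiv x y n →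
    μ {ω | ∀ i ≤ n, ω i = x i} = μ {ω | ∀ i ≤ n, ω i = y i}

/-- The set of partially exchangeable probability measures on `S^ℕ`. -/
def PEProb (S : Type) [MeasurableSpace S] : Set (Measure (ℕ → S)) :=
  {μ | μ Set.univ = 1 ∧ PartiallyExchangeable μ}

/-- `μ` is an extreme point of the convex set of partially exchangeable probability measures. -/
def IsExtremePE [MeasurableSpace S] (μ : Measure (ℕ → S)) : Prop :=
  μ ∈ PEProb S ∧
    ∀ μ₁ ∈ PEProb S, ∀ μ₂ ∈ PEProb S, ∀ t : ℝ≥0∞, 0 < t → t < 1 →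
      μ = t • μ₁ + (1 - t) • μ₂ → μ₁ = μ₂

/-! ### Digraphs -/

/-- A digraph on vertex set `V` with edge set `E`: each edge has a tail (`src`) and head (`dst`).
Multiple edges and loops are allowed. -/
structure DigraphStruct (V E : Type) where
  src : E → V
  dst : E → V

namespace DigraphStruct

variable {V E : Type} (G : DigraphStruct V E)

def outEdges (v : V) : Set E := {e | G.src e = v}

def inEdges (v : V) : Set E := {e | G.dst e = v}

noncomputable def outDeg (v : V) : ℕ := (G.outEdges v).ncard

noncomputable def inDeg (v : V) : ℕ := (G.inEdges v).ncard

def LocallyFinite : Prop := ∀ v : V, (G.outEdges v).Finite ∧ (G.inEdges v).Finite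

/-- Adjacency in the underlying undirected graph. -/
def undirAdj (u v : V) : Prop :=
  ∃ e : E, (G.src e = u ∧ G.dst e = v) ∨ (G.src e = v ∧ G.dst e = u)

/-- `G` is connected as an undirected graph. -/
def Connected : Prop := ∀ u v : V, Relation.ReflTransGen G.undirAdj u v

def dirAdj (u v : V) : Prop := ∃ e : E, G.src e = u ∧ G.dst e = v

/-- One step along an edge of the edge set `B`. -/
def step (B : Set E) (u v : V) : Prop := ∃ e ∈ B, G.src e = u ∧ G.dst e = v

/-- `(G,o)` is an infinite sourced Eulerian digraph (with sink at infinity). -/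
structure IsSourcedEulerian (o : V) : Prop where
  infinite : Infinite V
  locFin : G.LocallyFinite
  conn : G.Connected
  balanced : ∀ v : V, v ≠ o → G.inDeg v = G.outDeg v
  source : G.outDeg o = G.inDeg o + 1

/-- The reversal of `G`: head and tail of every edge are exchanged. -/
def rev : DigraphStruct V E := ⟨G.dst, G.src⟩

/-- One-step transition probability of the random walk on `G`. -/
noncomputable def stepProb (u v : V) : ℝ≥0∞ :=
  ({e : E | G.src e = u ∧ G.dst e = v}.ncard : ℝ≥0∞) / (G.outDeg u : ℝ≥0∞)

open Classical in
/-- `μ` is the law of the random walk on `G` started at `o`, characterised through its cylinder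
probabilities. -/
def IsWalkLaw [MeasurableSpace V] (o : V) (μ : Measure (ℕ → V)) : Prop :=
  μ Set.univ = 1 ∧
    ∀ (n : ℕ) (x : ℕ → V),
      μ {ω | ∀ i ≤ n, ω i = x i} =
        if x 0 = o then ∏ i ∈ Finset.range n, G.stepProb (x i) (x (i + 1)) else 0

/-- `G` is transient: from every starting point, the random walk on `G` visits every vertex at
most finitely often almost surely. -/
def TransientDigraph [MeasurableSpace V] : Prop :=
  ∀ (o : V) (μ : Measure (ℕ → V)),
    G.IsWalkLaw o μ → μ {ω | ∀ v : V, {i : ℕ | ω i = v}.Finite} = 1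

/-- An infinite path in `G` indexed by `ℕ`, encoded by its sequence of edges. -/
def IsInfPath (γ : ℕ → E) : Prop := ∀ i : ℕ, G.dst (γ i) = G.src (γ (i + 1))

/-- A transient path: it visits every vertex at most finitely often. -/
def IsTransientPath (γ : ℕ → E) : Prop := ∀ v : V, {i : ℕ | G.src (γ i) = v}.Finite

/-- The edge set of the last-exit arboretum `𝓛(γ)`: the edges crossed by `γ` as it exits their
tail for the last time. -/
def lastExitSet (γ : ℕ → E) : Set E :=
  {e | ∃ i : ℕ, γ i = e ∧ ∀ j : ℕ, i < j → G.src (γ j) ≠ G.src (γ i)}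

end DigraphStruct

/-! ### Finite paths, Eulerian paths, arborescences -/

/-- `IsPathList G o z P` means that the list of edges `P` forms a directed path from `o`
to `z` in `G`. -/
def IsPathList {V E : Type} (G : DigraphStruct V E) : V → V → List E → Prop
  | o, z, [] => o = z
  | o, z, e :: es => G.src e = o ∧ IsPathList G (G.dst e) z es

/-- `P` is an Eulerian path from `o` to `z`: a path crossing every edge exactly once. -/
def IsEulerList {V E : Type} (G : DigraphStruct V E) (o z : V) (P : List E) : Prop :=
  IsPathList G o z P ∧ P.Nodup ∧ ∀ e : E, e ∈ P

/-- `B` is (the edge set of) a spanning in-arborescence of `G` rooted at `z`. -/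
def IsFinArb {V E : Type} (G : DigraphStruct V E) (z : V) (B : Set E) : Prop :=
  (∀ e ∈ B, G.src e ≠ z) ∧
  (∀ v : V, v ≠ z → ∃! e : E, e ∈ B ∧ G.src e = v) ∧
  (∀ v : V, Relation.ReflTransGen (G.step B) v z)

/-- `(G,o,z)` is a finite Eulerian digraph with source `o` and sink `z`. -/
structure IsFinEulerian {V E : Type} (G : DigraphStruct V E) (o z : V) : Prop where
  finV : Finite V
  finE : Finite E
  reach_from : ∀ v : V, Relation.ReflTransGen G.dirAdj o v
  reach_to : ∀ v : V, Relation.ReflTransGen G.dirAdj v z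
  bal_ne : o ≠ z → (∀ v : V, v ≠ o → v ≠ z → G.inDeg v = G.outDeg v) ∧
      G.outDeg o = G.inDeg o + 1 ∧ G.inDeg z = G.outDeg z + 1
  bal_eq : o = z → ∀ v : V, G.inDeg v = G.outDeg v

/-! ### Wired uniform spanning in-arborescences -/

/-- An exhaustion of the vertex set by finite subsets. -/
def IsExhaustion {V : Type} (Vn : ℕ → Set V) : Prop :=
  (∀ n, (Vn n).Finite) ∧ (∀ n, Vn n ⊆ Vn (n + 1)) ∧ (⋃ n, Vn n) = Set.univ

/-- `B` is (the edge set of) a spanning in-arborescence of the wired graph `G_U^*`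
(all vertices outside `U` identified to a single boundary vertex) rooted at the boundary. -/
def IsWiredArb {V E : Type} (G : DigraphStruct V E) (U : Set V) (B : Set E) : Prop :=
  (∀ e ∈ B, G.src e ∈ U) ∧ (∀ v ∈ U, ∃! e : E, e ∈ B ∧ G.src e = v) ∧
  (∀ v ∈ U, ∃ v' : V, v' ∉ U ∧ Relation.ReflTransGen (G.step B) v v')

/-- The probability, under the uniform spanning in-arborescence of the wired graph `G_U^*`
rooted at the boundary, that all edges of `F` are present. -/
noncomputable def wiredUACyl {V E : Type} (G : DigraphStruct V E) (U : Set V) (F : Finset E) :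
    ℝ≥0∞ :=
  (Nat.card {B : Set E // IsWiredArb G U B ∧ (F : Set E) ⊆ B} : ℝ≥0∞) /
    (Nat.card {B : Set E // IsWiredArb G U B} : ℝ≥0∞)

/-- `κ` is the law of the wired uniform spanning in-arboretum of `G` (as a random edge set,
encoded as an element of `E → Bool`): its cylinder probabilities are the limits along any
exhaustion of the uniform spanning in-arborescence measures of the wired graphs. -/
def IsWUALaw {V E : Type} (G : DigraphStruct V E) (κ : Measure (E → Bool)) : Prop :=
  κ Set.univ = 1 ∧
    ∀ Vn : ℕ → Set V, IsExhaustion Vn → ∀ F : Finset E,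
      Filter.Tendsto (fun n => wiredUACyl G (Vn n) F) Filter.atTop
        (nhds (κ {A | ∀ e ∈ F, A e = true}))

/-- A spanning in-arboretum rooted at infinity all of whose components are one-ended:
every vertex has out-degree exactly one, and the past of every vertex is finite. -/
def IsOneEndedSpanningArb {V E : Type} (G : DigraphStruct V E) (A : Set E) : Prop :=
  (∀ v : V, ∃! e : E, e ∈ A ∧ G.src e = v) ∧
    ∀ v : V, {u : V | Relation.ReflTransGen (G.step A) u v}.Finite

/-! ### Proper Gibbs measures on Eulerian paths -/

/-- `w` is a finite path in `G` starting at `o` (encoded by its edges). -/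
def PrefixPath {V E : Type} (G : DigraphStruct V E) (o : V) {n : ℕ} (w : Fin n → E) : Prop :=
  (∀ h : 0 < n, G.src (w ⟨0, h⟩) = o) ∧
    ∀ (i : ℕ) (h : i + 1 < n), G.dst (w ⟨i, Nat.lt_of_succ_lt h⟩) = G.src (w ⟨i + 1, h⟩)

/-- A proper Gibbs measure on Eulerian paths from `o` to `∞` in `G`: a probability measure on
edge sequences, supported on half-infinite paths started at `o` crossing every edge exactly once,
such that conditionally on the steps after time `n` the first `n` steps are a uniform Eulerian
path (from `o`, in the digraph spanned by the edges not crossed after time `n`, to the position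
at time `n`). Uniformity is expressed by invariance under replacing the first `n` steps by any
other path from `o` crossing the same set of edges. -/
def ProperGibbs {V E : Type} [MeasurableSpace E] (G : DigraphStruct V E) (o : V)
    (μ : Measure (ℕ → E)) : Prop :=
  μ Set.univ = 1 ∧
  μ {γ | (∀ i : ℕ, G.dst (γ i) = G.src (γ (i + 1))) ∧ G.src (γ 0) = o ∧ Function.Bijective γ}
      = 1 ∧
  ∀ (n : ℕ) (w w' : Fin n → E), Function.Injective w → Function.Injective w' →
    Set.range w = Set.range w' → PrefixPath G o w → PrefixPath G o w' →
    ∀ B : Set (ℕ → E),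
      μ {γ | (∀ i : Fin n, γ (i : ℕ) = w i) ∧ (fun t : ℕ => γ (n + t)) ∈ B} =
        μ {γ | (∀ i : Fin n, γ (i : ℕ) = w' i) ∧ (fun t : ℕ => γ (n + t)) ∈ B}

/-! ### Loop erasure and Wilson's algorithm rooted at infinity -/

/-- The loop-erasure times of the (transient) vertex sequence `p`:
`t₀ = 0`, `tᵢ₊₁ = 1 + max {t ≥ tᵢ : p t = p tᵢ}`. -/
noncomputable def leTimes {V : Type} (p : ℕ → V) : ℕ → ℕ
  | 0 => 0
  | i + 1 => sSup {t : ℕ | leTimes p i ≤ t ∧ p t = p (leTimes p i)} + 1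

/-- The loop-erasure times of the vertex sequence `p` run up to time `k`. -/
noncomputable def leTimesF {V : Type} (p : ℕ → V) (k : ℕ) : ℕ → ℕ
  | 0 => 0
  | i + 1 => sSup {t : ℕ | leTimesF p k i ≤ t ∧ t ≤ k ∧ p t = p (leTimesF p k i)} + 1

/-- The set of vertices incident to an edge of `A`. -/
def vertsOf {V E : Type} (G : DigraphStruct V E) (A : Set E) : Set V :=
  {u | ∃ e ∈ A, G.src e = u ∨ G.dst e = u}

open Classical in
/-- The set of edges of the loop-erasure of the walk `x` (an edge sequence) stopped when it
first hits `U`; if it never hits `U`, the loop-erasure of the whole (transient) walk. -/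
noncomputable def stoppedLEedges {V E : Type} (G : DigraphStruct V E) (U : Set V) (x : ℕ → E) :
    Set E :=
  if ∃ t : ℕ, G.src (x t) ∈ U then
    {e | ∃ i : ℕ,
      leTimesF (fun t => G.src (x t)) (sInf {t : ℕ | G.src (x t) ∈ U}) i <
          sInf {t : ℕ | G.src (x t) ∈ U} ∧
        x (leTimesF (fun t => G.src (x t)) (sInf {t : ℕ | G.src (x t) ∈ U}) i) = e}
  else Set.range fun i => x (leTimes (fun t => G.src (x t)) i)

/-- The partial edge sets generated by Wilson's algorithm rooted at infinity, run with the
enumeration `v` of the vertices and with `W j` the random walk used at stage `j + 1`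
(started at `v j`). -/
noncomputable def wilsonA {V E : Type} (G : DigraphStruct V E) (v : ℕ → V) (W : ℕ → ℕ → E) :
    ℕ → Set E
  | 0 => ∅
  | j + 1 =>
      wilsonA G v W j ∪
        stoppedLEedges G (vertsOf G (wilsonA G v W j) ∪ {u | ∃ i < j, v i = u}) (W j)

open Classical in
/-- Cylinder probabilities for the random walk on `G` started at `v`, recorded as a sequence of
edges: the probability that the first `n` crossed edges are `x 0, …, x (n-1)`. -/
noncomputable def edgeWalkCyl {V E : Type} (G : DigraphStruct V E) (v : V) (x : ℕ → E) (n : ℕ) :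
    ℝ≥0∞ :=
  if (0 < n → G.src (x 0) = v) ∧ (∀ i : ℕ, i + 1 < n → G.dst (x i) = G.src (x (i + 1))) then
    ∏ i ∈ Finset.range n, ((G.outDeg (G.src (x i)) : ℝ≥0∞))⁻¹
  else 0

/-- `P` is the joint law of a sequence of independent random walks on `G`, the `j`-th walk
started at `v j`. -/
def IsIndepWalksLaw {V E : Type} [MeasurableSpace E] (G : DigraphStruct V E) (v : ℕ → V)
    (P : Measure (ℕ → ℕ → E)) : Prop :=
  P Set.univ = 1 ∧
    ∀ (m n : ℕ) (x : ℕ → ℕ → E),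
      P {ω | ∀ j < m, ∀ t < n, ω j t = x j t} =
        ∏ j ∈ Finset.range m, edgeWalkCyl G (v j) (x j) n

/-- `μ` is the law of the random walk on `G` started at `o`, recorded as its sequence of crossed
edges. -/
def IsEdgeWalkLaw {V E : Type} [MeasurableSpace E] (G : DigraphStruct V E) (o : V)
    (μ : Measure (ℕ → E)) : Prop :=
  μ Set.univ = 1 ∧ ∀ (n : ℕ) (x : ℕ → E), μ {ω | ∀ i < n, ω i = x i} = edgeWalkCyl G o x n

/-! ### Finite approximations and Gibbs measures on arboreta -/

/-- A finite digraph with vertices and edges labelled by natural numbers. -/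
structure FinDigraph where
  VS : Finset ℕ
  ES : Finset ℕ
  fsrc : ℕ → ℕ
  fdst : ℕ → ℕ

/-- `B` is a spanning in-arborescence of the finite digraph `H` rooted at `z`. -/
def FinDigraph.IsArb (H : FinDigraph) (z : ℕ) (B : Finset ℕ) : Prop :=
  B ⊆ H.ES ∧ (∀ e ∈ B, H.fsrc e ≠ z) ∧
  (∀ v ∈ H.VS, v ≠ z → ∃! e : ℕ, e ∈ B ∧ H.fsrc e = v) ∧
  (∀ v ∈ H.VS, Relation.ReflTransGen
      (fun a b => ∃ e ∈ B, H.fsrc e = a ∧ H.fdst e = b) v z)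

/-- A finite digraph `H` with a distinguished vertex `z`, together with a partial isomorphism
to a digraph on `(V, E)`: vertex and edge domains `A`, `F` in `H` and maps `φV`, `φE` to `V`, `E`. -/
structure PIso (V E : Type) where
  H : FinDigraph
  z : ℕ
  A : Finset ℕ
  F : Finset ℕ
  φV : ℕ → V
  φE : ℕ → E

/-- The data of `p` really is a partial isomorphism to `G`. -/
def PIso.Valid {V E : Type} (p : PIso V E) (G : DigraphStruct V E) : Prop :=
  ↑p.A ⊆ ↑p.H.VS ∧ ↑p.F ⊆ ↑p.H.ES ∧ p.z ∈ p.H.VS ∧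
  Set.InjOn p.φV ↑p.A ∧ Set.InjOn p.φE ↑p.F ∧
  ∀ e ∈ p.F, p.H.fsrc e ∈ p.A ∧ p.H.fdst e ∈ p.A ∧
    G.src (p.φE e) = p.φV (p.H.fsrc e) ∧ G.dst (p.φE e) = p.φV (p.H.fdst e)

/-- The partial isomorphism `p` identifies a neighbourhood of (a preimage of) `w`:
`w` is in the range of `φV` and `φE` maps the edges incident to its preimage bijectively onto
the edges incident to `w`. -/
def PIso.GoodAt {V E : Type} (p : PIso V E) (G : DigraphStruct V E) (w : V) : Prop :=
  ∃ w' ∈ p.A, p.φV w' = w ∧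
    (∀ e' ∈ p.H.ES, (p.H.fsrc e' = w' ∨ p.H.fdst e' = w') → e' ∈ p.F) ∧
    ∀ e : E, (G.src e = w ∨ G.dst e = w) →
      ∃! e' : ℕ, e' ∈ p.F ∧ (p.H.fsrc e' = w' ∨ p.H.fdst e' = w') ∧ p.φE e' = e

/-- `a` is a finite approximation to `G`: a sequence of finite digraphs with distinguished
vertices `zₙ` and partial isomorphisms to `G`, identifying larger and larger neighbourhoods of
every finite vertex set, with the distinguished vertices escaping to infinity. -/
def IsFinApproxSeq {V E : Type} (G : DigraphStruct V E) (a : ℕ → PIso V E) : Prop :=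
  (∀ n, (a n).Valid G) ∧
  (∀ W : Finset V, ∃ N, ∀ n ≥ N, ∀ w ∈ W, (a n).GoodAt G w) ∧
  (∀ W : Finset V, ∃ N, ∀ n ≥ N, ¬((a n).z ∈ (a n).A ∧ (a n).φV (a n).z ∈ (W : Set V)))

/-- The probability, under the uniform spanning in-arborescence of `p.H` rooted at `p.z`, that
every edge of `F` is in the image of the arborescence under the partial isomorphism. -/
noncomputable def pisoUACyl {V E : Type} (p : PIso V E) (F : Finset E) :
    ℝ≥0∞ :=
  (Nat.card {B : Finset ℕ // p.H.IsArb p.z B ∧ ∀ e ∈ F, ∃ e' ∈ B, e' ∈ p.F ∧ p.φE e' = e} :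
      ℝ≥0∞) /
    (Nat.card {B : Finset ℕ // p.H.IsArb p.z B} : ℝ≥0∞)

/-- `μ` (a measure on edge sets, encoded as elements of `E → Bool`) is a Gibbs measure on
spanning in-arboreta of `G` rooted at infinity: it is a weak limit of mixtures (over a random
finite approximation to `G`) of uniform spanning in-arborescence measures on finite
approximations to `G`. -/
def IsArbGibbs {V E : Type} (G : DigraphStruct V E) (μ : Measure (E → Bool)) : Prop :=
  μ Set.univ = 1 ∧
  ∃ (Ω : Type) (mΩ : MeasurableSpace Ω) (ν : @Measure Ω mΩ) (a : Ω → ℕ → PIso V E),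
    ν Set.univ = 1 ∧ (∀ ω : Ω, IsFinApproxSeq G (a ω)) ∧
    ∀ F : Finset E,
      Filter.Tendsto (fun n => ∫⁻ ω, pisoUACyl (a ω n) F ∂ν) Filter.atTop
        (nhds (μ {A : E → Bool | ∀ e ∈ F, A e = true}))

/-! ### Stacks -/

open Classical in
/-- The state (current vertex, remaining stacks) after `n` steps of following the stacks `σ`
starting from `o`: at each step we cross the edge at the front of the list at the current vertex
and delete it from the list (doing nothing if the list is empty). -/
noncomputable def stackState {V E : Type} (G : DigraphStruct V E) (o : V) (σ : V → List E) :
    ℕ → V × (V → List E)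
  | 0 => (o, σ)
  | n + 1 =>
    let p := stackState G o σ n
    match p.2 p.1 with
    | [] => p
    | e :: rest => (G.dst e, Function.update p.2 p.1 rest)

/-- The edge crossed at step `n` when following the stacks `σ` from `o` (`none` if the
current stack is exhausted). -/
noncomputable def stackEdge {V E : Type} (G : DigraphStruct V E) (o : V) (σ : V → List E)
    (n : ℕ) : Option E :=
  ((stackState G o σ n).2 (stackState G o σ n).1).head?

/-- The sigma-algebra on stack configurations. -/
noncomputable def stackMS (V E : Type) : MeasurableSpace (V → List E) :=
  @MeasurableSpace.pi V (fun _ => List E) fun _ => ⊤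

open Classical in
/-- `ρ` is the law of the random stack configuration built from a random arboretum with law `κ`:
place the arboretum edge at the bottom of the stack at each vertex, and an independent,
uniformly random ordering of the remaining outgoing edges on top of it. -/
def IsStackLaw {V E : Type} (G : DigraphStruct V E) (κ : Measure (E → Bool))
    (ρ : @Measure (V → List E) (stackMS V E)) : Prop :=
  ρ Set.univ = 1 ∧
    ∀ (K : Finset V) (s : V → List E),
      ρ {σ | ∀ v ∈ K, σ v = s v} =
        if ∀ v ∈ K, (s v).Nodup ∧ ∀ e : E, e ∈ s v ↔ G.src e = v then
          κ {A | ∀ v ∈ K, ∃ e : E, (s v).getLast? = some e ∧ A e = true} *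
            ∏ v ∈ K, (((G.outDeg v - 1).factorial : ℝ≥0∞))⁻¹
        else 0

/-! ### Markov chains -/

open Classical in
/-- `ν` is the law of the trajectory of a Markov chain with state space `S' ⊆ S`, transition
kernel `p` and deterministic initial state `s0`. -/
def IsMCLaw {S : Type} [MeasurableSpace S] (S' : Set S) (p : S → S → ℝ≥0∞) (s0 : S)
    (ν : Measure (ℕ → S)) : Prop :=
  ν Set.univ = 1 ∧ s0 ∈ S' ∧
  (∀ u ∈ S', (∑' v : S, p u v) = 1 ∧ ∀ v : S, p u v ≠ 0 → v ∈ S') ∧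
  (∀ u : S, u ∉ S' → ∀ v : S, p u v = 0) ∧
  ∀ (n : ℕ) (y : ℕ → S),
    ν {x | ∀ i ≤ n, x i = y i} =
      if y 0 = s0 then ∏ i ∈ Finset.range n, p (y i) (y (i + 1)) else 0

/-- `ν` is the law of the trajectory of a recurrent Markov chain on a subset of `S` with
non-random initial state: the chain returns to its initial state infinitely often a.s. -/
def IsRecMCLaw {S : Type} [MeasurableSpace S] (ν : Measure (ℕ → S)) : Prop :=
  ∃ (S' : Set S) (p : S → S → ℝ≥0∞) (s0 : S),
    IsMCLaw S' p s0 ν ∧ ν {x | {i : ℕ | x i = s0}.Infinite} = 1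

/-- `ν` is the law of the sequence of vertices visited by (the unique) proper Gibbs measure on
Eulerian paths from `o` to `∞` on a sourced Eulerian digraph whose vertex set is a subset
of `S`. -/
def IsGibbsVertexLaw {S : Type} [MeasurableSpace S] (ν : Measure (ℕ → S)) : Prop :=
  ∃ (Vs : Set S) (E : Type) (mE : MeasurableSpace E) (G : DigraphStruct (↥Vs) E) (o : ↥Vs),
    Countable E ∧ G.IsSourcedEulerian o ∧
    ∃ μp : @Measure (ℕ → E) (@MeasurableSpace.pi ℕ (fun _ => E) fun _ => mE),
      @ProperGibbs (↥Vs) E mE G o μp ∧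
      ∀ A : Set (ℕ → S), MeasurableSet A →
        ν A = μp ((fun (γ : ℕ → E) (i : ℕ) => ((G.src (γ i) : S))) ⁻¹' A)

/-- Concatenation of a finite list with an infinite sequence. -/
def concatSeq {S : Type} (l : List S) (y : ℕ → S) : ℕ → S :=
  fun i => if h : i < l.length then l.get ⟨i, h⟩ else y (i - l.length)

/-- `ν` is the law of a process following a uniform random Eulerian path on a finite Eulerian
digraph with source and sink whose vertex set is a subset of `S`, followed by the trajectory of
an (independent) recurrent Markov chain on a disjoint subset of `S` with non-random initial
state. -/
def IsMixedLaw {S : Type} [MeasurableSpace S] (ν : Measure (ℕ → S)) : Prop :=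
  ∃ (Vf : Finset S) (Ef : Type) (_ : Finite Ef)
    (Gf : DigraphStruct {s : S // s ∈ Vf} Ef) (of zf : {s : S // s ∈ Vf})
    (Vr : Set S) (p : S → S → ℝ≥0∞) (s1 : S) (νMC : Measure (ℕ → S)),
    IsFinEulerian Gf of zf ∧ Disjoint (↑Vf : Set S) Vr ∧
    IsMCLaw Vr p s1 νMC ∧ νMC {x | {i : ℕ | x i = s1}.Infinite} = 1 ∧
    ∀ A : Set (ℕ → S), MeasurableSet A →
      ν A =
        (∑' L : {L : List Ef // IsEulerList Gf of zf L},
            νMC ((fun y => concatSeq (((of : S)) ::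
              (L : List Ef).map fun e => ((Gf.dst e : S))) y) ⁻¹' A)) /
          (Nat.card {L : List Ef // IsEulerList Gf of zf L} : ℝ≥0∞)


/-! ### Part A : stacks of finite paths -/

/-- The successor stacks of the path `a :: p`. -/
def stk [DecidableEq S] : S → List S → S → List S
  | _, [] => fun _ => []
  | a, b :: p => Function.update (stk b p) a (b :: stk b p a)

/-- exits -/
def Exits (f : S → S) (A : Set S) (w : S) : Prop := ∃ n : ℕ, f^[n] w ∉ A

/-- following the bottoms of stacks -/
def bot (σ : S → List S) (v : S) : S := (σ v).getLastD v

theorem exits_of_notMem {f : S → S} {A : Set S} {w : S} (h : w ∉ A) : Exits f A w := ⟨0, h⟩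

theorem exits_step {f : S → S} {A : Set S} {w : S} (h : Exits f A (f w)) : Exits f A w := by
  obtain ⟨n, hn⟩ := h
  exact ⟨n + 1, by simpa [Function.iterate_succ_apply] using hn⟩

theorem exits_step_iff {f : S → S} {A : Set S} {w : S} (hw : w ∈ A) :
    Exits f A w ↔ Exits f A (f w) := by
  refine ⟨?_, exits_step⟩
  rintro ⟨n, hn⟩
  cases n with
  | zero => exact absurd hw hn
  | succ n => exact ⟨n, by simpa [Function.iterate_succ_apply] using hn⟩

theorem exits_induction {f : S → S} {A : Set S} {P : S → Prop}
    (h0 : ∀ w, w ∉ A → P w) (h1 : ∀ w, w ∈ A → P (f w) → P w) :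
    ∀ w, Exits f A w → P w := by
  rintro w ⟨n, hn⟩
  induction n generalizing w with
  | zero => exact h0 _ hn
  | succ n ih =>
    by_cases hw : w ∈ A
    · exact h1 w hw (ih (f w) (by simpa [Function.iterate_succ_apply] using hn))
    · exact h0 w hw

section
variable [DecidableEq S]

def InC (U : Finset S) (σ : S → List S) (v : S) : ℕ := ∑ u ∈ U, (σ u).count v

def RB (σ : S → List S) (v w : S) : Prop := σ v ≠ [] ∧ bot σ v = w

theorem bot_update_cons (σ : S → List S) (a b v : S) (h : σ v ≠ []) :
    bot (Function.update σ a (b :: σ a)) v = bot σ v := by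
  unfold bot
  by_cases hv : v = a
  · subst hv
    simp only [Function.update_self]
    cases hσ : σ v with
    | nil => exact absurd hσ h
    | cons x l => simp [List.getLastD_eq_getLast?]
  · simp [Function.update_of_ne hv]

theorem bot_of_head (σ : S → List S) (a b : S) (h : σ a = []) :
    bot (Function.update σ a (b :: σ a)) a = b := by
  simp [bot, h]

theorem InC_update_cons (U : Finset S) (σ : S → List S) (a b v : S) (ha : a ∈ U) :
    InC U (Function.update σ a (b :: σ a)) v = InC U σ v + if v = b then 1 else 0 := by
  unfold InC
  rw [← Finset.add_sum_erase U _ ha, ← Finset.add_sum_erase U (fun u => (σ u).count v) ha]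
  have : ∀ u ∈ U.erase a, (Function.update σ a (b :: σ a) u).count v = (σ u).count v := by
    intro u hu
    rw [Function.update_of_ne (Finset.ne_of_mem_erase hu)]
  rw [Finset.sum_congr rfl this]
  simp only [Function.update_self, List.count_cons, beq_iff_eq, eq_comm (a := b)]
  omega

theorem len_update_cons (U : Finset S) (σ : S → List S) (a b : S) (ha : a ∈ U) :
    ∑ u ∈ U, (Function.update σ a (b :: σ a) u).length = (∑ u ∈ U, (σ u).length) + 1 := by
  rw [← Finset.add_sum_erase U _ ha, ← Finset.add_sum_erase U (fun u => (σ u).length) ha]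
  have : ∀ u ∈ U.erase a, (Function.update σ a (b :: σ a) u).length = (σ u).length := by
    intro u hu
    rw [Function.update_of_ne (Finset.ne_of_mem_erase hu)]
  rw [Finset.sum_congr rfl this]
  simp only [Function.update_self, List.length_cons]
  omega

theorem stk_supp (a : S) (p : List S) (u : S) (h : stk a p u ≠ []) : u = a ∨ u ∈ p := by
  induction p generalizing a with
  | nil => simp [stk] at h
  | cons b p ih =>
    by_cases hu : u = a
    · exact Or.inl hu
    · right
      simp only [stk, Function.update_of_ne hu] at h
      rcases ih b h with h | h <;> simp [h]

theorem stk_total (U : Finset S) (a : S) (p : List S) (ha : a ∈ U) (hp : ∀ x ∈ p, x ∈ U) :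
    ∑ u ∈ U, (stk a p u).length = p.length := by
  induction p generalizing a with
  | nil => simp [stk]
  | cons b p ih =>
    rw [stk, len_update_cons U _ a b ha, ih b (hp b (by simp)) (fun x hx => hp x (by simp [hx]))]
    simp

theorem getLastD_cons' (a b : S) (p : List S) : (b :: p).getLastD a = p.getLastD b := by
  cases p with
  | nil => rfl
  | cons c p => rfl

theorem stk_balance (U : Finset S) (a : S) (p : List S) (ha : a ∈ U) (hp : ∀ x ∈ p, x ∈ U)
    (v : S) :
    InC U (stk a p) v + (if v = a then 1 else 0) =
      (stk a p v).length + if v = p.getLastD a then 1 else 0 := by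
  induction p generalizing a with
  | nil => simp [stk, InC]
  | cons b p ih =>
    have := ih b (hp b (by simp)) (fun x hx => hp x (by simp [hx]))
    rw [stk, InC_update_cons U _ a b v ha, getLastD_cons', this]
    by_cases hv : v = a
    · subst hv
      simp only [Function.update_self, List.length_cons, if_true]
      omega
    · simp [hv, Function.update_of_ne hv]

theorem RB_mono (σ : S → List S) (a b v w : S) (h : RB σ v w) :
    RB (Function.update σ a (b :: σ a)) v w := by
  refine ⟨?_, ?_⟩
  · by_cases hv : v = a
    · subst hv; simp
    · simpa [Function.update_of_ne hv] using h.1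
  · rw [bot_update_cons _ _ _ _ h.1]; exact h.2

theorem stk_tree (a : S) (p : List S) (v : S) (h : stk a p v ≠ []) :
    Relation.ReflTransGen (RB (stk a p)) v (p.getLastD a) := by
  induction p generalizing a v with
  | nil => simp [stk] at h
  | cons b p ih =>
    rw [getLastD_cons']
    have mono : ∀ x y, Relation.ReflTransGen (RB (stk b p)) x y →
        Relation.ReflTransGen (RB (stk a (b :: p))) x y := by
      intro x y hxy
      exact Relation.ReflTransGen.mono (fun x y h => RB_mono _ _ _ _ _ h) x y hxy
    by_cases hv : stk b p v = []
    · have hva : v = a := by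
        by_contra hva
        exact h (by simp [stk, Function.update_of_ne hva, hv])
      subst hva
      refine Relation.ReflTransGen.head (b := b) ⟨h, bot_of_head _ _ _ hv⟩ ?_
      by_cases hb : stk b p b = []
      · cases p with
        | nil => simpa using Relation.ReflTransGen.refl
        | cons c p => simp [stk] at hb
      · exact mono _ _ (ih b b hb)
    · exact mono _ _ (ih b v hv)

theorem stk_inj (a : S) (p q : List S) (h : stk a p = stk a q) : p = q := by
  induction p generalizing a q with
  | nil =>
    cases q with
    | nil => rfl
    | cons c q => have := congrFun h a; simp [stk] at this
  | cons b p ih =>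
    cases q with
    | nil => have := congrFun h a; simp [stk] at this
    | cons c q =>
      have h1 := congrFun h a
      simp only [stk, Function.update_self, List.cons.injEq] at h1
      obtain ⟨rfl, h2⟩ := h1
      have : stk b p = stk b q := by
        funext v
        by_cases hv : v = a
        · subst hv; exact h2
        · have := congrFun h v
          simpa [stk, Function.update_of_ne hv] using this
      rw [ih b q this]

theorem exists_path (U : Finset S) (n : ℕ) (σ : S → List S) (a z : S) (ha : a ∈ U)
    (hn : ∑ u ∈ U, (σ u).length = n) (hU : ∀ u, u ∉ U → σ u = [])
    (hσU : ∀ v, ∀ x ∈ σ v, x ∈ U)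
    (hbal : ∀ v, InC U σ v + (if v = a then 1 else 0) = (σ v).length + if v = z then 1 else 0)
    (htree : ∀ v, σ v ≠ [] → Relation.ReflTransGen (RB σ) v z) :
    ∃ p : List S, p.length = n ∧ p.getLastD a = z ∧ stk a p = σ := by
  induction n generalizing σ a with
  | zero =>
    have h0 : ∀ u, σ u = [] := by
      intro u
      by_cases hu : u ∈ U
      · have := (Finset.sum_eq_zero_iff.1 hn) u hu
        exact List.length_eq_zero_iff.1 this
      · exact hU u hu
    refine ⟨[], rfl, ?_, ?_⟩
    · have := hbal a
      simp only [InC, h0] at this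
      by_contra hne
      simp at hne
      simp [hne] at this
    · funext v; simp [stk, h0]
  | succ n ih =>
    have hσa : σ a ≠ [] := by
      intro hσa
      have hb := hbal a
      simp only [hσa, if_true, List.length_nil, zero_add] at hb
      have haz : a = z := by
        by_contra hne
        simp [hne] at hb
      subst haz
      simp only [if_true] at hb
      have hIn : InC U σ a = 0 := by omega
      obtain ⟨v, hvU, hv⟩ : ∃ v ∈ U, (σ v).length ≠ 0 := by
        by_contra hcon
        push Not at hcon
        rw [Finset.sum_eq_zero hcon] at hn
        omega
      have hv' : σ v ≠ [] := by intro h; simp [h] at hv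
      rcases Relation.ReflTransGen.cases_tail (htree v hv') with h | ⟨w, _, hw, hw2⟩
      · exact hv' (by rw [← h]; exact hσa)
      · have hwU : w ∈ U := by
          by_contra hwU
          exact hw (hU w hwU)
        have hmem : a ∈ σ w := by
          unfold bot at hw2
          rw [List.getLastD_eq_getLast?, List.getLast?_eq_some_getLast hw] at hw2
          rw [← hw2]
          exact List.getLast_mem hw
        have := (Finset.sum_eq_zero_iff.1 hIn) w hwU
        exact (List.count_pos_iff.2 hmem).ne' this
    obtain ⟨b, r, hbr⟩ := List.exists_cons_of_ne_nil hσa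
    set τ := Function.update σ a r with hτ
    have hστ : σ = Function.update τ a (b :: τ a) := by
      funext v
      by_cases hv : v = a
      · subst hv; simp [hτ, hbr]
      · simp [hτ, Function.update_of_ne hv]
    have hτU : ∀ u, u ∉ U → τ u = [] := by
      intro u hu
      have : u ≠ a := by rintro rfl; exact hu ha
      simp [hτ, Function.update_of_ne this, hU u hu]
    have hbU : b ∈ U := hσU a b (by rw [hbr]; simp)
    have hτσ : ∀ v x, x ∈ τ v → x ∈ σ v := by
      intro v x hx
      by_cases hv : v = a
      · subst hv
        rw [hbr]
        simp only [hτ, Function.update_self] at hx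
        simp [hx]
      · simpa [hτ, Function.update_of_ne hv] using hx
    have hbal' : ∀ v, InC U τ v + (if v = b then 1 else 0) =
        (τ v).length + if v = z then 1 else 0 := by
      intro v
      have h1 := hbal v
      rw [hστ, InC_update_cons U τ a b v ha] at h1
      by_cases hv : v = a
      · subst hv
        simp only [Function.update_self, List.length_cons, if_true] at h1
        omega
      · rw [Function.update_of_ne hv] at h1
        simp only [hv, if_false, add_zero] at h1
        exact h1
    have htree' : ∀ v, τ v ≠ [] → Relation.ReflTransGen (RB τ) v z := by
      have key : ∀ v, Relation.ReflTransGen (RB σ) v z →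
          (v = z ∨ τ v ≠ []) → Relation.ReflTransGen (RB τ) v z := by
        intro v hv0
        induction hv0 using Relation.ReflTransGen.head_induction_on with
        | refl => intro _; exact Relation.ReflTransGen.refl
        | @head v w hvw _ ihh =>
          intro h
          rcases h with rfl | h
          · exact Relation.ReflTransGen.refl
          · have hb : bot σ v = bot τ v := by rw [hστ]; exact bot_update_cons τ a b v h
            have hw : bot τ v = w := by rw [← hb]; exact hvw.2
            refine Relation.ReflTransGen.head ⟨h, hw⟩ (ihh ?_)
            by_cases hwz : w = z
            · exact Or.inl hwz
            · right
              intro hwe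
              have hbw := hbal' w
              simp only [hwe, hwz, if_false, List.length_nil, add_zero] at hbw
              have hmem : w ∈ τ v := by
                rw [← hw]
                unfold bot
                rw [List.getLastD_eq_getLast?, List.getLast?_eq_some_getLast h]
                exact List.getLast_mem h
              have hvU : v ∈ U := by
                by_contra hvU
                exact h (hτU v hvU)
              have h0 : InC U τ w = 0 := by omega
              have := (Finset.sum_eq_zero_iff.1 h0) v hvU
              exact (List.count_pos_iff.2 hmem).ne' this
      intro v hv
      refine key v (htree v ?_) (Or.inr hv)
      intro h
      obtain ⟨x, hx⟩ := List.exists_mem_of_ne_nil _ hv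
      have := hτσ v x hx
      rw [h] at this
      simp at this
    have hn' : ∑ u ∈ U, (τ u).length = n := by
      rw [hστ, len_update_cons U τ a b ha] at hn
      omega
    obtain ⟨p, hp1, hp2, hp3⟩ := ih τ b hbU hn' hτU (fun v x hx => hσU v x (hτσ v x hx))
      hbal' htree'
    refine ⟨b :: p, by simp [hp1], by rw [getLastD_cons']; exact hp2, ?_⟩
    rw [stk, hp3, ← hστ]

theorem bot_mem (σ : S → List S) (v : S) (h : σ v ≠ []) : bot σ v ∈ σ v := by
  unfold bot
  rw [List.getLastD_eq_getLast?, List.getLast?_eq_some_getLast h]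
  exact List.getLast_mem h

theorem stk_mem (a : S) (p : List S) (u x : S) (h : x ∈ stk a p u) : x ∈ p := by
  induction p generalizing a with
  | nil => simp [stk] at h
  | cons b p ih =>
    by_cases hu : u = a
    · subst hu
      simp only [stk, Function.update_self, List.mem_cons] at h
      rcases h with h | h
      · simp [h]
      · simp [ih b h]
    · simp only [stk, Function.update_of_ne hu] at h
      simp [ih b h]

theorem stk_swap (a : S) (p : List S) (D : Set S) [DecidablePred (· ∈ D)] (hz : p.getLastD a ∉ D)
    (hPC : ∀ u, stk a p u ≠ [] → bot (stk a p) u ∈ D → u ∈ D) (c : S → List S)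
    (hc : ∀ v ∈ D, (c v).Perm (stk a p v)) (hE : ∀ v ∈ D, Exits (bot c) D v) :
    ∃ p' : List S, p'.length = p.length ∧ p'.getLastD a = p.getLastD a ∧
      stk a p' = fun v => if v ∈ D then c v else stk a p v := by
  set U : Finset S := insert a p.toFinset with hUdef
  set z := p.getLastD a with hzdef
  set σ := stk a p with hσ
  set σ' : S → List S := fun v => if v ∈ D then c v else stk a p v with hσ'
  have hperm : ∀ v, (σ' v).Perm (σ v) := by
    intro v
    by_cases hv : v ∈ D
    · simp only [hσ', hv, if_true]; exact hc v hv
    · simp only [hσ', hv, if_false]; exact List.Perm.refl _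
  have haU : a ∈ U := by simp [hUdef]
  have hpU : ∀ x ∈ p, x ∈ U := by intro x hx; simp [hUdef, hx]
  have hU : ∀ u, u ∉ U → σ' u = [] := by
    intro u hu
    by_contra h
    have h' : σ u ≠ [] := fun h' => h (by have := hperm u; rw [h'] at this; exact this.eq_nil)
    rcases stk_supp a p u h' with h1 | h1
    · exact hu (h1 ▸ haU)
    · exact hu (hpU u h1)
  have hInC : ∀ v, InC U σ' v = InC U σ v := by
    intro v
    unfold InC
    exact Finset.sum_congr rfl fun u _ => (hperm u).count_eq v
  have hbal : ∀ v, InC U σ' v + (if v = a then 1 else 0) =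
      (σ' v).length + if v = z then 1 else 0 := by
    intro v
    rw [hInC, (hperm v).length_eq]
    exact stk_balance U a p haU hpU v
  have hnext : ∀ v w, RB σ' v w → w = z ∨ σ' w ≠ [] := by
    intro v w hvw
    by_cases hwz : w = z
    · exact Or.inl hwz
    · right
      intro hwe
      have hbw := hbal w
      simp only [hwe, hwz, if_false, List.length_nil, add_zero] at hbw
      have hmem : w ∈ σ' v := by rw [← hvw.2]; exact bot_mem σ' v hvw.1
      have hvU : v ∈ U := by
        by_contra hvU
        exact hvw.1 (hU v hvU)
      have h0 : InC U σ' w = 0 := by omega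
      have := (Finset.sum_eq_zero_iff.1 h0) v hvU
      exact (List.count_pos_iff.2 hmem).ne' this
  have key1 : ∀ y, Relation.ReflTransGen (RB σ) y z → y ∉ D →
      Relation.ReflTransGen (RB σ') y z := by
    intro y hy
    induction hy using Relation.ReflTransGen.head_induction_on with
    | refl => intro _; exact Relation.ReflTransGen.refl
    | @head y w hyw _ ihh =>
      intro hyD
      have hwD : w ∉ D := by
        intro hw
        exact hyD (hPC y hyw.1 (by rw [hyw.2]; exact hw))
      refine Relation.ReflTransGen.head ?_ (ihh hwD)
      have : σ' y = σ y := by simp [hσ', hyD, hσ]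
      refine ⟨by rw [this]; exact hyw.1, ?_⟩
      unfold bot
      rw [this]
      exact hyw.2
  have key2 : ∀ v, Exits (bot c) D v → (v = z ∨ σ' v ≠ []) →
      Relation.ReflTransGen (RB σ') v z := by
    apply exits_induction
    · intro w hw h
      rcases h with rfl | h
      · exact Relation.ReflTransGen.refl
      · refine key1 w (stk_tree a p w ?_) hw
        simpa [hσ', hw] using h
    · intro w hw ih h
      have hw' : σ' w ≠ [] := by
        rcases h with rfl | h
        · exact absurd hw hz
        · exact h
      have hr : RB σ' w (bot c w) := by
        refine ⟨hw', ?_⟩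
        unfold bot
        simp [hσ', hw]
      exact Relation.ReflTransGen.head hr (ih (hnext _ _ hr))
  have htree : ∀ v, σ' v ≠ [] → Relation.ReflTransGen (RB σ') v z := by
    intro v hv
    refine key2 v ?_ (Or.inr hv)
    by_cases hvD : v ∈ D
    · exact hE v hvD
    · exact exits_of_notMem hvD
  have hn : ∑ u ∈ U, (σ' u).length = p.length := by
    rw [← stk_total U a p haU hpU]
    exact Finset.sum_congr rfl fun u _ => (hperm u).length_eq
  have hσU : ∀ v, ∀ x ∈ σ' v, x ∈ U := by
    intro v x hx
    exact hpU x (stk_mem a p v x ((hperm v).mem_iff.1 hx))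
  exact exists_path U p.length σ' a z haU hn hU hσU hbal htree

end


/-! ### Part B : forests and harmonic functions -/

section
open Classical

/-- exit point -/
noncomputable def xpt (f : S → S) (A : Set S) (w : S) : S :=
  if h : Exits f A w then f^[Nat.find h] w else w

theorem xpt_of_notMem {f : S → S} {A : Set S} {w : S} (h : w ∉ A) : xpt f A w = w := by
  have h' : Exits f A w := exits_of_notMem h
  unfold xpt
  rw [dif_pos h']
  have : Nat.find h' = 0 := by exact (Nat.find_eq_zero (p := fun n => f^[n] w ∉ A) h').2 h
  rw [this]; rfl

theorem xpt_step {f : S → S} {A : Set S} {w : S} (hw : w ∈ A) (h : Exits f A (f w)) :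
    xpt f A w = xpt f A (f w) := by
  have h' : Exits f A w := exits_step h
  unfold xpt
  rw [dif_pos h', dif_pos h]
  have : Nat.find h' = Nat.find h + 1 := Nat.find_comp_succ h' h (by simpa using hw)
  rw [this, Function.iterate_succ_apply]

theorem xpt_notMem {f : S → S} {A : Set S} : ∀ w, Exits f A w → xpt f A w ∉ A := by
  intro w h
  unfold xpt
  rw [dif_pos h]
  exact Nat.find_spec h

theorem exits_fix {f : S → S} {A : Set S} (hf : ∀ w, w ∉ A → f w = w) {w : S} {n : ℕ}
    (h : f^[n] w ∉ A) (m : ℕ) : f^[n + m] w = f^[n] w := by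
  induction m with
  | zero => rfl
  | succ m ih => rw [← add_assoc, Function.iterate_succ_apply', ih, hf _ h]

theorem no_cycle {f : S → S} {A : Set S} (hf : ∀ w, w ∉ A → f w = w) {v : S} (hv : v ∈ A)
    (hE : Exits f A v) (n : ℕ) : f^[n] (f v) ≠ v := by
  intro h
  have hp : Function.IsPeriodicPt f (n + 1) v := by
    rw [← Function.iterate_succ_apply] at h; exact h
  obtain ⟨k, hk⟩ := hE
  have h1 : f^[(n + 1) * k] v = v := hp.mul_const k
  have h2 : (n + 1) * k = k + n * k := by ring
  rw [h2, exits_fix hf hk] at h1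
  exact hk (by rw [h1]; exact hv)

theorem xpt_iter {f : S → S} {A : Set S} (hf : ∀ w, w ∉ A → f w = w)
    (hE : ∀ w, Exits f A w) (w : S) (n : ℕ) : xpt f A (f^[n] w) = xpt f A w := by
  induction n generalizing w with
  | zero => rfl
  | succ n ih =>
    rw [Function.iterate_succ_apply, ih]
    by_cases hw : w ∈ A
    · exact (xpt_step hw (hE _)).symm
    · rw [hf w hw]

/-- the paths of `f` and `f'` from `w` coincide unless they hit `v` -/
theorem dichot {f f' : S → S} {A : Set S} {v : S} (hff : ∀ w, w ≠ v → f' w = f w) :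
    ∀ w, Exits f A w → (Exits f' A w ∧ xpt f A w = xpt f' A w) ∨ ∃ n, f^[n] w = v := by
  suffices h : ∀ w, Exits f A w → Exits f A w ∧
      ((Exits f' A w ∧ xpt f A w = xpt f' A w) ∨ ∃ n, f^[n] w = v) from
    fun w hw => (h w hw).2
  apply exits_induction
  · intro w hw
    exact ⟨exits_of_notMem hw, Or.inl ⟨exits_of_notMem hw, by
      rw [xpt_of_notMem hw, xpt_of_notMem hw]⟩⟩
  · rintro w hw ⟨hE, h⟩
    refine ⟨exits_step hE, ?_⟩
    by_cases hwv : w = v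
    · exact Or.inr ⟨0, hwv⟩
    · rcases h with ⟨h1, h2⟩ | ⟨n, hn⟩
      · left
        rw [← hff w hwv] at h1
        refine ⟨exits_step h1, ?_⟩
        rw [xpt_step hw hE, xpt_step hw h1, h2, hff w hwv]
      · exact Or.inr ⟨n + 1, by rw [Function.iterate_succ_apply]; exact hn⟩

/-- configurations on `A` -/
noncomputable def Conf (K : S → Finset (List S)) (A : Finset S) : Finset (S → List S) :=
  (A.pi K).image (fun f v => if h : v ∈ A then f v h else [])

theorem mem_Conf {K : S → Finset (List S)} {A : Finset S} {c : S → List S} :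
    c ∈ Conf K A ↔ (∀ v ∈ A, c v ∈ K v) ∧ ∀ v, v ∉ A → c v = [] := by
  unfold Conf
  rw [Finset.mem_image]
  constructor
  · rintro ⟨f, hf, rfl⟩
    rw [Finset.mem_pi] at hf
    refine ⟨fun v hv => ?_, fun v hv => ?_⟩
    · simp only [hv, dif_pos]; exact hf v hv
    · simp only [hv, dif_neg, not_false_eq_true]
  · rintro ⟨h1, h2⟩
    refine ⟨fun v _ => c v, Finset.mem_pi.2 (fun v hv => h1 v hv), ?_⟩
    funext v
    by_cases hv : v ∈ A
    · simp [hv]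
    · simp [hv, h2 v hv]

/-- forests on `A` -/
noncomputable def FA (K : S → Finset (List S)) (A : Finset S) : Finset (S → List S) :=
  (Conf K A).filter (fun c => ∀ w ∈ A, Exits (bot c) (A : Set S) w)

theorem mem_FA {K : S → Finset (List S)} {A : Finset S} {c : S → List S} :
    c ∈ FA K A ↔ (∀ v ∈ A, c v ∈ K v) ∧ (∀ v, v ∉ A → c v = []) ∧
      ∀ w, Exits (bot c) (A : Set S) w := by
  unfold FA
  rw [Finset.mem_filter, mem_Conf, and_assoc]
  refine and_congr_right fun _ => and_congr_right fun _ => ⟨fun h w => ?_, fun h w _ => h w⟩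
  by_cases hw : w ∈ A
  · exact h w hw
  · exact exits_of_notMem (by simpa using hw)

theorem bot_fix {c : S → List S} {A : Finset S} (h : ∀ v, v ∉ A → c v = []) :
    ∀ w, w ∉ (A : Set S) → bot c w = w := by
  intro w hw
  simp [bot, h w (by simpa using hw)]

theorem bot_update_ne (c : S → List S) (v : S) (e : List S) (w : S) (h : w ≠ v) :
    bot (Function.update c v e) w = bot c w := by
  simp [bot, Function.update_of_ne h]

theorem bot_update_self (c : S → List S) (v : S) (e : List S) :
    bot (Function.update c v e) v = e.getLastD v := by
  simp [bot]

/-- unnormalised expectation of the exit point -/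
noncomputable def NN (K : S → Finset (List S)) (A : Finset S) (φ : S → ℝ) (w : S) : ℝ :=
  ∑ c ∈ FA K A, φ (xpt (bot c) (A : Set S) w)

theorem harmonic (K : S → Finset (List S)) (A : Finset S) (φ : S → ℝ) (v : S) (hv : v ∈ A) :
    ((K v).card : ℝ) * NN K A φ v = ∑ e ∈ K v, NN K A φ (e.getLastD v) := by
  have main : ∑ x ∈ FA K A ×ˢ K v, (φ (xpt (bot x.1) (A : Set S) (x.2.getLastD v)) -
      φ (xpt (bot x.1) (A : Set S) v)) = 0 := by
    have hvA : v ∈ (A : Set S) := by simpa using hv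
    have hT : ∀ (c : S → List S) (e : List S), c ∈ FA K A → e ∈ K v →
        Function.update c v e ∉ FA K A →
        xpt (bot c) (A : Set S) (e.getLastD v) = xpt (bot c) (A : Set S) v := by
          intro c e hc he hu
          have hc' := mem_FA.1 hc
          rcases dichot (f := bot c) (f' := bot (Function.update c v e)) (v := v)
            (fun w hw => (bot_update_ne c v e w hw)) (e.getLastD v) (hc'.2.2 _) with h | ⟨n, h⟩
          · exfalso
            apply hu
            have hEv : Exits (bot (Function.update c v e)) (A : Set S) v := by
              apply exits_step
              rw [bot_update_self]
              exact h.1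
            refine mem_FA.2 ⟨?_, ?_, ?_⟩
            · intro w hw
              by_cases hwv : w = v
              · subst hwv; simpa using he
              · rw [Function.update_of_ne hwv]; exact hc'.1 w hw
            · intro w hw
              have hwv : w ≠ v := by rintro rfl; exact hw hv
              rw [Function.update_of_ne hwv]; exact hc'.2.1 w hw
            · intro w
              refine exits_induction (f := bot c) (A := (A : Set S))
                (P := fun w => Exits (bot (Function.update c v e)) (A : Set S) w)
                (fun w hw => exits_of_notMem hw) ?_ w (hc'.2.2 w)
              intro w hw ih
              by_cases hwv : w = v
              · subst hwv; exact hEv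
              · apply exits_step
                rw [bot_update_ne _ _ _ _ hwv]
                exact ih
          · rw [← xpt_iter (bot_fix hc'.2.1) hc'.2.2 (e.getLastD v) n, h]
    refine Finset.sum_involution
      (fun x _ => if Function.update x.1 v x.2 ∈ FA K A then (Function.update x.1 v x.2, x.1 v)
        else x) ?_ ?_ ?_ ?_
    · rintro ⟨c, e⟩ hx
      rw [Finset.mem_product] at hx
      obtain ⟨hc, he⟩ := hx
      simp only at hc he ⊢
      have hc' := mem_FA.1 hc
      by_cases hu : Function.update c v e ∈ FA K A
      · simp only [if_pos hu]
        have hu' := mem_FA.1 hu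
        have hb : bot (Function.update c v e) v = e.getLastD v := bot_update_self c v e
        have e1 : xpt (bot (Function.update c v e)) (A : Set S) (e.getLastD v) =
            xpt (bot c) (A : Set S) (e.getLastD v) := by
          rcases dichot (f := bot (Function.update c v e)) (f' := bot c) (v := v)
            (fun w hw => (bot_update_ne c v e w hw).symm) (e.getLastD v) (hu'.2.2 _) with h | ⟨n, h⟩
          · exact h.2
          · rw [← hb] at h
            exact absurd h (no_cycle (bot_fix hu'.2.1) hvA (hu'.2.2 _) n)
        have e2 : xpt (bot c) (A : Set S) (bot c v) =
            xpt (bot (Function.update c v e)) (A : Set S) (bot c v) := by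
          rcases dichot (f := bot c) (f' := bot (Function.update c v e)) (v := v)
            (fun w hw => (bot_update_ne c v e w hw)) (bot c v) (hc'.2.2 _) with h | ⟨n, h⟩
          · exact h.2
          · exact absurd h (no_cycle (bot_fix hc'.2.1) hvA (hc'.2.2 _) n)
        rw [xpt_step (f := bot c) hvA (hc'.2.2 _),
          xpt_step (f := bot (Function.update c v e)) hvA (hu'.2.2 _), hb, e1, e2]
        change _ + (φ (xpt (bot (Function.update c v e)) (A : Set S) (bot c v)) - _) = 0
        ring
      · simp only [if_neg hu]
        rw [hT c e hc he hu]
        ring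
    · rintro ⟨c, e⟩ hx hne heq
      apply hne
      rw [Finset.mem_product] at hx
      have hc' := mem_FA.1 hx.1
      by_cases hu : Function.update c v e ∈ FA K A
      · simp only [if_pos hu, Prod.mk.injEq] at heq
        simp only at hc' ⊢
        rw [xpt_step (f := bot c) hvA (hc'.2.2 _)]
        have : bot c v = e.getLastD v := by rw [← heq.2]; rfl
        rw [this]
        ring
      · exfalso
        simp only at hne
        apply hne
        rw [hT c e hx.1 hx.2 hu]
        ring
    · rintro ⟨c, e⟩ hx
      rw [Finset.mem_product] at hx
      by_cases hu : Function.update c v e ∈ FA K A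
      · simp only [if_pos hu]
        exact Finset.mem_product.2 ⟨hu, (mem_FA.1 hx.1).1 v hv⟩
      · simp only [if_neg hu]
        exact Finset.mem_product.2 hx
    · rintro ⟨c, e⟩ hx
      rw [Finset.mem_product] at hx
      by_cases hu : Function.update c v e ∈ FA K A
      · simp [if_pos hu, hx.1]
      · simp only [if_neg hu]
  rw [Finset.sum_sub_distrib, Finset.sum_product_right, Finset.sum_product_right,
    sub_eq_zero] at main
  unfold NN
  rw [main]
  simp only [Finset.sum_const, nsmul_eq_mul]

theorem max_principle (K : S → Finset (List S)) (A : Finset S) (δ : S → ℝ)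
    (hδ : ∀ v ∈ A, ((K v).card : ℝ) * δ v = ∑ e ∈ K v, δ (e.getLastD v))
    (hoff : ∀ v, v ∉ A → δ v ≤ 0) (hne : (FA K A).Nonempty) : ∀ w, δ w ≤ 0 := by
  intro w0
  by_cases hA : A.Nonempty
  · obtain ⟨v, hv, hmax⟩ := A.exists_max_image δ hA
    by_cases hpos : δ v ≤ 0
    · by_cases hw : w0 ∈ A
      · exact (hmax w0 hw).trans hpos
      · exact hoff w0 hw
    · exfalso
      push Not at hpos
      have hle : ∀ w, δ w ≤ δ v := by
        intro w
        by_cases hw : w ∈ A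
        · exact hmax w hw
        · exact (hoff w hw).trans hpos.le
      obtain ⟨c, hc⟩ := hne
      have hc' := mem_FA.1 hc
      refine exits_induction (f := bot c) (A := (A : Set S)) (P := fun w => δ w ≠ δ v) ?_ ?_ v
        (hc'.2.2 v) rfl
      · intro w hw h
        have := hoff w (by simpa using hw)
        linarith
      · intro w hw h hwv
        apply h
        have hwA : w ∈ A := by simpa using hw
        have h1 := hδ w hwA
        have h2 : ∑ e ∈ K w, (δ v - δ (e.getLastD w)) = 0 := by
          rw [Finset.sum_sub_distrib, ← h1, hwv, Finset.sum_const, nsmul_eq_mul, sub_self]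
        have h3 := (Finset.sum_eq_zero_iff_of_nonneg
          (fun e _ => sub_nonneg.2 (hle _))).1 h2 (c w) (hc'.1 w hwA)
        have : bot c w = (c w).getLastD w := rfl
        rw [this]
        linarith
  · rw [Finset.not_nonempty_iff_eq_empty] at hA
    exact hoff w0 (by simp [hA])

end


/-! ### Part C : the ratio rho -/

section
open Classical

noncomputable def phi (o : S) (x : S) : ℝ := if x = o then 0 else 1

theorem NN_phi (K : S → Finset (List S)) (A : Finset S) (o w : S) :
    NN K A (phi o) w = ((FA K A).filter (fun c => xpt (bot c) (A : Set S) w ≠ o)).card := by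
  unfold NN phi
  rw [Finset.card_filter]
  push_cast
  refine Finset.sum_congr rfl fun c _ => ?_
  by_cases h : xpt (bot c) (A : Set S) w = o <;> simp [h]

theorem val_count (K : S → Finset (List S)) (D : Finset S) (o : S) (ho : o ∈ D) (s : List S)
    (hs : s ∈ K o) :
    (((FA K D).filter (fun c => c o = s)).card : ℝ) =
      NN K (D.erase o) (phi o) (s.getLastD o) := by
  rw [NN_phi, Nat.cast_inj]
  have hoA : o ∉ ((D.erase o : Finset S) : Set S) := by simp
  have hoD : o ∈ (D : Set S) := by simpa using ho
  refine Finset.card_nbij' (fun c => Function.update c o []) (fun c => Function.update c o s)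
    ?_ ?_ ?_ ?_
  · intro c hc
    simp only [Finset.coe_filter, Set.mem_ofPred_eq] at hc ⊢
    obtain ⟨hc, hco⟩ := hc
    have hc' := mem_FA.1 hc
    have hex : ∀ w, Exits (bot (Function.update c o [])) ((D.erase o : Finset S) : Set S) w := by
      intro w
      refine exits_induction (f := bot c) (A := (D : Set S))
        (P := fun w => Exits (bot (Function.update c o [])) ((D.erase o : Finset S) : Set S) w)
        ?_ ?_ w (hc'.2.2 w)
      · intro w hw
        exact exits_of_notMem (by simp at hw ⊢; tauto)
      · intro w hw ih
        by_cases hwo : w = o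
        · subst hwo; exact exits_of_notMem hoA
        · apply exits_step
          rw [bot_update_ne _ _ _ _ hwo]; exact ih
    refine ⟨mem_FA.2 ⟨?_, ?_, hex⟩, ?_⟩
    · intro v hv
      rw [Function.update_of_ne (Finset.ne_of_mem_erase hv)]
      exact hc'.1 v (Finset.mem_of_mem_erase hv)
    · intro v hv
      by_cases hvo : v = o
      · subst hvo; simp
      · rw [Function.update_of_ne hvo]
        exact hc'.2.1 v (fun h => hv (Finset.mem_erase.2 ⟨hvo, h⟩))
    · have key : ∀ w, Exits (bot (Function.update c o [])) ((D.erase o : Finset S) : Set S) w →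
          xpt (bot (Function.update c o [])) ((D.erase o : Finset S) : Set S) w = o →
            ∃ n, (bot c)^[n] w = o := by
        apply exits_induction
        · intro w hw h
          rw [xpt_of_notMem hw] at h
          exact ⟨0, h⟩
        · intro w hw ih h
          rw [xpt_step hw (hex _)] at h
          obtain ⟨n, hn⟩ := ih h
          have hwo : w ≠ o := by rintro rfl; exact hoA hw
          rw [bot_update_ne _ _ _ _ hwo] at hn
          exact ⟨n + 1, by rw [Function.iterate_succ_apply]; exact hn⟩
      intro h
      obtain ⟨n, hn⟩ := key _ (hex _) h
      have : s.getLastD o = bot c o := by rw [← hco]; rfl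
      rw [this] at hn
      exact no_cycle (bot_fix hc'.2.1) hoD (hc'.2.2 _) n hn
  · intro c hc
    simp only [Finset.coe_filter, Set.mem_ofPred_eq] at hc ⊢
    obtain ⟨hc, hco⟩ := hc
    have hc' := mem_FA.1 hc
    have h1 : ∀ w, Exits (bot c) ((D.erase o : Finset S) : Set S) w →
        xpt (bot c) ((D.erase o : Finset S) : Set S) w ≠ o →
          Exits (bot (Function.update c o s)) (D : Set S) w := by
      apply exits_induction
      · intro w hw h
        rw [xpt_of_notMem hw] at h
        exact exits_of_notMem (by simp at hw ⊢; tauto)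
      · intro w hw ih h
        rw [xpt_step hw (hc'.2.2 _)] at h
        have hwo : w ≠ o := by rintro rfl; exact hoA hw
        apply exits_step
        rw [bot_update_ne _ _ _ _ hwo]
        exact ih h
    have h2 : Exits (bot (Function.update c o s)) (D : Set S) o := by
      apply exits_step
      rw [bot_update_self]
      exact h1 _ (hc'.2.2 _) hco
    refine ⟨mem_FA.2 ⟨?_, ?_, ?_⟩, by simp⟩
    · intro v hv
      by_cases hvo : v = o
      · subst hvo; simpa using hs
      · rw [Function.update_of_ne hvo]
        exact hc'.1 v (Finset.mem_erase.2 ⟨hvo, hv⟩)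
    · intro v hv
      have hvo : v ≠ o := by rintro rfl; exact hv ho
      rw [Function.update_of_ne hvo]
      exact hc'.2.1 v (fun h => hv (Finset.mem_of_mem_erase h))
    · intro w
      refine exits_induction (f := bot c) (A := ((D.erase o : Finset S) : Set S))
        (P := fun w => Exits (bot (Function.update c o s)) (D : Set S) w) ?_ ?_ w (hc'.2.2 w)
      · intro w hw
        by_cases hwo : w = o
        · subst hwo; exact h2
        · exact exits_of_notMem (by simp at hw ⊢; tauto)
      · intro w hw ih
        have hwo : w ≠ o := by rintro rfl; exact hoA hw
        apply exits_step
        rw [bot_update_ne _ _ _ _ hwo]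
        exact ih
  · intro c hc
    simp only [Finset.coe_filter, Set.mem_ofPred_eq] at hc
    simp [← hc.2]
  · intro c hc
    simp only [Finset.coe_filter, Set.mem_ofPred_eq] at hc
    have := (mem_FA.1 hc.1).2.1 o (by simp)
    simp [← this]

/-- sum over forests of a function of the stack at `o` -/
theorem val_sum (K : S → Finset (List S)) (D : Finset S) (o : S) (ho : o ∈ D)
    (P : List S → Prop) :
    (((FA K D).filter (fun c => P (c o))).card : ℝ) =
      ∑ s ∈ (K o).filter P, NN K (D.erase o) (phi o) (s.getLastD o) := by
  rw [Finset.card_eq_sum_card_fiberwise (f := fun c => c o) (t := (K o).filter P)]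
  · push_cast
    refine Finset.sum_congr rfl fun s hs => ?_
    rw [Finset.mem_filter] at hs
    rw [← val_count K D o ho s hs.1, Finset.filter_filter]
    congr 2
    ext c
    simp only [Finset.mem_filter]
    constructor
    · rintro ⟨h1, _, h3⟩; exact ⟨h1, h3⟩
    · rintro ⟨h1, h3⟩; exact ⟨h1, h3 ▸ hs.2, h3⟩
  · intro c hc
    simp only [Finset.coe_filter, Set.mem_ofPred_eq] at hc ⊢
    exact ⟨(mem_FA.1 hc.1).1 o ho, hc.2⟩

/-- permutations of the reference stack -/
noncomputable def Kb (b : S → List S) (v : S) : Finset (List S) := (b v).permutations.toFinset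

theorem mem_Kb {b : S → List S} {v : S} {e : List S} : e ∈ Kb b v ↔ e.Perm (b v) := by
  simp [Kb]

theorem sum_getD (g : S → ℝ) (v : S) (e : List S) :
    (e.map g).sum = ∑ i ∈ Finset.range e.length, g (e.getD i v) := by
  induction e with
  | nil => simp
  | cons x e ih => simp [Finset.sum_range_succ', ih, add_comm]

theorem perm_avg (b : S → List S) (v : S) (g : S → ℝ) :
    (∑ e ∈ Kb b v, g (e.getLastD v)) * (b v).length = (Kb b v).card * ((b v).map g).sum := by
  have h1 : ∑ e ∈ Kb b v, (e.map g).sum = (Kb b v).card * ((b v).map g).sum := by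
    rw [← nsmul_eq_mul]
    refine Finset.sum_eq_card_nsmul fun e he => ?_
    exact ((mem_Kb.1 he).map g).sum_eq
  have h2 : ∀ i ∈ Finset.range (b v).length,
      ∑ e ∈ Kb b v, g (e.getD i v) = ∑ e ∈ Kb b v, g (e.getLastD v) := by
    intro i hi
    rw [Finset.mem_range] at hi
    have h3 : ∑ e ∈ Kb b v, g (e.getD i v) = ∑ e ∈ Kb b v, g (e.headD v) := by
      refine Finset.sum_bij (fun e _ => e.rotate i) ?_ ?_ ?_ ?_
      · intro e he
        exact mem_Kb.2 ((List.rotate_perm e i).trans (mem_Kb.1 he))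
      · intro e _ e' _ h
        exact List.rotate_injective i h
      · intro e he
        obtain ⟨k, hk⟩ := (List.IsRotated.symm ⟨i, rfl⟩ : (e.rotate i) ~r e)
        have hlen : i ≤ e.length := by rw [(mem_Kb.1 he).length_eq]; exact hi.le
        refine ⟨e.rotate (e.length - i), ?_, ?_⟩
        · exact mem_Kb.2 ((List.rotate_perm e _).trans (mem_Kb.1 he))
        · rw [List.rotate_rotate, Nat.sub_add_cancel hlen, List.rotate_length]
      · intro e he
        have hlen : i < e.length := by rw [(mem_Kb.1 he).length_eq]; exact hi
        congr 1
        have := List.head?_rotate hlen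
        rw [List.headD_eq_head?_getD, this]
        simp [List.getD_eq_getElem?_getD]
    have h4 : ∑ e ∈ Kb b v, g (e.getLastD v) = ∑ e ∈ Kb b v, g (e.headD v) := by
      refine Finset.sum_bij (fun e _ => e.reverse) ?_ ?_ ?_ ?_
      · intro e he
        exact mem_Kb.2 ((List.reverse_perm e).trans (mem_Kb.1 he))
      · intro e _ e' _ h
        exact List.reverse_injective h
      · intro e he
        exact ⟨e.reverse, mem_Kb.2 ((List.reverse_perm e).trans (mem_Kb.1 he)), by simp⟩
      · intro e he
        congr 1
        rw [List.headD_eq_head?_getD, List.head?_reverse, List.getLastD_eq_getLast?]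
    rw [h3, h4]
  rw [← h1, mul_comm, ← nsmul_eq_mul, ← Finset.card_range (b v).length, ← Finset.sum_const,
    ← Finset.sum_congr rfl h2, Finset.sum_comm]
  refine Finset.sum_congr rfl fun e he => ?_
  rw [sum_getD g v e, (mem_Kb.1 he).length_eq]

end


/-! ### Part D : convergence of rho -/

section
open Classical

structure Sys (V : Set S) (o : S) (b : S → List S) : Prop where
  ho : o ∈ V
  hne : ∀ v ∈ V, b v ≠ []
  rank : ∃ r : S → ℕ, ∀ v ∈ V, r v < r (bot b v)
  flow : ∀ D : Finset S, (D : Set S) ⊆ V → ∀ u ∈ V,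
    (∑ v ∈ D, (b v).count u) + (if u = o then 1 else 0) ≤ (b u).length

variable {V : Set S} {o : S} {b : S → List S}

theorem Sys.FA_nonempty (h : Sys V o b) (D : Finset S) (hD : (D : Set S) ⊆ V) :
    (FA (Kb b) D).Nonempty := by
  obtain ⟨r, hr⟩ := h.rank
  refine ⟨fun v => if v ∈ D then b v else [], mem_FA.2 ⟨?_, ?_, ?_⟩⟩
  · intro v hv
    simp only [hv, if_true]
    exact mem_Kb.2 (List.Perm.refl _)
  · intro v hv
    simp [hv]
  · intro w
    set c : S → List S := fun v => if v ∈ D then b v else [] with hc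
    by_contra hcon
    have hin : ∀ n, (bot c)^[n] w ∈ D := by
      intro n
      by_contra hn
      exact hcon ⟨n, by simpa using hn⟩
    have hbot : ∀ v ∈ D, bot c v = bot b v := by
      intro v hv
      simp [bot, hc, hv]
    have hlt : ∀ n, n ≤ r ((bot c)^[n] w) := by
      intro n
      induction n with
      | zero => exact Nat.zero_le _
      | succ n ih =>
        rw [Function.iterate_succ_apply', hbot _ (hin n)]
        have := hr _ (hD (by simpa using hin n))
        omega
    have h1 := hlt (D.sup r + 1)
    have h2 : r ((bot c)^[D.sup r + 1] w) ≤ D.sup r := Finset.le_sup (hin _)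
    omega

/-- normalised -/
noncomputable def HH (b : S → List S) (o : S) (D : Finset S) (w : S) : ℝ :=
  NN (Kb b) (D.erase o) (phi o) w / ((FA (Kb b) (D.erase o)).card : ℝ)

theorem phi_nonneg (o x : S) : 0 ≤ phi o x := by unfold phi; split_ifs <;> norm_num
theorem phi_le (o x : S) : phi o x ≤ 1 := by unfold phi; split_ifs <;> norm_num

theorem HH_nonneg (b : S → List S) (o : S) (D : Finset S) (w : S) : 0 ≤ HH b o D w :=
  div_nonneg (Finset.sum_nonneg fun _ _ => phi_nonneg _ _) (Nat.cast_nonneg _)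

theorem HH_le (b : S → List S) (o : S) (D : Finset S) (w : S) : HH b o D w ≤ 1 := by
  unfold HH
  refine div_le_one_of_le₀ ?_ (Nat.cast_nonneg _)
  unfold NN
  refine (Finset.sum_le_card_nsmul _ _ 1 fun _ _ => phi_le _ _).trans ?_
  simp

theorem HH_harm (b : S → List S) (o : S) (D : Finset S) (v : S) (hv : v ∈ D.erase o) :
    ((Kb b v).card : ℝ) * HH b o D v = ∑ e ∈ Kb b v, HH b o D (e.getLastD v) := by
  unfold HH
  rw [← Finset.sum_div, ← harmonic _ _ _ _ hv, mul_div_assoc]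

theorem erase_sub {D : Finset S} (hD : (D : Set S) ⊆ V) : ((D.erase o : Finset S) : Set S) ⊆ V := by
  intro x hx
  exact hD (by simp at hx ⊢; exact hx.1)

theorem Sys.card_pos (h : Sys V o b) (D : Finset S) (hD : (D : Set S) ⊆ V) :
    (0 : ℝ) < ((FA (Kb b) D).card : ℝ) := by
  exact_mod_cast (h.FA_nonempty D hD).card_pos

theorem Sys.HH_off (h : Sys V o b) (D : Finset S) (hD : (D : Set S) ⊆ V) (w : S)
    (hw : w ∉ D.erase o) : HH b o D w = phi o w := by
  unfold HH NN
  have : ∀ c ∈ FA (Kb b) (D.erase o), phi o (xpt (bot c) ((D.erase o : Finset S) : Set S) w) =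
      phi o w := by
    intro c _
    rw [xpt_of_notMem (by rw [Finset.mem_coe]; exact hw)]
  rw [Finset.sum_congr rfl this, Finset.sum_const, nsmul_eq_mul, mul_div_cancel_left₀]
  exact (h.card_pos _ (erase_sub hD)).ne'

theorem Sys.HH_anti (h : Sys V o b) (D1 D2 : Finset S) (h12 : D1 ⊆ D2)
    (hD : (D2 : Set S) ⊆ V) (w : S) : HH b o D2 w ≤ HH b o D1 w := by
  have hD1 : (D1 : Set S) ⊆ V := fun x hx => hD (by simpa using h12 (by simpa using hx))
  have := max_principle (Kb b) (D1.erase o) (fun w => HH b o D2 w - HH b o D1 w) ?_ ?_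
    (h.FA_nonempty _ (erase_sub hD1)) w
  · linarith
  · intro v hv
    rw [Finset.sum_sub_distrib, ← HH_harm _ _ _ _ hv,
      ← HH_harm b o D2 v (Finset.erase_subset_erase o h12 hv)]
    ring
  · intro v hv
    rw [h.HH_off D1 hD1 v hv]
    by_cases hvo : v = o
    · subst hvo
      rw [h.HH_off D2 hD v (by simp)]
      simp
    · have : phi o v = 1 := by simp [phi, hvo]
      rw [this]
      linarith [HH_le b o D2 v]

theorem Kb_card_pos (b : S → List S) (v : S) : (0 : ℝ) < ((Kb b v).card : ℝ) := by
  have : (Kb b v).Nonempty := ⟨b v, mem_Kb.2 (List.Perm.refl _)⟩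
  exact_mod_cast this.card_pos

theorem list_sum_count (l : List S) (g : S → ℝ) (D : Finset S) (hg : ∀ x, x ∉ D → g x = 0) :
    (l.map g).sum = ∑ u ∈ D, (l.count u : ℝ) * g u := by
  induction l with
  | nil => simp
  | cons x l ih =>
    simp only [List.map_cons, List.sum_cons, ih, List.count_cons, beq_iff_eq]
    push_cast
    simp only [add_mul, Finset.sum_add_distrib, ite_mul, one_mul, zero_mul, Finset.sum_ite_eq]
    by_cases hx : x ∈ D
    · simp [hx, add_comm]
    · simp [hx, hg x hx]

theorem Sys.flow_bound (h : Sys V o b) (D : Finset S) (hD : (D : Set S) ⊆ V) (ho : o ∈ D) :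
    1 ≤ ((b o).map (HH b o D)).sum := by
  set k : S → ℝ := fun w => 1 - HH b o D w with hk
  have hk0 : ∀ w, 0 ≤ k w := fun w => by have := HH_le b o D w; simp only [hk]; linarith
  have hko : k o = 1 := by
    simp only [hk]
    rw [h.HH_off D hD o (by simp)]
    simp [phi]
  have hkoff : ∀ w, w ∉ D → k w = 0 := by
    intro w hw
    simp only [hk]
    rw [h.HH_off D hD w (fun h => hw (Finset.mem_of_mem_erase h))]
    have : w ≠ o := by rintro rfl; exact hw ho
    simp [phi, this]
  have hharm : ∀ v ∈ D.erase o, ((b v).map k).sum = (b v).length * k v := by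
    intro v hv
    have h1 := perm_avg b v k
    have h2 : ∑ e ∈ Kb b v, k (e.getLastD v) = (Kb b v).card * k v := by
      simp only [hk]
      rw [Finset.sum_sub_distrib, ← HH_harm _ _ _ _ hv]
      simp
      ring
    rw [h2] at h1
    have h3 := Kb_card_pos b v
    have : ((Kb b v).card : ℝ) * ((b v).map k).sum = (Kb b v).card * ((b v).length * k v) := by
      rw [← h1]; ring
    exact mul_left_cancel₀ h3.ne' this
  have htot : ∑ v ∈ D, ((b v).map k).sum ≤ (∑ u ∈ D, ((b u).length : ℝ) * k u) - 1 := by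
    calc ∑ v ∈ D, ((b v).map k).sum = ∑ v ∈ D, ∑ u ∈ D, ((b v).count u : ℝ) * k u :=
          Finset.sum_congr rfl fun v _ => list_sum_count _ _ _ hkoff
      _ = ∑ u ∈ D, (∑ v ∈ D, ((b v).count u : ℝ)) * k u := by
          rw [Finset.sum_comm]
          exact Finset.sum_congr rfl fun u _ => (Finset.sum_mul _ _ _).symm
      _ ≤ ∑ u ∈ D, (((b u).length : ℝ) * k u - if u = o then 1 else 0) := by
          refine Finset.sum_le_sum fun u hu => ?_
          have hf := h.flow D hD u (hD (by simpa using hu))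
          have hf' : (∑ v ∈ D, ((b v).count u : ℝ)) + (if u = o then 1 else 0) ≤
              ((b u).length : ℝ) := by
            have := (Nat.cast_le (α := ℝ)).2 hf
            push_cast at this
            exact this
          by_cases huo : u = o
          · subst huo
            simp only [if_true, hko, mul_one] at hf' ⊢
            linarith
          · simp only [huo, if_false, add_zero, sub_zero] at hf' ⊢
            exact mul_le_mul_of_nonneg_right hf' (hk0 u)
      _ = _ := by
          rw [Finset.sum_sub_distrib]
          simp [ho]
  rw [← Finset.add_sum_erase D _ ho, ← Finset.add_sum_erase D (fun u => ((b u).length : ℝ) * k u) ho,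
    Finset.sum_congr rfl hharm, hko] at htot
  have h5 : ((b o).map k).sum = (b o).length - ((b o).map (HH b o D)).sum := by
    generalize b o = l
    simp only [hk]
    induction l with
    | nil => simp
    | cons x l ih => simp [ih]; ring
  rw [h5] at htot
  linarith

theorem Sys.pos_bound (h : Sys V o b) (D : Finset S) (hD : (D : Set S) ⊆ V) (ho : o ∈ D) :
    ((Kb b o).card : ℝ) / (b o).length ≤ ∑ e ∈ Kb b o, HH b o D (e.getLastD o) := by
  have h1 := perm_avg b o (HH b o D)
  have h2 := h.flow_bound D hD ho
  have h3 : (0 : ℝ) < (b o).length := by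
    exact_mod_cast List.length_pos_of_ne_nil (h.hne o h.ho)
  rw [div_le_iff₀ h3, h1]
  have := Kb_card_pos b o
  nlinarith

/-- first entry of a stack -/
def Hd (u : S) (s : List S) : Prop := s.head? = some u

noncomputable def rho (b : S → List S) (o : S) (D : Finset S) (u : S) : ℝ :=
  (((FA (Kb b) D).filter (fun c => Hd u (c o))).card : ℝ) / ((FA (Kb b) D).card : ℝ)

theorem Sys.rho_eq (h : Sys V o b) (D : Finset S) (hD : (D : Set S) ⊆ V) (ho : o ∈ D) (u : S) :
    rho b o D u = (∑ s ∈ (Kb b o).filter (fun s => Hd u s), HH b o D (s.getLastD o)) /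
      ∑ s ∈ Kb b o, HH b o D (s.getLastD o) := by
  unfold rho
  rw [val_sum (Kb b) D o ho (fun s => Hd u s)]
  have h2 : ((FA (Kb b) D).card : ℝ) = ∑ s ∈ Kb b o, NN (Kb b) (D.erase o) (phi o) (s.getLastD o) := by
    have := val_sum (Kb b) D o ho (fun _ => True)
    simpa using this
  rw [h2]
  unfold HH
  rw [← Finset.sum_div, ← Finset.sum_div, div_div_div_cancel_right₀]
  exact (h.card_pos _ (erase_sub hD)).ne'

theorem Sys.rho_tendsto (h : Sys V o b) : ∃ ρ : S → ℝ, ∀ u, ∀ ε > 0, ∃ B : Finset S,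
    (B : Set S) ⊆ V ∧ o ∈ B ∧ ∀ D : Finset S, B ⊆ D → (D : Set S) ⊆ V →
      |rho b o D u - ρ u| < ε := by
  let T := {D : Finset S // o ∈ D ∧ (D : Set S) ⊆ V}
  have : Nonempty T := ⟨⟨{o}, by simp, by simpa using h.ho⟩⟩
  have : IsDirectedOrder T := ⟨fun x y => ⟨⟨x.1 ∪ y.1, by simp [x.2.1], by
    simpa using ⟨x.2.2, y.2.2⟩⟩, by
      change x.1 ⊆ x.1 ∪ y.1; exact Finset.subset_union_left, by
      change y.1 ⊆ x.1 ∪ y.1; exact Finset.subset_union_right⟩⟩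
  have hconv : ∀ w, Tendsto (fun D : T => HH b o D.1 w) atTop (nhds (⨅ D : T, HH b o D.1 w)) := by
    intro w
    refine tendsto_atTop_ciInf ?_ ⟨0, ?_⟩
    · intro D1 D2 h12
      exact h.HH_anti D1.1 D2.1 h12 D2.2.2 w
    · rintro x ⟨D, rfl⟩
      exact HH_nonneg _ _ _ _
  set L : S → ℝ := fun w => ⨅ D : T, HH b o D.1 w with hL
  have hden : Tendsto (fun D : T => ∑ s ∈ Kb b o, HH b o D.1 (s.getLastD o)) atTop
      (nhds (∑ s ∈ Kb b o, L (s.getLastD o))) := tendsto_finsetSum _ fun s _ => hconv _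
  have hdpos : ∑ s ∈ Kb b o, L (s.getLastD o) ≠ 0 := by
    have h1 := ge_of_tendsto' hden (fun D : T => h.pos_bound D.1 D.2.2 D.2.1)
    have h3 : (0 : ℝ) < (b o).length := by
      exact_mod_cast List.length_pos_of_ne_nil (h.hne o h.ho)
    have := div_pos (Kb_card_pos b o) h3
    linarith
  refine ⟨fun u => (∑ s ∈ (Kb b o).filter (fun s => Hd u s), L (s.getLastD o)) /
      ∑ s ∈ Kb b o, L (s.getLastD o), fun u ε hε => ?_⟩
  have ht : Tendsto (fun D : T => rho b o D.1 u) atTop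
      (nhds ((∑ s ∈ (Kb b o).filter (fun s => Hd u s), L (s.getLastD o)) /
      ∑ s ∈ Kb b o, L (s.getLastD o))) := by
    refine Tendsto.congr (fun D => (h.rho_eq D.1 D.2.2 D.2.1 u).symm) ?_
    exact (tendsto_finsetSum _ fun s _ => hconv _).div hden hdpos
  have ht2 := (Metric.tendsto_nhds.1 ht) ε hε
  rw [eventually_atTop] at ht2
  obtain ⟨B, hB⟩ := ht2
  refine ⟨B.1, B.2.2, B.2.1, fun D hBD hD => ?_⟩
  have := hB ⟨D, hBD B.2.1, hD⟩ hBD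
  rwa [Real.dist_eq] at this

end


/-! ### Part E : prefixes of infinite sequences -/

/-- the list of states visited at times `1, …, N` -/
def tl : (ℕ → S) → ℕ → List S
  | _, 0 => []
  | ω, N + 1 => ω 1 :: tl (fun i => ω (i + 1)) N

theorem tl_length (ω : ℕ → S) (N : ℕ) : (tl ω N).length = N := by
  induction N generalizing ω with
  | zero => rfl
  | succ N ih => simp [tl, ih]

theorem tl_last (ω : ℕ → S) (N : ℕ) : (tl ω N).getLastD (ω 0) = ω N := by
  induction N generalizing ω with
  | zero => rfl
  | succ N ih =>
    rw [tl, show (ω 1 :: tl (fun i => ω (i + 1)) N).getLastD (ω 0) =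
      (tl (fun i => ω (i + 1)) N).getLastD ((fun i => ω (i + 1)) 0) by
        cases tl (fun i => ω (i + 1)) N <;> rfl]
    exact ih _

theorem tl_succ (ω : ℕ → S) (N : ℕ) : tl ω (N + 1) = tl ω N ++ [ω (N + 1)] := by
  induction N generalizing ω with
  | zero => rfl
  | succ N ih =>
    rw [tl, ih, tl]
    rfl

theorem tl_eq_iff (ω ω' : ℕ → S) (N : ℕ) :
    tl ω N = tl ω' N ↔ ∀ i < N, ω (i + 1) = ω' (i + 1) := by
  induction N with
  | zero => simp [tl]
  | succ N ih =>
    rw [tl_succ, tl_succ, ← List.concat_eq_append, ← List.concat_eq_append, List.concat_inj, ih]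
    constructor
    · rintro ⟨h1, h2⟩ i hi
      rcases Nat.lt_succ_iff_lt_or_eq.1 hi with h | rfl
      · exact h1 i h
      · exact h2
    · intro h
      exact ⟨fun i hi => h i (by omega), h N (by omega)⟩

theorem exists_tl (a : S) (p : List S) : ∃ ω : ℕ → S, ω 0 = a ∧ tl ω p.length = p := by
  induction p generalizing a with
  | nil => exact ⟨fun _ => a, rfl, rfl⟩
  | cons b p ih =>
    obtain ⟨ω, h1, h2⟩ := ih b
    refine ⟨fun i => Nat.casesOn i a ω, rfl, ?_⟩
    simp only [List.length_cons, tl]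
    rw [h2]
    change ω 0 :: p = b :: p
    rw [h1]

section
open Classical

theorem stk_snoc (a : S) (p : List S) (x : S) :
    stk a (p ++ [x]) = Function.update (stk a p) (p.getLastD a)
      (stk a p (p.getLastD a) ++ [x]) := by
  induction p generalizing a with
  | nil => simp [stk]
  | cons b p ih =>
    rw [List.cons_append, stk, ih, getLastD_cons', stk]
    generalize p.getLastD b = z
    funext v
    by_cases hva : v = a
    · subst hva
      by_cases hvz : v = z
      · rw [← hvz]; simp
      · simp [Function.update_of_ne hvz]
    · by_cases hvz : v = z
      · rw [← hvz]; simp [Function.update_of_ne hva]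
      · simp [Function.update_of_ne hva, Function.update_of_ne hvz]

/-- stacks of the first `N` steps -/
noncomputable def sk (ω : ℕ → S) (N : ℕ) : S → List S := stk (ω 0) (tl ω N)

theorem sk_succ (ω : ℕ → S) (N : ℕ) :
    sk ω (N + 1) = Function.update (sk ω N) (ω N) (sk ω N (ω N) ++ [ω (N + 1)]) := by
  unfold sk
  rw [tl_succ, stk_snoc, tl_last]

theorem sk_succ_ne (ω : ℕ → S) (N : ℕ) (v : S) (h : ω N ≠ v) : sk ω (N + 1) v = sk ω N v := by
  rw [sk_succ, Function.update_of_ne (Ne.symm h)]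

theorem sk_stable (ω : ℕ → S) (N M : ℕ) (v : S) (hNM : N ≤ M)
    (h : ∀ i, N ≤ i → i < M → ω i ≠ v) : sk ω M v = sk ω N v := by
  induction M, hNM using Nat.le_induction with
  | base => rfl
  | succ M hM ih =>
    rw [sk_succ_ne ω M v (h M hM (by omega)), ih (fun i h1 h2 => h i h1 (by omega))]

theorem sk_ne_nil_iff (ω : ℕ → S) (N : ℕ) (v : S) : sk ω N v ≠ [] ↔ ∃ i < N, ω i = v := by
  induction N with
  | zero => simp [sk, tl, stk]
  | succ N ih =>
    by_cases h : ω N = v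
    · rw [sk_succ, ← h]
      simp only [Function.update_self]
      constructor
      · intro _; exact ⟨N, by omega, rfl⟩
      · intro _; simp
    · rw [sk_succ_ne _ _ _ h, ih]
      constructor
      · rintro ⟨i, hi, hv⟩; exact ⟨i, by omega, hv⟩
      · rintro ⟨i, hi, hv⟩
        refine ⟨i, ?_, hv⟩
        rcases Nat.lt_succ_iff_lt_or_eq.1 hi with h' | rfl
        · exact h'
        · exact absurd hv h

theorem sk_bot (ω : ℕ → S) (N t : ℕ) (v : S) (ht : t < N) (hv : ω t = v)
    (h : ∀ s, t < s → s < N → ω s ≠ v) : bot (sk ω N) v = ω (t + 1) := by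
  have h1 : sk ω N v = sk ω (t + 1) v :=
    sk_stable ω (t + 1) N v ht (fun i h1 h2 => h i h1 h2)
  unfold bot
  rw [h1, sk_succ, ← hv]
  simp

theorem transCount_succ (ω : ℕ → S) (N : ℕ) (u v : S) :
    transCount ω (N + 1) u v = transCount ω N u v +
      if ω N = u ∧ ω (N + 1) = v then 1 else 0 := by
  unfold transCount
  have hfin : {i : ℕ | i < N ∧ ω i = u ∧ ω (i + 1) = v}.Finite :=
    (Set.finite_lt_nat N).subset fun i hi => hi.1
  by_cases h : ω N = u ∧ ω (N + 1) = v
  · rw [if_pos h]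
    have : {i : ℕ | i < N + 1 ∧ ω i = u ∧ ω (i + 1) = v} =
        insert N {i : ℕ | i < N ∧ ω i = u ∧ ω (i + 1) = v} := by
      ext i
      simp only [Set.mem_ofPred_eq, Set.mem_insert_iff]
      constructor
      · rintro ⟨h1, h2⟩
        rcases Nat.lt_succ_iff_lt_or_eq.1 h1 with h' | h'
        · exact Or.inr ⟨h', h2⟩
        · exact Or.inl h'
      · rintro (rfl | h')
        · exact ⟨by omega, h⟩
        · exact ⟨by omega, h'.2⟩
    rw [this, Set.ncard_insert_of_notMem (by simp) hfin]
  · rw [if_neg h, add_zero]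
    congr 1
    ext i
    simp only [Set.mem_ofPred_eq]
    constructor
    · rintro ⟨h1, h2⟩
      rcases Nat.lt_succ_iff_lt_or_eq.1 h1 with h' | rfl
      · exact ⟨h', h2⟩
      · exact absurd h2 h
    · rintro ⟨h1, h2⟩; exact ⟨by omega, h2⟩

theorem sk_count (ω : ℕ → S) (N : ℕ) (u v : S) : (sk ω N u).count v = transCount ω N u v := by
  induction N with
  | zero => simp [sk, tl, stk, transCount]
  | succ N ih =>
    rw [transCount_succ, ← ih]
    by_cases h : ω N = u
    · rw [sk_succ, ← h]
      simp [List.count_append, List.count_singleton]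
    · rw [sk_succ_ne _ _ _ h]
      simp [h]

theorem finEquiv_iff (ω ω' : ℕ → S) (N : ℕ) :
    FinEquiv ω ω' N ↔ ω 0 = ω' 0 ∧ ∀ v, (sk ω N v).Perm (sk ω' N v) := by
  unfold FinEquiv
  refine and_congr_right fun _ => forall_congr' fun u => ?_
  rw [List.perm_iff_count]
  exact forall_congr' fun v => by rw [sk_count, sk_count]

theorem transNum_eq (ω : ℕ → S) (N : ℕ) (u v : S) (h : ∀ i, N ≤ i → ω i ≠ u) :
    transNum ω u v = transCount ω N u v := by
  unfold transNum transCount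
  have hfin : {i : ℕ | i < N ∧ ω i = u ∧ ω (i + 1) = v}.Finite :=
    (Set.finite_lt_nat N).subset fun i hi => hi.1
  rw [hfin.cast_ncard_eq]
  congr 1
  ext i
  simp only [Set.mem_ofPred_eq]
  constructor
  · rintro ⟨h1, h2⟩
    refine ⟨?_, h1, h2⟩
    by_contra hi
    exact h i (by omega) h1
  · rintro ⟨_, h1⟩; exact h1

def Transient (ω : ℕ → S) : Prop := ∀ s : S, {i : ℕ | ω i = s}.Finite

theorem Transient.bound {ω : ℕ → S} (h : Transient ω) (F : Finset S) :
    ∃ N, ∀ v ∈ F, ∀ i, N ≤ i → ω i ≠ v := by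
  induction F using Finset.induction_on with
  | empty => exact ⟨0, by simp⟩
  | insert a F _ ih =>
    obtain ⟨N, hN⟩ := ih
    obtain ⟨K, hK⟩ := (h a).bddAbove
    refine ⟨max N (K + 1), ?_⟩
    intro v hv i hi
    rcases Finset.mem_insert.1 hv with rfl | hv
    · intro h'
      have := hK h'
      omega
    · exact hN v hv i (by omega)

/-- The full stack -/
noncomputable def fs (ω : ℕ → S) (h : Transient ω) (v : S) : List S :=
  sk ω (h.bound {v}).choose v

theorem fs_eq (ω : ℕ → S) (h : Transient ω) (v : S) (N : ℕ) (hN : ∀ i, N ≤ i → ω i ≠ v) :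
    sk ω N v = fs ω h v := by
  unfold fs
  set M := (h.bound {v}).choose with hM
  have hM' : ∀ i, M ≤ i → ω i ≠ v := fun i hi => (h.bound {v}).choose_spec v (by simp) i hi
  rcases le_total N M with h1 | h1
  · exact (sk_stable ω N M v h1 fun i h1 _ => hN i h1).symm
  · exact sk_stable ω M N v h1 fun i h1 _ => hM' i h1

theorem fs_sys (ω : ℕ → S) (h : Transient ω) :
    Sys (Set.range ω) (ω 0) (fs ω h) := by
  refine ⟨⟨0, rfl⟩, ?_, ?_, ?_⟩
  · rintro v ⟨i, rfl⟩
    obtain ⟨N, hN⟩ := h.bound {ω i}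
    rw [← fs_eq ω h (ω i) N (hN _ (by simp)), sk_ne_nil_iff]
    refine ⟨i, ?_, rfl⟩
    by_contra hi
    exact hN (ω i) (by simp) i (by omega) rfl
  · refine ⟨fun v => sSup {i | ω i = v}, ?_⟩
    rintro v ⟨i, rfl⟩
    set t := sSup {j | ω j = ω i} with ht
    have ht1 : ω t = ω i := Nat.sSup_mem (s := {j | ω j = ω i}) ⟨i, rfl⟩ (h (ω i)).bddAbove
    have ht2 : ∀ s, t < s → ω s ≠ ω i := by
      intro s hs h'
      have := le_csSup (h (ω i)).bddAbove (show s ∈ {j | ω j = ω i} from h')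
      omega
    have hb : bot (fs ω h) (ω i) = ω (t + 1) := by
      have := sk_bot ω (t + 1) t (ω i) (by omega) ht1 (fun s h1 _ => ht2 s h1)
      unfold bot at this ⊢
      rw [← fs_eq ω h (ω i) (t + 1) (fun s hs => ht2 s hs)]
      exact this
    rw [hb]
    have : t + 1 ≤ sSup {j | ω j = ω (t + 1)} :=
      le_csSup (h (ω (t + 1))).bddAbove (show t + 1 ∈ {j | ω j = ω (t + 1)} from rfl)
    exact this
  · intro D _ u _
    obtain ⟨N, hN⟩ := h.bound (insert u D)
    have hu : ω N ≠ u := hN u (by simp) N le_rfl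
    set U : Finset S := insert (ω 0) ((tl ω N).toFinset ∪ D) with hU
    have hbal := stk_balance U (ω 0) (tl ω N) (by simp [hU]) (fun x hx => by simp [hU, hx]) u
    rw [tl_last, if_neg (Ne.symm hu), add_zero] at hbal
    change InC U (sk ω N) u + _ = (sk ω N u).length at hbal
    rw [← fs_eq ω h u N (hN u (by simp)), ← hbal]
    refine Nat.add_le_add_right ?_ _
    unfold InC
    calc ∑ v ∈ D, (fs ω h v).count u = ∑ v ∈ D, (sk ω N v).count u :=
          Finset.sum_congr rfl fun v hv => by
            rw [fs_eq ω h v N (hN v (by simp [hv]))]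
      _ ≤ _ := Finset.sum_le_sum_of_subset (by intro x hx; simp [hU, hx])

end


/-! ### Part F : the maximal completed closed set -/

section
open Classical

def Cl (b : S → List S) (o : S) (p : List S) (D : Finset S) : Prop :=
  (∀ v ∈ D, (stk o p v).Perm (b v) ∧ b v ≠ []) ∧ p.getLastD o ∉ D ∧
    ∀ u, stk o p u ≠ [] → bot (stk o p) u ∈ D → u ∈ D

noncomputable def Dm (b : S → List S) (o : S) (p : List S) : Finset S :=
  ((o :: p).toFinset.powerset.filter (Cl b o p)).sup id

theorem Cl_empty (b : S → List S) (o : S) (p : List S) : Cl b o p ∅ := by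
  refine ⟨by simp, by simp, by simp⟩

theorem Cl_union {b : S → List S} {o : S} {p : List S} {D1 D2 : Finset S} (h1 : Cl b o p D1)
    (h2 : Cl b o p D2) : Cl b o p (D1 ∪ D2) := by
  refine ⟨?_, ?_, ?_⟩
  · intro v hv
    rcases Finset.mem_union.1 hv with h | h
    · exact h1.1 v h
    · exact h2.1 v h
  · intro h
    rcases Finset.mem_union.1 h with h | h
    · exact h1.2.1 h
    · exact h2.2.1 h
  · intro u hu h
    rcases Finset.mem_union.1 h with h | h
    · exact Finset.mem_union_left _ (h1.2.2 u hu h)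
    · exact Finset.mem_union_right _ (h2.2.2 u hu h)

theorem Cl_sub {b : S → List S} {o : S} {p : List S} {D : Finset S} (h : Cl b o p D) :
    D ⊆ (o :: p).toFinset := by
  intro v hv
  obtain ⟨h1, h2⟩ := h.1 v hv
  have h3 : stk o p v ≠ [] := by
    intro h3
    rw [h3] at h1
    exact h2 h1.symm.eq_nil
  rcases stk_supp o p v h3 with h | h <;> simp [h]

theorem Cl_Dm (b : S → List S) (o : S) (p : List S) : Cl b o p (Dm b o p) := by
  unfold Dm
  refine Finset.sup_induction (Cl_empty b o p) (fun _ h1 _ h2 => Cl_union h1 h2) ?_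
  intro D hD
  exact (Finset.mem_filter.1 hD).2

theorem le_Dm {b : S → List S} {o : S} {p : List S} {D : Finset S} (h : Cl b o p D) :
    D ⊆ Dm b o p := by
  unfold Dm
  exact Finset.le_sup (f := id)
    (Finset.mem_filter.2 ⟨Finset.mem_powerset.2 (Cl_sub h), h⟩)

noncomputable def restr (D : Finset S) (σ : S → List S) : S → List S :=
  fun v => if v ∈ D then σ v else []

theorem restr_mem_FA {b : S → List S} {o : S} {p : List S} {D : Finset S} (h : Cl b o p D) :
    restr D (stk o p) ∈ FA (Kb b) D := by
  refine mem_FA.2 ⟨?_, ?_, ?_⟩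
  · intro v hv
    simp only [restr, hv, if_true]
    exact mem_Kb.2 (h.1 v hv).1
  · intro v hv
    simp [restr, hv]
  · have key : ∀ v, Relation.ReflTransGen (RB (stk o p)) v (p.getLastD o) →
        Exits (bot (restr D (stk o p))) (D : Set S) v := by
      intro v hv
      induction hv using Relation.ReflTransGen.head_induction_on with
      | refl => exact exits_of_notMem (by simpa using h.2.1)
      | @head v w hvw _ ih =>
        by_cases hvD : v ∈ D
        · apply exits_step
          have : bot (restr D (stk o p)) v = w := by
            rw [← hvw.2]
            simp [bot, restr, hvD]
          rw [this]; exact ih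
        · exact exits_of_notMem (by simpa using hvD)
    intro w
    by_cases hw : w ∈ D
    · refine key w (stk_tree o p w ?_)
      intro h3
      obtain ⟨h1, h2⟩ := h.1 w hw
      rw [h3] at h1
      exact h2 h1.symm.eq_nil
    · exact exits_of_notMem (by simpa using hw)

theorem Dm_swap {b : S → List S} {o : S} {p : List S} {D : Finset S} (h : Dm b o p = D)
    {c : S → List S} (hc : c ∈ FA (Kb b) D) :
    ∃ p' : List S, p'.length = p.length ∧ p'.getLastD o = p.getLastD o ∧
      (stk o p' = fun v => if v ∈ D then c v else stk o p v) ∧ Dm b o p' = D := by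
  have hCl : Cl b o p D := h ▸ Cl_Dm b o p
  have hc' := mem_FA.1 hc
  obtain ⟨p', h1, h2, h3⟩ := stk_swap o p (D : Set S) (by simpa using hCl.2.1)
    (by simpa using hCl.2.2) c
    (fun v hv => by
      have hv' : v ∈ D := by simpa using hv
      exact (mem_Kb.1 (hc'.1 v hv')).trans (hCl.1 v hv').1.symm)
    (fun v _ => hc'.2.2 v)
  have h3' : stk o p' = fun v => if v ∈ D then c v else stk o p v := by
    rw [h3]
    funext v
    simp
  refine ⟨p', h1, h2, h3', ?_⟩
  have hoff : ∀ v, v ∉ D → stk o p' v = stk o p v := by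
    intro v hv
    rw [h3']; simp [hv]
  have hon : ∀ v, v ∈ D → (stk o p' v).Perm (b v) := by
    intro v hv
    rw [h3']; simp only [hv, if_true]; exact mem_Kb.1 (hc'.1 v hv)
  have hbotoff : ∀ v, v ∉ D → bot (stk o p') v = bot (stk o p) v := by
    intro v hv
    unfold bot
    rw [hoff v hv]
  apply Finset.Subset.antisymm
  · conv_rhs => rw [← h]
    have hCl' := Cl_Dm b o p'
    have hsub : D ⊆ Dm b o p' := by
      apply le_Dm
      refine ⟨fun v hv => ⟨hon v hv, (hCl.1 v hv).2⟩, by rw [h2]; exact hCl.2.1, ?_⟩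
      intro u hu hb
      by_contra huD
      rw [hbotoff u huD] at hb
      rw [hoff u huD] at hu
      exact huD (hCl.2.2 u hu hb)
    apply le_Dm
    refine ⟨?_, by rw [← h2]; exact hCl'.2.1, ?_⟩
    · intro v hv
      refine ⟨?_, (hCl'.1 v hv).2⟩
      by_cases hvD : v ∈ D
      · exact (hCl.1 v hvD).1
      · rw [← hoff v hvD]; exact (hCl'.1 v hv).1
    · intro u hu hb
      by_cases huD : u ∈ D
      · exact hsub huD
      · rw [← hbotoff u huD] at hb
        rw [← hoff u huD] at hu
        exact hCl'.2.2 u hu hb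
  · apply le_Dm
    refine ⟨fun v hv => ⟨hon v hv, (hCl.1 v hv).2⟩, by rw [h2]; exact hCl.2.1, ?_⟩
    intro u hu hb
    by_contra huD
    rw [hbotoff u huD] at hb
    rw [hoff u huD] at hu
    exact huD (hCl.2.2 u hu hb)

theorem Dm_eventually (b : S → List S) (ω : ℕ → S) (h : Transient ω)
    (hb : ∀ v, (fs ω h v).Perm (b v)) (B : Finset S) (hB : (B : Set S) ⊆ Set.range ω) :
    ∃ N0, ∀ N ≥ N0, B ⊆ Dm b (ω 0) (tl ω N) := by
  obtain ⟨t, ht⟩ := h.bound B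
  set F : Finset S := (Finset.range (t + 1)).image ω with hF
  obtain ⟨N0, hN0⟩ := h.bound F
  set D : Finset S := F.filter (fun v => ∀ i, t ≤ i → ω i ≠ v) with hD
  refine ⟨max N0 (t + 1), fun N hN => ?_⟩
  have hBD : B ⊆ D := by
    intro v hv
    rw [hD, Finset.mem_filter]
    refine ⟨?_, fun i hi => ht v hv i hi⟩
    obtain ⟨i, rfl⟩ := hB (by simpa using hv)
    rw [hF, Finset.mem_image]
    refine ⟨i, ?_, rfl⟩
    rw [Finset.mem_range]
    by_contra hi
    exact ht (ω i) hv i (by omega) rfl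
  refine hBD.trans (le_Dm ⟨?_, ?_, ?_⟩)
  · intro v hv
    rw [hD, Finset.mem_filter] at hv
    have h1 : sk ω N v = fs ω h v := fs_eq ω h v N (fun i hi => hN0 v hv.1 i (by omega))
    have h2 : fs ω h v ≠ [] := by
      rw [hF, Finset.mem_image] at hv
      obtain ⟨⟨i, _, rfl⟩, _⟩ := hv
      exact (fs_sys ω h).hne _ ⟨i, rfl⟩
    refine ⟨?_, ?_⟩
    · change (sk ω N v).Perm (b v)
      rw [h1]; exact hb v
    · intro h3
      have := hb v
      rw [h3] at this
      exact h2 this.eq_nil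
  · rw [tl_last]
    intro hz
    rw [hD, Finset.mem_filter] at hz
    exact hz.2 N (by omega) rfl
  · intro u hu hbot
    change sk ω N u ≠ [] at hu
    change bot (sk ω N) u ∈ D at hbot
    rw [sk_ne_nil_iff] at hu
    obtain ⟨i, hi, hiu⟩ := hu
    set T : Finset ℕ := (Finset.range N).filter (fun j => ω j = u) with hT
    have hTne : T.Nonempty := ⟨i, by simp [hT, hi, hiu]⟩
    set s := T.max' hTne with hs
    have hsT : s ∈ T := Finset.max'_mem _ _
    simp only [hT, Finset.mem_filter, Finset.mem_range] at hsT
    have hsmax : ∀ j, s < j → j < N → ω j ≠ u := by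
      intro j hj hjN hju
      have := Finset.le_max' T j (by simp [hT, hjN, hju])
      omega
    rw [sk_bot ω N s u hsT.1 hsT.2 hsmax, hD, Finset.mem_filter] at hbot
    have hst : s + 1 < t := by
      by_contra hcon
      exact hbot.2 (s + 1) (by omega) rfl
    have huF : u ∈ F := by
      rw [hF, Finset.mem_image]
      exact ⟨s, by rw [Finset.mem_range]; omega, hsT.2⟩
    rw [hD, Finset.mem_filter]
    refine ⟨huF, fun j hj => ?_⟩
    by_cases hjN : j < N
    · exact hsmax j (by omega) hjN
    · exact hN0 u huF j (by omega)

end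


/-! ### Part G : measures, the first step of an extremal law -/

section
open Classical

theorem meas_initseg [Countable S] [MeasurableSpace S] [DiscreteMeasurableSpace S]
    (N : ℕ) (T : Set (ℕ → S))
    (hT : ∀ ω ω' : ℕ → S, (∀ i ≤ N, ω i = ω' i) → ω ∈ T → ω' ∈ T) : MeasurableSet T := by
  have h1 : T = (fun (ω : ℕ → S) (i : Fin (N + 1)) => ω i) ⁻¹'
      ((fun (ω : ℕ → S) (i : Fin (N + 1)) => ω i) '' T) := by
    ext ω
    constructor
    · intro h; exact ⟨ω, h, rfl⟩
    · rintro ⟨ω', h, h2⟩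
      refine hT ω' ω (fun i hi => ?_) h
      exact congrFun h2 ⟨i, by omega⟩
  rw [h1]
  refine measurableSet_preimage ?_ (Set.to_countable _).measurableSet
  exact measurable_pi_lambda _ (fun i => measurable_pi_apply _)

theorem tl_congr {ω ω' : ℕ → S} {N : ℕ} (h : ∀ i ≤ N, ω i = ω' i) : tl ω N = tl ω' N :=
  (tl_eq_iff _ _ _).2 (fun i hi => h (i + 1) (by omega))

theorem meas_tl [Countable S] [MeasurableSpace S] [DiscreteMeasurableSpace S]
    (N : ℕ) (P : S → List S → Prop) : MeasurableSet {ω : ℕ → S | P (ω 0) (tl ω N)} := by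
  refine meas_initseg N _ (fun ω ω' h hω => ?_)
  simp only [Set.mem_ofPred_eq] at hω ⊢
  rw [← tl_congr h, ← h 0 (by omega)]
  exact hω

/-- the cylinder of paths starting with `o` followed by `p` -/
def CC (o : S) (p : List S) : Set (ℕ → S) := {ω | ω 0 = o ∧ tl ω p.length = p}

theorem CC_eq (x : ℕ → S) (N : ℕ) : CC (x 0) (tl x N) = {ω | ∀ i ≤ N, ω i = x i} := by
  ext ω
  simp only [CC, tl_length, tl_eq_iff, Set.mem_ofPred_eq]
  constructor
  · rintro ⟨h1, h2⟩ i hi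
    cases i with
    | zero => exact h1
    | succ i => exact h2 i (by omega)
  · intro h
    exact ⟨h 0 (by omega), fun i hi => h (i + 1) (by omega)⟩

theorem CC_perm [MeasurableSpace S] {μ : Measure (ℕ → S)} (hμ : PartiallyExchangeable μ) (o : S)
    (p p' : List S) (hl : p.length = p'.length)
    (hp : ∀ v, (stk o p v).Perm (stk o p' v)) : μ (CC o p) = μ (CC o p') := by
  obtain ⟨x, hx0, hx⟩ := exists_tl o p
  obtain ⟨y, hy0, hy⟩ := exists_tl o p'
  have e1 : CC o p = {ω | ∀ i ≤ p.length, ω i = x i} := by rw [← CC_eq, hx0, hx]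
  have e2 : CC o p' = {ω | ∀ i ≤ p.length, ω i = y i} := by rw [← CC_eq, hy0, hl, hy]
  rw [e1, e2]
  apply hμ
  rw [finEquiv_iff]
  refine ⟨by rw [hx0, hy0], fun v => ?_⟩
  unfold sk
  rw [hx0, hy0, hx, hl, hy]
  exact hp v

def WW (b : S → List S) (o : S) (N : ℕ) (D : Finset S) (c : S → List S) : Set (ℕ → S) :=
  {ω | ω 0 = o ∧ Dm b o (tl ω N) = D ∧ restr D (stk o (tl ω N)) = c}

theorem WW_meas [Countable S] [MeasurableSpace S] [DiscreteMeasurableSpace S]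
    (b : S → List S) (o : S) (N : ℕ) (D : Finset S) (c : S → List S) :
    MeasurableSet (WW b o N D c) :=
  meas_tl N (fun a p => a = o ∧ Dm b o p = D ∧ restr D (stk o p) = c)

theorem WW_le [Countable S] [MeasurableSpace S] [DiscreteMeasurableSpace S]
    {μ : Measure (ℕ → S)} (hμ : PartiallyExchangeable μ)
    (b : S → List S) (o : S) (N : ℕ) (D : Finset S) (c c' : S → List S)
    (hc' : c' ∈ FA (Kb b) D) : μ (WW b o N D c) ≤ μ (WW b o N D c') := by
  let Q : (S → List S) → Type := fun c => {p : List S // p.length = N ∧ Dm b o p = D ∧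
    restr D (stk o p) = c}
  have hW : ∀ c, WW b o N D c = ⋃ p : Q c, CC o p.1 := by
    intro c
    ext ω
    simp only [WW, Set.mem_ofPred_eq, Set.mem_iUnion, CC]
    constructor
    · rintro ⟨h1, h2, h3⟩
      exact ⟨⟨tl ω N, tl_length _ _, h2, h3⟩, h1, by simp [tl_length]⟩
    · rintro ⟨⟨p, h1, h2, h3⟩, h4, h5⟩
      simp only at h5
      rw [h1] at h5
      rw [h5]
      exact ⟨h4, h2, h3⟩
  have hμW : ∀ c, μ (WW b o N D c) = ∑' p : Q c, μ (CC o p.1) := by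
    intro c
    rw [hW c]
    refine measure_iUnion ?_ ?_
    · intro p q hpq
      refine Set.disjoint_left.2 ?_
      rintro ω ⟨_, h1⟩ ⟨_, h2⟩
      apply hpq
      apply Subtype.ext
      rw [← h1, ← h2, p.2.1, q.2.1]
    · intro p
      exact meas_tl p.1.length (fun a q => a = o ∧ q = p.1)
  rw [hμW, hμW]
  have hsw : ∀ p : Q c, ∃ q : Q c', (stk o q.1 = fun v => if v ∈ D then c' v else stk o p.1 v) := by
    rintro ⟨p, h1, h2, h3⟩
    obtain ⟨p', k1, k2, k3, k4⟩ := Dm_swap h2 hc'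
    refine ⟨⟨p', by omega, k4, ?_⟩, k3⟩
    funext v
    simp only [restr, k3]
    by_cases hv : v ∈ D
    · simp [hv]
    · simp [hv, (mem_FA.1 hc').2.1 v hv]
  choose f hf using hsw
  have hinj : Function.Injective f := by
    intro p q hpq
    apply Subtype.ext
    apply stk_inj (a := o)
    funext v
    by_cases hv : v ∈ D
    · have h1 := congrFun p.2.2.2 v
      have h2 := congrFun q.2.2.2 v
      simp only [restr, hv, if_true] at h1 h2
      rw [h1, h2]
    · have h1 := congrFun (hf p) v
      have h2 := congrFun (hf q) v
      rw [hpq] at h1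
      simp only [hv, if_false] at h1 h2
      rw [← h1, ← h2]
  have hval : ∀ p : Q c, μ (CC o p.1) = μ (CC o (f p).1) := by
    intro p
    refine CC_perm hμ o _ _ (by rw [p.2.1, (f p).2.1]) (fun v => ?_)
    rw [hf p]
    have hCl : Cl b o p.1 D := by
      have := Cl_Dm b o p.1
      rwa [p.2.2.1] at this
    by_cases hv : v ∈ D
    · simp only [hv, if_true]
      exact (hCl.1 v hv).1.trans (mem_Kb.1 ((mem_FA.1 hc').1 v hv)).symm
    · simp [hv]
  calc ∑' p : Q c, μ (CC o p.1) = ∑' p : Q c, μ (CC o (f p).1) := by simp only [hval]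
    _ ≤ _ := ENNReal.tsum_comp_le_tsum_of_injective hinj (fun q : Q c' => μ (CC o q.1))

def EE (b : S → List S) (o : S) (N : ℕ) (D : Finset S) : Set (ℕ → S) :=
  {ω | ω 0 = o ∧ Dm b o (tl ω N) = D}

theorem EE_meas [Countable S] [MeasurableSpace S] [DiscreteMeasurableSpace S]
    (b : S → List S) (o : S) (N : ℕ) (D : Finset S) :
    MeasurableSet (EE b o N D) :=
  meas_tl N (fun a p => a = o ∧ Dm b o p = D)

theorem Hd_iff (o : S) (b : S → List S) (ω : ℕ → S) (N : ℕ) (D : Finset S) (hD : o ∈ D)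
    (h0 : ω 0 = o) (hω : Dm b o (tl ω N) = D) (u : S) :
    ω 1 = u ↔ Hd u (restr D (stk o (tl ω N)) o) := by
  have hCl : Cl b o (tl ω N) D := by
    have := Cl_Dm b o (tl ω N)
    rwa [hω] at this
  cases N with
  | zero =>
    exfalso
    have := hCl.2.1
    simp [tl] at this
    exact this hD
  | succ N =>
    simp [restr, hD, Hd, tl, stk]

theorem EE_step [Countable S] [MeasurableSpace S] [DiscreteMeasurableSpace S]
    {μ : Measure (ℕ → S)} [IsFiniteMeasure μ] (hμ : PartiallyExchangeable μ)
    {V : Set S} {b : S → List S} {o : S} (hS : Sys V o b) (N : ℕ) (D : Finset S)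
    (hD : (D : Set S) ⊆ V) (ho : o ∈ D) (u : S) :
    μ (EE b o N D ∩ {ω | ω 1 = u}) = ENNReal.ofReal (rho b o D u) * μ (EE b o N D) := by
  obtain ⟨c0, hc0⟩ := hS.FA_nonempty D hD
  have hEE : EE b o N D = ⋃ c ∈ FA (Kb b) D, WW b o N D c := by
    ext ω
    simp only [EE, WW, Set.mem_ofPred_eq, Set.mem_iUnion, exists_prop]
    constructor
    · rintro ⟨h1, h2⟩
      have hCl : Cl b o (tl ω N) D := by
        have := Cl_Dm b o (tl ω N)
        rwa [h2] at this
      exact ⟨_, restr_mem_FA hCl, h1, h2, rfl⟩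
    · rintro ⟨c, _, h1, h2, _⟩
      exact ⟨h1, h2⟩
  have hEu : EE b o N D ∩ {ω | ω 1 = u} =
      ⋃ c ∈ (FA (Kb b) D).filter (fun c => Hd u (c o)), WW b o N D c := by
    ext ω
    simp only [EE, WW, Set.mem_ofPred_eq, Set.mem_iUnion, exists_prop, Set.mem_inter_iff,
      Finset.mem_filter]
    constructor
    · rintro ⟨⟨h1, h2⟩, h3⟩
      have hCl : Cl b o (tl ω N) D := by
        have := Cl_Dm b o (tl ω N)
        rwa [h2] at this
      exact ⟨_, ⟨restr_mem_FA hCl, (Hd_iff o b ω N D ho h1 h2 u).1 h3⟩, h1, h2, rfl⟩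
    · rintro ⟨c, ⟨_, h0⟩, h1, h2, h3⟩
      refine ⟨⟨h1, h2⟩, (Hd_iff o b ω N D ho h1 h2 u).2 ?_⟩
      rw [h3]; exact h0
  have hdis : ∀ F : Finset (S → List S), Set.PairwiseDisjoint (F : Set (S → List S))
      (WW b o N D) := by
    intro F c _ c' _ hcc
    refine Set.disjoint_left.2 ?_
    rintro ω ⟨_, _, h1⟩ ⟨_, _, h2⟩
    exact hcc (h1.symm.trans h2)
  have hconst : ∀ c ∈ FA (Kb b) D, μ (WW b o N D c) = μ (WW b o N D c0) := fun c hc =>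
    le_antisymm (WW_le hμ b o N D _ _ hc0) (WW_le hμ b o N D _ _ hc)
  have h1 : μ (EE b o N D) = (FA (Kb b) D).card * μ (WW b o N D c0) := by
    rw [hEE, measure_biUnion_finset (hdis _) (fun c _ => WW_meas b o N D c),
      Finset.sum_congr rfl hconst, Finset.sum_const, nsmul_eq_mul]
  have h2 : μ (EE b o N D ∩ {ω | ω 1 = u}) =
      ((FA (Kb b) D).filter (fun c => Hd u (c o))).card * μ (WW b o N D c0) := by
    rw [hEu, measure_biUnion_finset (hdis _) (fun c _ => WW_meas b o N D c),
      Finset.sum_congr rfl (fun c hc => hconst c (Finset.mem_filter.1 hc).1), Finset.sum_const,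
      nsmul_eq_mul]
  rw [h1, h2, ← mul_assoc]
  congr 1
  have hpos := hS.card_pos D hD
  unfold rho
  rw [ENNReal.ofReal_div_of_pos hpos, ENNReal.ofReal_natCast, ENNReal.ofReal_natCast]
  rw [ENNReal.div_mul_cancel]
  · intro h
    have : (FA (Kb b) D).card = 0 := by exact_mod_cast h
    rw [this] at hpos; simp at hpos
  · exact ENNReal.natCast_ne_top _

end


/-! ### Part H : the first step, limit -/

section
open Classical

def AA (b : S → List S) (o : S) (N : ℕ) (B : Finset S) : Set (ℕ → S) :=
  {ω | ω 0 = o ∧ B ⊆ Dm b o (tl ω N)}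

theorem AA_meas [Countable S] [MeasurableSpace S] [DiscreteMeasurableSpace S]
    (b : S → List S) (o : S) (N : ℕ) (B : Finset S) :
    MeasurableSet (AA b o N B) :=
  meas_tl N (fun a p => a = o ∧ B ⊆ Dm b o p)

theorem one_meas [MeasurableSpace S] [DiscreteMeasurableSpace S] (k : ℕ) (u : S) :
    MeasurableSet {ω : ℕ → S | ω k = u} := by
  change MeasurableSet ((fun ω : ℕ → S => ω k) ⁻¹' {u})
  exact measurableSet_preimage (measurable_pi_apply k) (MeasurableSet.of_discrete)

theorem AA_sum [Countable S] [MeasurableSpace S] [DiscreteMeasurableSpace S]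
    (μ : Measure (ℕ → S)) {V : Set S} {b : S → List S} {o : S} (hV : ∀ v, b v ≠ [] → v ∈ V)
    (N : ℕ) (B : Finset S) (R : Set (ℕ → S)) (hR : MeasurableSet R) :
    μ (AA b o N B ∩ R) = ∑' D : {D : Finset S // B ⊆ D ∧ (D : Set S) ⊆ V}, μ (EE b o N D.1 ∩ R) := by
  rw [← measure_iUnion]
  · congr 1
    ext ω
    simp only [AA, EE, Set.mem_inter_iff, Set.mem_ofPred_eq, Set.mem_iUnion]
    constructor
    · rintro ⟨⟨h1, h2⟩, h3⟩
      refine ⟨⟨Dm b o (tl ω N), h2, fun v hv => ?_⟩, ⟨h1, rfl⟩, h3⟩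
      exact hV v ((Cl_Dm b o (tl ω N)).1 v (by simpa using hv)).2
    · rintro ⟨⟨D, h1, h2⟩, ⟨h3, h4⟩, h5⟩
      exact ⟨⟨h3, h4 ▸ h1⟩, h5⟩
  · intro D D' hDD
    refine Set.disjoint_left.2 ?_
    rintro ω ⟨⟨_, h1⟩, _⟩ ⟨⟨_, h2⟩, _⟩
    exact hDD (Subtype.ext (h1.symm.trans h2))
  · intro D
    exact (EE_meas b o N D.1).inter hR

theorem first_step [Countable S] [MeasurableSpace S] [DiscreteMeasurableSpace S]
    {μ : Measure (ℕ → S)} [IsFiniteMeasure μ] (hμ : PartiallyExchangeable μ)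
    {V : Set S} {b : S → List S} {o : S} (hS : Sys V o b) (hV : ∀ v, b v ≠ [] → v ∈ V)
    (ρ : S → ℝ) (hρ : ∀ u, ∀ ε > 0, ∃ B : Finset S, (B : Set S) ⊆ V ∧ o ∈ B ∧
      ∀ D : Finset S, B ⊆ D → (D : Set S) ⊆ V → |rho b o D u - ρ u| < ε)
    (hae : ∀ᵐ ω ∂μ, ω 0 = o ∧ ∀ B : Finset S, (B : Set S) ⊆ V →
      ∃ N0, ∀ N ≥ N0, B ⊆ Dm b o (tl ω N)) (u : S) :
    μ {ω | ω 1 = u} = ENNReal.ofReal (ρ u) * μ univ := by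
  have lim : ∀ (B : Finset S), (B : Set S) ⊆ V → ∀ R : Set (ℕ → S), MeasurableSet R →
      Tendsto (fun N => μ (AA b o N B ∩ R)) atTop (nhds (μ R)) := by
    intro B hB R hR
    refine tendsto_measure_of_ae_tendsto_indicator_of_isFiniteMeasure atTop hR
      (fun N => (AA_meas b o N B).inter hR) ?_
    filter_upwards [hae] with ω hω
    obtain ⟨N0, hN0⟩ := hω.2 B hB
    filter_upwards [eventually_ge_atTop N0] with N hN
    constructor
    · exact fun h => h.2
    · exact fun h => ⟨⟨hω.1, hN0 N hN⟩, h⟩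
  have bd : ∀ ε > 0, μ {ω | ω 1 = u} ≤ ENNReal.ofReal (ρ u + ε) * μ univ ∧
      ENNReal.ofReal (ρ u - ε) * μ univ ≤ μ {ω | ω 1 = u} := by
    intro ε hε
    obtain ⟨B, hB, hoB, hBD⟩ := hρ u ε hε
    have l1 := lim B hB {ω | ω 1 = u} (one_meas 1 u)
    have l2 := lim B hB univ MeasurableSet.univ
    have key : ∀ N, μ (AA b o N B ∩ {ω | ω 1 = u}) ≤ ENNReal.ofReal (ρ u + ε) * μ (AA b o N B ∩ univ) ∧
        ENNReal.ofReal (ρ u - ε) * μ (AA b o N B ∩ univ) ≤ μ (AA b o N B ∩ {ω | ω 1 = u}) := by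
      intro N
      rw [AA_sum μ hV N B _ (one_meas 1 u), AA_sum μ hV N B _ MeasurableSet.univ,
        ← ENNReal.tsum_mul_left, ← ENNReal.tsum_mul_left]
      constructor
      · refine ENNReal.tsum_le_tsum (fun D => ?_)
        rw [EE_step hμ hS N D.1 D.2.2 (D.2.1 hoB) u, inter_univ]
        gcongr
        have := abs_lt.1 (hBD D.1 D.2.1 D.2.2)
        linarith
      · refine ENNReal.tsum_le_tsum (fun D => ?_)
        rw [EE_step hμ hS N D.1 D.2.2 (D.2.1 hoB) u, inter_univ]
        gcongr
        have := abs_lt.1 (hBD D.1 D.2.1 D.2.2)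
        linarith
    constructor
    · exact le_of_tendsto_of_tendsto' l1 (ENNReal.Tendsto.const_mul l2 (Or.inr ENNReal.ofReal_ne_top))
        (fun N => (key N).1)
    · exact le_of_tendsto_of_tendsto' (ENNReal.Tendsto.const_mul l2 (Or.inr ENNReal.ofReal_ne_top)) l1
        (fun N => (key N).2)
  have hne : μ univ ≠ ⊤ := measure_ne_top _ _
  have t1 : Tendsto (fun ε : ℝ => ENNReal.ofReal (ρ u + ε) * μ univ) (nhdsWithin 0 (Set.Ioi 0))
      (nhds (ENNReal.ofReal (ρ u) * μ univ)) := by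
    refine ENNReal.Tendsto.mul_const ?_ (Or.inr hne)
    refine (ENNReal.continuous_ofReal.tendsto _).comp ?_
    have : Tendsto (fun ε : ℝ => ρ u + ε) (nhds 0) (nhds (ρ u + 0)) :=
      (continuous_const.add continuous_id).tendsto 0
    rw [add_zero] at this
    exact this.mono_left nhdsWithin_le_nhds
  have t2 : Tendsto (fun ε : ℝ => ENNReal.ofReal (ρ u - ε) * μ univ) (nhdsWithin 0 (Set.Ioi 0))
      (nhds (ENNReal.ofReal (ρ u) * μ univ)) := by
    refine ENNReal.Tendsto.mul_const ?_ (Or.inr hne)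
    refine (ENNReal.continuous_ofReal.tendsto _).comp ?_
    have : Tendsto (fun ε : ℝ => ρ u - ε) (nhds 0) (nhds (ρ u - 0)) :=
      (continuous_const.sub continuous_id).tendsto 0
    rw [sub_zero] at this
    exact this.mono_left nhdsWithin_le_nhds
  refine le_antisymm ?_ ?_
  · refine ge_of_tendsto t1 ?_
    filter_upwards [self_mem_nhdsWithin] with ε hε using (bd ε hε).1
  · refine le_of_tendsto t2 ?_
    filter_upwards [self_mem_nhdsWithin] with ε hε using (bd ε hε).2

/-- transient sequences with prescribed initial state and transition numbers -/
def Good (o : S) (M : S → S → ℕ∞) (ω : ℕ → S) : Prop :=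
  ω 0 = o ∧ (∀ u v, transNum ω u v = M u v) ∧ Transient ω

theorem fs_count (ω : ℕ → S) (h : Transient ω) (u v : S) :
    ((fs ω h u).count v : ℕ∞) = transNum ω u v := by
  obtain ⟨N, hN⟩ := h.bound {u}
  have hN' := hN u (by simp)
  rw [← fs_eq ω h u N hN', sk_count, transNum_eq ω N u v hN']

theorem fs_perm {o : S} {M : S → S → ℕ∞} {ω ω0 : ℕ → S} (h : Good o M ω) (h0 : Good o M ω0) (v : S) :
    (fs ω h.2.2 v).Perm (fs ω0 h0.2.2 v) := by
  rw [List.perm_iff_count]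
  intro u
  have h1 := fs_count ω h.2.2 v u
  have h2 := fs_count ω0 h0.2.2 v u
  rw [h.2.1, ← h0.2.1, ← h2] at h1
  exact_mod_cast h1

theorem fs_ne_nil_iff (ω : ℕ → S) (h : Transient ω) (v : S) : fs ω h v ≠ [] ↔ v ∈ Set.range ω := by
  obtain ⟨N, hN⟩ := h.bound {v}
  have hN' := hN v (by simp)
  rw [← fs_eq ω h v N hN', sk_ne_nil_iff]
  constructor
  · rintro ⟨i, _, hi⟩; exact ⟨i, hi⟩
  · rintro ⟨i, hi⟩
    refine ⟨i, ?_, hi⟩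
    by_contra hc
    exact hN' i (by omega) hi

theorem good_range {o : S} {M : S → S → ℕ∞} {ω ω0 : ℕ → S} (h : Good o M ω) (h0 : Good o M ω0) :
    Set.range ω = Set.range ω0 := by
  ext v
  rw [← fs_ne_nil_iff ω h.2.2, ← fs_ne_nil_iff ω0 h0.2.2]
  have := fs_perm h h0 v
  constructor
  · intro h1 h2
    rw [h2] at this
    exact h1 this.eq_nil
  · intro h1 h2
    rw [h2] at this
    exact h1 this.symm.eq_nil

/-- the law of the first step depends only on `o` and `M` -/
theorem first_step_good [Countable S] [MeasurableSpace S] [DiscreteMeasurableSpace S]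
    (o : S) (M : S → S → ℕ∞) : ∃ ρ : S → ℝ≥0∞, ∀ μ : Measure (ℕ → S), IsFiniteMeasure μ →
      PartiallyExchangeable μ → (∀ᵐ ω ∂μ, Good o M ω) → ∀ u, μ {ω | ω 1 = u} = ρ u * μ univ := by
  by_cases hex : ∃ ω0, Good o M ω0
  · obtain ⟨ω0, h0⟩ := hex
    have hS := fs_sys ω0 h0.2.2
    obtain ⟨ρ, hρ⟩ := hS.rho_tendsto
    refine ⟨fun u => ENNReal.ofReal (ρ u), fun μ _ hμ hae u => ?_⟩
    refine first_step hμ hS (fun v hv => (fs_ne_nil_iff _ _ _).1 hv) ρ hρ ?_ u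
    filter_upwards [hae] with ω hω
    refine ⟨hω.1.trans h0.1.symm, fun B hB => ?_⟩
    have := Dm_eventually (fs ω0 h0.2.2) ω hω.2.2 (fs_perm hω h0) B (by rwa [good_range hω h0])
    rwa [hω.1.trans h0.1.symm] at this
  · refine ⟨fun _ => 0, fun μ _ hμ hae u => ?_⟩
    have : μ = 0 := by
      rw [← ae_eq_bot]
      have : ∀ᵐ ω ∂μ, False := by
        filter_upwards [hae] with ω hω using hex ⟨ω, hω⟩
      exact Filter.empty_mem_iff_bot.1 this
    simp [this]

end


/-! ### Part I : cylinders, swapping of prefixes, uniqueness -/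

section
open Classical

/-- the cylinder of sequences agreeing with `x` up to time `n` -/
def cyl (x : ℕ → S) (n : ℕ) : Set (ℕ → S) := {ω | ∀ i ≤ n, ω i = x i}

theorem cyl_meas [Countable S] [MeasurableSpace S] [DiscreteMeasurableSpace S] (x : ℕ → S) (n : ℕ) :
    MeasurableSet (cyl x n) := by
  refine meas_initseg n _ (fun ω ω' h hω i hi => ?_)
  rw [← h i hi]; exact hω i hi

theorem cyl_ext [Countable S] [MeasurableSpace S] [DiscreteMeasurableSpace S]
    {μ ν : Measure (ℕ → S)} [IsFiniteMeasure μ] (h : ∀ x n, μ (cyl x n) = ν (cyl x n)) : μ = ν := by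
  have hpre : ∀ (N : ℕ) (T : Set (ℕ → S)),
      (∀ ω ω' : ℕ → S, (∀ i ≤ N, ω i = ω' i) → ω ∈ T → ω' ∈ T) → μ T = ν T := by
    intro N T hT
    have h1 : T = (fun (ω : ℕ → S) (i : Fin (N + 1)) => ω i) ⁻¹'
        ((fun (ω : ℕ → S) (i : Fin (N + 1)) => ω i) '' T) := by
      ext ω
      constructor
      · intro h; exact ⟨ω, h, rfl⟩
      · rintro ⟨ω', h, h2⟩
        refine hT ω' ω (fun i hi => ?_) h
        exact congrFun h2 ⟨i, by omega⟩
    have hm : Measurable (fun (ω : ℕ → S) (i : Fin (N + 1)) => ω i) :=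
      measurable_pi_lambda _ (fun i => measurable_pi_apply _)
    have hmap : μ.map (fun (ω : ℕ → S) (i : Fin (N + 1)) => ω i) =
        ν.map (fun (ω : ℕ → S) (i : Fin (N + 1)) => ω i) := by
      refine Measure.ext_of_singleton (fun q => ?_)
      rw [Measure.map_apply hm (Set.to_countable _).measurableSet,
        Measure.map_apply hm (Set.to_countable _).measurableSet]
      have : (fun (ω : ℕ → S) (i : Fin (N + 1)) => ω i) ⁻¹' {q} =
          cyl (fun i => if h : i < N + 1 then q ⟨i, h⟩ else q 0) N := by
        ext ω
        simp only [Set.mem_preimage, Set.mem_singleton_iff, cyl, Set.mem_ofPred_eq]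
        constructor
        · intro hq i hi
          have : i < N + 1 := by omega
          simp [this, ← hq]
        · intro hq
          funext i
          have h2 := hq i (by omega)
          rw [dif_pos i.2] at h2
          exact h2
      rw [this, h]
    rw [h1, ← Measure.map_apply hm (Set.to_countable _).measurableSet, hmap,
      Measure.map_apply hm (Set.to_countable _).measurableSet]
  refine ext_of_generate_finite (measurableCylinders (fun _ : ℕ => S))
    generateFrom_measurableCylinders.symm isPiSystem_measurableCylinders ?_ ?_
  · intro T hT
    obtain ⟨s, R, _, rfl⟩ := (mem_measurableCylinders T).1 hT
    refine hpre (s.sup id) _ (fun ω ω' h hω => ?_)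
    rw [mem_cylinder] at hω ⊢
    have : s.restrict ω' = s.restrict ω := by
      funext i
      exact (h i.1 (Finset.le_sup (f := id) i.2)).symm
    rwa [this]
  · exact hpre 0 univ (fun _ _ _ _ => trivial)

/-- follow `x` before time `n`, then `z` -/
def glue (x : ℕ → S) (n : ℕ) (z : ℕ → S) : ℕ → S := fun i => if i < n then x i else z (i - n)

theorem transCount_congr {x y : ℕ → S} {n : ℕ} (h : ∀ i ≤ n, x i = y i) (u v : S) :
    transCount x n u v = transCount y n u v := by
  unfold transCount
  congr 1
  ext i
  simp only [Set.mem_ofPred_eq]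
  refine and_congr_right (fun hi => ?_)
  rw [h i (by omega), h (i + 1) (by omega)]

theorem glue_le {x z : ℕ → S} {n : ℕ} (hz : z 0 = x n) (i : ℕ) (hi : i ≤ n) : glue x n z i = x i := by
  unfold glue
  split_ifs with h
  · rfl
  · have : i = n := by omega
    subst this; simpa using hz

theorem glue_add (x z : ℕ → S) (n i : ℕ) : glue x n z (n + i) = z i := by
  simp [glue]

theorem transCount_glue {x z : ℕ → S} {n : ℕ} (hz : z 0 = x n) (m : ℕ) (u v : S) :
    transCount (glue x n z) (n + m) u v = transCount x n u v + transCount z m u v := by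
  induction m with
  | zero =>
    rw [add_zero, transCount_congr (glue_le hz)]
    simp [transCount]
  | succ m ih =>
    rw [← add_assoc, transCount_succ, transCount_succ, ih, glue_add, add_assoc n m 1, glue_add,
      add_assoc]

theorem finEquiv_end {x y : ℕ → S} {n : ℕ} (h : FinEquiv x y n) : x n = y n := by
  have hp := (finEquiv_iff x y n).1 h
  set U : Finset S := (x 0 :: tl x n).toFinset ∪ (y 0 :: tl y n).toFinset with hU
  have b1 := stk_balance U (x 0) (tl x n) (by simp [hU]) (fun a ha => by simp [hU, ha]) (x n)
  have b2 := stk_balance U (y 0) (tl y n) (by simp [hU]) (fun a ha => by simp [hU, ha]) (x n)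
  rw [tl_last] at b1 b2
  have e1 : InC U (stk (x 0) (tl x n)) (x n) = InC U (stk (y 0) (tl y n)) (x n) := by
    unfold InC
    exact Finset.sum_congr rfl (fun w _ => (hp.2 w).count_eq _)
  have e2 : (stk (x 0) (tl x n) (x n)).length = (stk (y 0) (tl y n) (x n)).length :=
    (hp.2 _).length_eq
  by_contra hne
  rw [e1, e2, ← hp.1] at b1
  rw [← hp.1] at b2
  rw [b2] at b1
  simp [hne] at b1

theorem finEquiv_glue {x y z : ℕ → S} {n : ℕ} (h : FinEquiv x y n) (hz : z 0 = x n) (m : ℕ) :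
    FinEquiv (glue x n z) (glue y n z) (n + m) := by
  have hz' : z 0 = y n := hz.trans (finEquiv_end h)
  refine ⟨?_, fun u v => ?_⟩
  · rw [glue_le hz 0 (by omega), glue_le hz' 0 (by omega)]; exact h.1
  · rw [transCount_glue hz, transCount_glue hz', h.2]

/-- the shift by `n` -/
def sh (n : ℕ) (ω : ℕ → S) : ℕ → S := fun t => ω (n + t)

theorem sh_meas [MeasurableSpace S] (n : ℕ) : Measurable (sh n : (ℕ → S) → ℕ → S) :=
  measurable_pi_lambda _ (fun _ => measurable_pi_apply _)

theorem cyl_glue (x z : ℕ → S) (n m : ℕ) (hz : z 0 = x n) :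
    sh n ⁻¹' cyl z m ∩ cyl x n = cyl (glue x n z) (n + m) := by
  ext ω
  simp only [Set.mem_inter_iff, Set.mem_preimage, cyl, Set.mem_ofPred_eq, sh]
  constructor
  · rintro ⟨h1, h2⟩ i hi
    rcases le_total i n with h | h
    · rw [glue_le hz i h]; exact h2 i h
    · obtain ⟨k, rfl⟩ := Nat.exists_eq_add_of_le h
      rw [glue_add]; exact h1 k (by omega)
  · intro h
    refine ⟨fun i hi => ?_, fun i hi => ?_⟩
    · rw [h (n + i) (by omega), glue_add]
    · rw [h i (by omega), glue_le hz i hi]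

theorem cyl_glue_ne (x z : ℕ → S) (n m : ℕ) (hz : z 0 ≠ x n) :
    sh n ⁻¹' cyl z m ∩ cyl x n = ∅ := by
  ext ω
  simp only [Set.mem_inter_iff, Set.mem_preimage, cyl, Set.mem_ofPred_eq, sh, Set.mem_empty_iff_false,
    iff_false]
  rintro ⟨h1, h2⟩
  exact hz ((h1 0 (by omega)).symm.trans (h2 n le_rfl))

/-- partially exchangeable measures are invariant under swapping equivalent prefixes -/
theorem swap [Countable S] [MeasurableSpace S] [DiscreteMeasurableSpace S]
    {μ : Measure (ℕ → S)} [IsFiniteMeasure μ] (hμ : PartiallyExchangeable μ) {x y : ℕ → S} {n : ℕ}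
    (h : FinEquiv x y n) (B : Set (ℕ → S)) (hB : MeasurableSet B) :
    μ (sh n ⁻¹' B ∩ cyl x n) = μ (sh n ⁻¹' B ∩ cyl y n) := by
  have key : (μ.restrict (cyl x n)).map (sh n) = (μ.restrict (cyl y n)).map (sh n) := by
    refine cyl_ext (fun z m => ?_)
    rw [Measure.map_apply (sh_meas n) (cyl_meas z m), Measure.map_apply (sh_meas n) (cyl_meas z m),
      Measure.restrict_apply (sh_meas n (cyl_meas z m)),
      Measure.restrict_apply (sh_meas n (cyl_meas z m))]
    by_cases hz : z 0 = x n
    · rw [cyl_glue x z n m hz, cyl_glue y z n m (hz.trans (finEquiv_end h))]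
      exact hμ _ _ _ (finEquiv_glue h hz m)
    · rw [cyl_glue_ne x z n m hz, cyl_glue_ne y z n m (by rwa [← finEquiv_end h])]
  have := congrArg (fun ν => ν B) key
  simpa only [Measure.map_apply (sh_meas n) hB, Measure.restrict_apply (sh_meas n hB)] using this

/-- the law of the shifted sequence on the event that the first step is `a` -/
noncomputable def stepM [MeasurableSpace S] (μ : Measure (ℕ → S)) (a : S) : Measure (ℕ → S) :=
  (μ.restrict {ω | ω 1 = a}).map (sh 1)

theorem stepM_cyl [Countable S] [MeasurableSpace S] [DiscreteMeasurableSpace S]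
    {μ : Measure (ℕ → S)} {o a : S} (ho : ∀ᵐ ω ∂μ, ω 0 = o) (x : ℕ → S) (hx : x 0 = a) (n : ℕ) :
    stepM μ a (cyl x n) = μ (cyl (glue (fun _ => o) 1 x) (1 + n)) := by
  unfold stepM
  rw [Measure.map_apply (sh_meas 1) (cyl_meas x n), Measure.restrict_apply (sh_meas 1 (cyl_meas x n))]
  refine measure_congr ?_
  filter_upwards [ho] with ω hω
  apply propext
  change (ω ∈ sh 1 ⁻¹' cyl x n ∩ {ω | ω 1 = a}) ↔ ω ∈ cyl (glue (fun _ => o) 1 x) (1 + n)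
  simp only [Set.mem_inter_iff, Set.mem_preimage, cyl, Set.mem_ofPred_eq, sh]
  constructor
  · rintro ⟨h1, h2⟩ i hi
    cases i with
    | zero => simpa [glue] using hω
    | succ i => rw [add_comm i 1, glue_add]; exact h1 i (by omega)
  · intro h
    refine ⟨fun i hi => ?_, ?_⟩
    · rw [h (1 + i) (by omega), glue_add]
    · have := h (1 + 0) (by omega)
      rw [glue_add, hx] at this
      exact this

theorem stepM_cyl_ne [Countable S] [MeasurableSpace S] [DiscreteMeasurableSpace S]
    {μ : Measure (ℕ → S)} {a : S} (x : ℕ → S) (hx : x 0 ≠ a) (n : ℕ) :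
    stepM μ a (cyl x n) = 0 := by
  unfold stepM
  rw [Measure.map_apply (sh_meas 1) (cyl_meas x n), Measure.restrict_apply (sh_meas 1 (cyl_meas x n))]
  have : sh 1 ⁻¹' cyl x n ∩ {ω | ω 1 = a} = ∅ := by
    ext ω
    simp only [Set.mem_inter_iff, Set.mem_preimage, cyl, Set.mem_ofPred_eq, sh, Set.mem_empty_iff_false,
      iff_false]
    rintro ⟨h1, h2⟩
    exact hx ((h1 0 (by omega)).symm.trans h2)
  rw [this, measure_empty]

theorem stepM_PE [Countable S] [MeasurableSpace S] [DiscreteMeasurableSpace S]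
    {μ : Measure (ℕ → S)} (hμ : PartiallyExchangeable μ) {o a : S}
    (ho : ∀ᵐ ω ∂μ, ω 0 = o) : PartiallyExchangeable (stepM μ a) := by
  intro n x y h
  change stepM μ a (cyl x n) = stepM μ a (cyl y n)
  by_cases hx : x 0 = a
  · have hy : y 0 = a := h.1 ▸ hx
    rw [stepM_cyl ho x hx n, stepM_cyl ho y hy n]
    apply hμ
    set f : ℕ → S := fun i => if i = 0 then o else a with hf
    have e : ∀ z : ℕ → S, glue (fun _ => o) 1 z = glue f 1 z := by
      intro z; funext i
      unfold glue
      by_cases hi : i < 1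
      · have : i = 0 := by omega
        simp [this, hf]
      · simp [hi]
    rw [e, e]
    refine ⟨?_, fun u v => ?_⟩
    · simp [glue]
    · rw [transCount_glue (by simp [hf, hx]), transCount_glue (by simp [hf, hy]), h.2]
  · have hy : y 0 ≠ a := h.1 ▸ hx
    rw [stepM_cyl_ne x hx, stepM_cyl_ne y hy]

theorem transNum_sh (ω : ℕ → S) (u v : S) :
    transNum (sh 1 ω) u v + (if u = ω 0 ∧ v = ω 1 then 1 else 0) = transNum ω u v := by
  unfold transNum
  have e : {i : ℕ | ω i = u ∧ ω (i + 1) = v} =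
      (fun i => i + 1) '' {i : ℕ | sh 1 ω i = u ∧ sh 1 ω (i + 1) = v} ∪
        (if u = ω 0 ∧ v = ω 1 then {0} else ∅) := by
    ext i
    simp only [Set.mem_ofPred_eq, Set.mem_union, Set.mem_image, sh]
    cases i with
    | zero =>
      by_cases h : u = ω 0 ∧ v = ω 1
      · simp [h]
      · simp [h]
        intro h1 h2
        exact h ⟨h1.symm, h2.symm⟩
    | succ i =>
      have : (i + 1) ∉ (if u = ω 0 ∧ v = ω 1 then {0} else ∅ : Set ℕ) := by split_ifs <;> simp
      simp [this, add_comm 1]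
  rw [e, Set.encard_union_eq, (add_left_injective 1).encard_image]
  · split_ifs <;> simp
  · rw [Set.disjoint_left]
    rintro i ⟨j, _, rfl⟩
    split_ifs <;> simp

theorem good_sh {o a : S} {M : S → S → ℕ∞} {ω : ℕ → S} (h : Good o M ω) (ha : ω 1 = a) :
    Good a (fun u v => M u v - if u = o ∧ v = a then 1 else 0) (sh 1 ω) := by
  refine ⟨ha, fun u v => ?_, fun s => ?_⟩
  · change transNum (sh 1 ω) u v = M u v - if u = o ∧ v = a then 1 else 0
    rw [← h.2.1, ← transNum_sh ω u v, h.1, ha]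
    refine (AddLECancellable.add_tsub_cancel_right ?_).symm
    apply ENat.addLECancellable_of_ne_top
    split_ifs <;> simp
  · have := h.2.2 s
    exact this.preimage (f := fun t => 1 + t) ((add_right_injective 1).injOn)

theorem stepM_good [Countable S] [MeasurableSpace S] [DiscreteMeasurableSpace S]
    {μ : Measure (ℕ → S)} {o a : S} {M : S → S → ℕ∞} (h : ∀ᵐ ω ∂μ, Good o M ω)
    (hm : MeasurableSet {ω | Good a (fun u v => M u v - if u = o ∧ v = a then 1 else 0) ω}) :
    ∀ᵐ ω ∂(stepM μ a), Good a (fun u v => M u v - if u = o ∧ v = a then 1 else 0) ω := by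
  unfold stepM
  rw [ae_map_iff (sh_meas 1).aemeasurable hm, ae_restrict_iff' (one_meas 1 a)]
  filter_upwards [h] with ω hω ha
  exact good_sh hω ha

theorem encard_meas [Countable S] [MeasurableSpace S] [DiscreteMeasurableSpace S] (u v : S) (k : ℕ∞) :
    MeasurableSet {ω : ℕ → S | transNum ω u v = k} := by
  have hle : ∀ k : ℕ, MeasurableSet {ω : ℕ → S | transNum ω u v ≤ k} := by
    intro k
    have : {ω : ℕ → S | transNum ω u v ≤ k} =
        ⋂ N : ℕ, {ω : ℕ → S | transCount ω N u v ≤ k} := by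
      ext ω
      simp only [Set.mem_ofPred_eq, Set.mem_iInter]
      have hfin : ∀ N, {i : ℕ | i < N ∧ ω i = u ∧ ω (i + 1) = v}.Finite := fun N =>
        (Set.finite_lt_nat N).subset (fun i hi => hi.1)
      constructor
      · intro h N
        have h2 : ((transCount ω N u v : ℕ) : ℕ∞) ≤ transNum ω u v := by
          unfold transCount transNum
          rw [(hfin N).cast_ncard_eq]
          exact Set.encard_le_encard (fun i hi => hi.2)
        exact_mod_cast h2.trans h
      · intro h
        unfold transNum
        by_contra hc
        push Not at hc
        obtain ⟨t, ht, htc⟩ := Set.exists_subset_encard_eq (Order.add_one_le_of_lt hc)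
        have htf : t.Finite := by
          apply Set.finite_of_encard_eq_coe (k := k + 1)
          rw [htc]; norm_cast
        obtain ⟨N, hN⟩ := htf.bddAbove
        have h2 := h (N + 1)
        have h3 : t.encard ≤ {i : ℕ | i < N + 1 ∧ ω i = u ∧ ω (i + 1) = v}.encard :=
          Set.encard_le_encard (fun i hi => ⟨Nat.lt_succ_of_le (hN hi), ht hi⟩)
        rw [← (hfin (N + 1)).cast_ncard_eq, htc] at h3
        unfold transCount at h2
        have h4 : k + 1 ≤ {i : ℕ | i < N + 1 ∧ ω i = u ∧ ω (i + 1) = v}.ncard := by exact_mod_cast h3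
        omega
    rw [this]
    refine MeasurableSet.iInter (fun N => meas_initseg N _ (fun ω ω' h hω => ?_))
    simp only [Set.mem_ofPred_eq] at hω ⊢
    rwa [← transCount_congr h]
  induction k with
  | top =>
    have : {ω : ℕ → S | transNum ω u v = ⊤} = ⋂ k : ℕ, {ω : ℕ → S | transNum ω u v ≤ k}ᶜ := by
      ext ω
      simp only [Set.mem_ofPred_eq, Set.mem_iInter, Set.mem_compl_iff, not_le]
      rw [ENat.eq_top_iff_forall_gt]
    rw [this]
    exact MeasurableSet.iInter (fun k => (hle k).compl)
  | coe k =>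
    cases k with
    | zero =>
      have := hle 0
      simpa using this
    | succ k =>
      have : {ω : ℕ → S | transNum ω u v = ((k + 1 : ℕ) : ℕ∞)} =
          {ω : ℕ → S | transNum ω u v ≤ ((k + 1 : ℕ) : ℕ∞)} \ {ω : ℕ → S | transNum ω u v ≤ k} := by
        ext ω
        simp only [Set.mem_ofPred_eq, Set.mem_sdiff, not_le]
        generalize transNum ω u v = t
        induction t with
        | top => simpa using (ENat.coe_ne_top (k + 1)).symm
        | coe t => norm_cast; omega
      rw [this]
      exact (hle _).diff (hle _)

theorem transient_meas [Countable S] [MeasurableSpace S] [DiscreteMeasurableSpace S] :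
    MeasurableSet {ω : ℕ → S | Transient ω} := by
  have : {ω : ℕ → S | Transient ω} = ⋂ s : S, ⋃ N : ℕ, ⋂ i : ℕ, {ω : ℕ → S | N ≤ i → ω i ≠ s} := by
    ext ω
    simp only [Set.mem_ofPred_eq, Set.mem_iInter, Set.mem_iUnion]
    constructor
    · intro h s
      obtain ⟨N, hN⟩ := Transient.bound h {s}
      exact ⟨N, hN s (by simp)⟩
    · intro h s
      obtain ⟨N, hN⟩ := h s
      refine (Set.finite_lt_nat N).subset (fun i hi => ?_)
      by_contra hc
      exact hN i (not_lt.1 hc) hi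
  rw [this]
  refine MeasurableSet.iInter fun s => MeasurableSet.iUnion fun N => MeasurableSet.iInter fun i => ?_
  by_cases h : N ≤ i
  · simp only [h, forall_const]
    exact (one_meas i s).compl
  · simp [h]

theorem tn_meas [Countable S] [MeasurableSpace S] [DiscreteMeasurableSpace S] (o : S) (M : S → S → ℕ∞) :
    MeasurableSet {ω : ℕ → S | ω 0 = o ∧ ∀ u v, transNum ω u v = M u v} := by
  have : {ω : ℕ → S | ω 0 = o ∧ ∀ u v, transNum ω u v = M u v} =
      {ω : ℕ → S | ω 0 = o} ∩ ⋂ u, ⋂ v, {ω : ℕ → S | transNum ω u v = M u v} := by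
    ext ω; simp
  rw [this]
  exact (one_meas 0 o).inter (MeasurableSet.iInter fun u => MeasurableSet.iInter fun v =>
    encard_meas u v _)

theorem good_meas [Countable S] [MeasurableSpace S] [DiscreteMeasurableSpace S] (o : S) (M : S → S → ℕ∞) :
    MeasurableSet {ω : ℕ → S | Good o M ω} := by
  have : {ω : ℕ → S | Good o M ω} = {ω : ℕ → S | ω 0 = o ∧ ∀ u v, transNum ω u v = M u v} ∩
      {ω : ℕ → S | Transient ω} := by
    ext ω; simp [Good, and_assoc]
  rw [this]
  exact (tn_meas o M).inter transient_meas

theorem cyl_unique [Countable S] [MeasurableSpace S] [DiscreteMeasurableSpace S] (n : ℕ) :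
    ∀ (o : S) (M : S → S → ℕ∞) (μ1 μ2 : Measure (ℕ → S)), IsFiniteMeasure μ1 → IsFiniteMeasure μ2 →
      PartiallyExchangeable μ1 → PartiallyExchangeable μ2 → (∀ᵐ ω ∂μ1, Good o M ω) →
      (∀ᵐ ω ∂μ2, Good o M ω) → μ1 univ = μ2 univ → ∀ x, μ1 (cyl x n) = μ2 (cyl x n) := by
  induction n with
  | zero =>
    intro o M μ1 μ2 f1 f2 p1 p2 g1 g2 hu x
    have key : ∀ μ : Measure (ℕ → S), (∀ᵐ ω ∂μ, Good o M ω) →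
        μ (cyl x 0) = if x 0 = o then μ univ else 0 := by
      intro μ g
      split_ifs with hx
      · refine measure_congr ?_
        filter_upwards [g] with ω hω
        apply propext
        refine ⟨fun _ => trivial, fun _ i hi => ?_⟩
        have : i = 0 := by omega
        rw [this, hω.1, hx]
      · rw [measure_eq_zero_iff_ae_notMem]
        filter_upwards [g] with ω hω hc
        exact hx ((hc 0 le_rfl).symm.trans hω.1)
    rw [key μ1 g1, key μ2 g2, hu]
  | succ n ih =>
    intro o M μ1 μ2 f1 f2 p1 p2 g1 g2 hu x
    have hfin : ∀ μ : Measure (ℕ → S), IsFiniteMeasure μ → IsFiniteMeasure (stepM μ (x 1)) := by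
      intro μ _
      unfold stepM
      infer_instance
    have h0 : ∀ μ : Measure (ℕ → S), (∀ᵐ ω ∂μ, Good o M ω) → ∀ᵐ ω ∂μ, ω 0 = o := by
      intro μ g
      filter_upwards [g] with ω hω using hω.1
    by_cases hx : x 0 = o
    · have e : x = glue (fun _ => o) 1 (sh 1 x) := by
        funext i
        cases i with
        | zero => simp [glue, hx]
        | succ i => rw [add_comm i 1, glue_add, sh]
      have hc : ∀ μ : Measure (ℕ → S), (∀ᵐ ω ∂μ, Good o M ω) →
          μ (cyl x (n + 1)) = stepM μ (x 1) (cyl (sh 1 x) n) := by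
        intro μ g
        rw [stepM_cyl (a := x 1) (h0 μ g) (sh 1 x) rfl n, ← e, add_comm]
      rw [hc μ1 g1, hc μ2 g2]
      refine ih (x 1) _ _ _ (hfin _ f1) (hfin _ f2) (stepM_PE p1 (h0 _ g1)) (stepM_PE p2 (h0 _ g2))
        (stepM_good g1 (good_meas _ _)) (stepM_good g2 (good_meas _ _)) ?_ (sh 1 x)
      obtain ⟨ρ, hρ⟩ := first_step_good o M
      have hs : ∀ μ : Measure (ℕ → S), stepM μ (x 1) univ = μ {ω | ω 1 = x 1} := by
        intro μ
        unfold stepM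
        rw [Measure.map_apply (sh_meas 1) MeasurableSet.univ, Set.preimage_univ,
          Measure.restrict_apply_univ]
      rw [hs, hs, hρ μ1 f1 p1 g1, hρ μ2 f2 p2 g2, hu]
    · have hz : ∀ μ : Measure (ℕ → S), (∀ᵐ ω ∂μ, Good o M ω) → μ (cyl x (n + 1)) = 0 := by
        intro μ g
        rw [measure_eq_zero_iff_ae_notMem]
        filter_upwards [g] with ω hω hc
        exact hx ((hc 0 (by omega)).symm.trans hω.1)
      rw [hz μ1 g1, hz μ2 g2]

theorem good_unique [Countable S] [MeasurableSpace S] [DiscreteMeasurableSpace S]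
    {o : S} {M : S → S → ℕ∞} {μ1 μ2 : Measure (ℕ → S)} [f1 : IsFiniteMeasure μ1]
    [f2 : IsFiniteMeasure μ2] (p1 : PartiallyExchangeable μ1) (p2 : PartiallyExchangeable μ2)
    (g1 : ∀ᵐ ω ∂μ1, Good o M ω) (g2 : ∀ᵐ ω ∂μ2, Good o M ω) (hu : μ1 univ = μ2 univ) : μ1 = μ2 :=
  cyl_ext (fun x n => cyl_unique n o M μ1 μ2 f1 f2 p1 p2 g1 g2 hu x)

end


/-! ### Part J : extremality -/

section
open Classical

theorem ae_of_one {Ω : Type} [MeasurableSpace Ω] {μ : Measure Ω} (hprob : μ univ = 1) {A : Set Ω}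
    (hA : MeasurableSet A) (h : μ A = 1) : ∀ᵐ ω ∂μ, ω ∈ A := by
  have : IsProbabilityMeasure μ := ⟨hprob⟩
  exact (mem_ae_iff_prob_eq_one hA).2 h

theorem two_one [Countable S] [MeasurableSpace S] [DiscreteMeasurableSpace S]
    {μ : Measure (ℕ → S)} (hprob : μ univ = 1) (hPE : PartiallyExchangeable μ)
    {o : S} {M : S → S → ℕ∞} (hg : ∀ᵐ ω ∂μ, Good o M ω) : IsExtremePE μ := by
  refine ⟨⟨hprob, hPE⟩, ?_⟩
  intro μ1 h1 μ2 h2 t ht0 ht1 hμ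
  have f1 : IsFiniteMeasure μ1 := ⟨by rw [h1.1]; simp⟩
  have f2 : IsFiniteMeasure μ2 := ⟨by rw [h2.1]; simp⟩
  have hz : μ {ω | ¬ Good o M ω} = 0 := hg
  rw [hμ, Measure.add_apply, Measure.smul_apply, Measure.smul_apply, add_eq_zero, smul_eq_mul,
    smul_eq_mul, mul_eq_zero, mul_eq_zero] at hz
  have g1 : ∀ᵐ ω ∂μ1, Good o M ω := hz.1.resolve_left ht0.ne'
  have g2 : ∀ᵐ ω ∂μ2, Good o M ω := hz.2.resolve_left (tsub_pos_of_lt ht1).ne'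
  exact good_unique h1.2 h2.2 g1 g2 (h1.1.trans h2.1.symm)

theorem extreme_zero_one [Countable S] [MeasurableSpace S] [DiscreteMeasurableSpace S]
    {μ : Measure (ℕ → S)} (hex : IsExtremePE μ) (I : Set (ℕ → S)) (hI : MeasurableSet I)
    (hinv : ∀ n x y, FinEquiv x y n → μ (cyl x n ∩ I) = μ (cyl y n ∩ I)) (h0 : μ I ≠ 0) :
    μ I = 1 := by
  have hprob := hex.1.1
  have hp : IsProbabilityMeasure μ := ⟨hprob⟩
  by_contra h1
  have hlt : μ I < 1 := lt_of_le_of_ne prob_le_one h1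
  have hcc : μ Iᶜ = 1 - μ I := prob_compl_eq_one_sub hI
  have hc0 : μ Iᶜ ≠ 0 := by rw [hcc]; exact (tsub_pos_of_lt hlt).ne'
  have hinv' : ∀ n x y, FinEquiv x y n → μ (cyl x n ∩ Iᶜ) = μ (cyl y n ∩ Iᶜ) := by
    intro n x y h
    have e : ∀ z, μ (cyl z n ∩ Iᶜ) = μ (cyl z n) - μ (cyl z n ∩ I) := by
      intro z
      have h3 := measure_inter_add_sdiff (μ := μ) (cyl z n) hI
      rw [← h3, Set.sdiff_eq, ENNReal.add_sub_cancel_left (measure_ne_top _ _)]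
    rw [e, e, hinv n x y h]
    congr 1
    exact hex.1.2 n x y h
  have mk : ∀ J : Set (ℕ → S), MeasurableSet J → μ J ≠ 0 →
      (∀ n x y, FinEquiv x y n → μ (cyl x n ∩ J) = μ (cyl y n ∩ J)) →
      (μ J)⁻¹ • μ.restrict J ∈ PEProb S := by
    intro J hJ hJ0 hJi
    refine ⟨?_, ?_⟩
    · rw [Measure.smul_apply, Measure.restrict_apply_univ, smul_eq_mul,
        ENNReal.inv_mul_cancel hJ0 (measure_ne_top _ _)]
    · intro n x y h
      change ((μ J)⁻¹ • μ.restrict J) (cyl x n) = ((μ J)⁻¹ • μ.restrict J) (cyl y n)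
      rw [Measure.smul_apply, Measure.smul_apply, Measure.restrict_apply (cyl_meas x n),
        Measure.restrict_apply (cyl_meas y n), hJi n x y h]
  have := hex.2 _ (mk I hI h0 hinv) _ (mk Iᶜ hI.compl hc0 hinv') (μ I) (pos_iff_ne_zero.2 h0) hlt ?_
  · have e := congrArg (fun ν => ν I) this
    simp only [Measure.smul_apply, Measure.restrict_apply hI, smul_eq_mul, inter_self,
      inter_compl_self, measure_empty, mul_zero] at e
    rw [ENNReal.inv_mul_cancel h0 (measure_ne_top _ _)] at e
    exact one_ne_zero e
  · rw [← hcc, smul_smul, smul_smul, ENNReal.mul_inv_cancel h0 (measure_ne_top _ _),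
      ENNReal.mul_inv_cancel hc0 (measure_ne_top _ _), one_smul, one_smul,
      Measure.restrict_add_restrict_compl hI]

theorem transNum_split (ω : ℕ → S) (n : ℕ) (u v : S) :
    transNum ω u v = transCount ω n u v + transNum (sh n ω) u v := by
  induction n with
  | zero =>
    have : sh 0 ω = ω := by funext t; simp [sh]
    rw [this]
    simp [transCount]
  | succ n ih =>
    rw [ih, ← transNum_sh (sh n ω), transCount_succ]
    have : sh 1 (sh n ω) = sh (n + 1) ω := by
      funext t; simp only [sh]; congr 1; omega
    rw [this]
    simp only [sh, add_zero]
    push_cast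
    rw [add_assoc, add_comm (transNum _ _ _)]
    congr 2
    simp [eq_comm]

theorem one_two [Countable S] [MeasurableSpace S] [DiscreteMeasurableSpace S]
    {μ : Measure (ℕ → S)} (hex : IsExtremePE μ) :
    ∃ (s0 : S) (M : S → S → ℕ∞), μ {x | x 0 = s0 ∧ ∀ u v, transNum x u v = M u v} = 1 := by
  have hp : IsProbabilityMeasure μ := ⟨hex.1.1⟩
  have hs : ∃ s, ∀ᵐ ω ∂μ, ω 0 = s := by
    have : ∃ s, μ {ω : ℕ → S | ω 0 = s} ≠ 0 := by
      by_contra hc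
      push Not at hc
      have h1 := measure_iUnion_null hc
      have : (⋃ s, {ω : ℕ → S | ω 0 = s}) = univ := by ext ω; simp
      rw [this, hex.1.1] at h1
      exact one_ne_zero h1
    obtain ⟨s, hs⟩ := this
    refine ⟨s, ae_of_one hex.1.1 (one_meas 0 s) (extreme_zero_one hex {ω : ℕ → S | ω 0 = s} (one_meas 0 s) ?_ hs)⟩
    intro n x y h
    have e : ∀ z : ℕ → S, cyl z n ∩ {ω | ω 0 = s} = if z 0 = s then cyl z n else ∅ := by
      intro z
      ext ω
      split_ifs with hz
      · simp only [Set.mem_inter_iff, Set.mem_ofPred_eq, and_iff_left_iff_imp]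
        intro h; exact (h 0 (by omega)).trans hz
      · simp only [Set.mem_inter_iff, Set.mem_ofPred_eq, Set.mem_empty_iff_false, iff_false]
        rintro ⟨h1, h2⟩
        exact hz ((h1 0 (by omega)).symm.trans h2)
    rw [e, e, ← h.1]
    split_ifs
    · exact hex.1.2 n x y h
    · rfl
  have ht : ∀ u v, ∃ k : ℕ∞, ∀ᵐ ω ∂μ, transNum ω u v = k := by
    intro u v
    have : ∃ k : ℕ∞, μ {ω : ℕ → S | transNum ω u v = k} ≠ 0 := by
      by_contra hc
      push Not at hc
      have h1 := measure_iUnion_null hc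
      have : (⋃ k, {ω : ℕ → S | transNum ω u v = k}) = univ := by ext ω; simp
      rw [this, hex.1.1] at h1
      exact one_ne_zero h1
    obtain ⟨k, hk⟩ := this
    refine ⟨k, ae_of_one hex.1.1 (encard_meas u v k) (extreme_zero_one hex
      {ω : ℕ → S | transNum ω u v = k} (encard_meas u v k) ?_ hk)⟩
    intro n x y h
    have e : ∀ z : ℕ → S, cyl z n ∩ {ω | transNum ω u v = k} =
        sh n ⁻¹' {ζ | (transCount z n u v : ℕ∞) + transNum ζ u v = k} ∩ cyl z n := by
      intro z
      ext ω
      simp only [Set.mem_inter_iff, Set.mem_ofPred_eq, Set.mem_preimage]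
      rw [and_comm]
      refine and_congr_left (fun hz => ?_)
      rw [transNum_split ω n u v, transCount_congr hz]
    rw [e, e, h.2]
    refine swap hex.1.2 h _ ?_
    have : {ζ : ℕ → S | (transCount y n u v : ℕ∞) + transNum ζ u v = k} =
        ⋃ j : {j : ℕ∞ // (transCount y n u v : ℕ∞) + j = k}, {ζ : ℕ → S | transNum ζ u v = j.1} := by
      ext ζ
      simp
    rw [this]
    exact MeasurableSet.iUnion (fun j => encard_meas u v j.1)
  obtain ⟨s, hs⟩ := hs
  choose M hM using ht
  refine ⟨s, M, ?_⟩
  rw [← mem_ae_iff_prob_eq_one (tn_meas s M)]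
  have hM' : ∀ᵐ ω ∂μ, ∀ u v, transNum ω u v = M u v := by
    rw [ae_all_iff]; intro u
    rw [ae_all_iff]; intro v
    exact hM u v
  filter_upwards [hs, hM'] with ω h1 h2
  exact ⟨h1, h2⟩

theorem three_two [Countable S] [MeasurableSpace S] [DiscreteMeasurableSpace S]
    {μ : Measure (ℕ → S)} (hprob : μ univ = 1) (h : IsGibbsVertexLaw μ) :
    ∃ (s0 : S) (M : S → S → ℕ∞), μ {x | x 0 = s0 ∧ ∀ u v, transNum x u v = M u v} = 1 := by
  obtain ⟨Vs, E, mE, G, o, _, _, μp, hG, hν⟩ := h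
  refine ⟨o, fun u v => Set.encard {e | (G.src e : S) = u ∧ (G.dst e : S) = v}, ?_⟩
  refine le_antisymm ((measure_mono (subset_univ _)).trans hprob.le) ?_
  rw [hν _ (tn_meas _ _), ← hG.2.1]
  refine measure_mono ?_
  rintro γ ⟨h1, h2, h3⟩
  simp only [Set.mem_preimage, Set.mem_ofPred_eq]
  refine ⟨by rw [h2], fun u v => ?_⟩
  unfold transNum
  have : {e | (G.src e : S) = u ∧ (G.dst e : S) = v} =
      γ '' {i | (G.src (γ i) : S) = u ∧ (G.src (γ (i + 1)) : S) = v} := by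
    ext e
    obtain ⟨i, rfl⟩ := h3.2 e
    simp only [Set.mem_ofPred_eq, h3.1.mem_set_image, h1]
  rw [this, h3.1.encard_image]

end


/-! ### Part K : the Gibbs measure -/

section
open Classical

/-- the type (source, target) of an edge -/
def ety {Vs : Set S} {E : Type} (G : DigraphStruct (↥Vs) E) (e : E) : S × S :=
  ((G.src e : S), (G.dst e : S))

/-- pairs of consecutive states -/
def prs (z : ℕ → S) : ℕ → S × S := fun i => (z i, z (i + 1))

theorem prs_meas [MeasurableSpace S] : Measurable (prs : (ℕ → S) → ℕ → S × S) :=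
  measurable_pi_lambda _ (fun i => (measurable_pi_apply i).prodMk (measurable_pi_apply (i + 1)))

/-- vertex sequence of a finite edge sequence -/
def vpt {Vs : Set S} {E : Type} (G : DigraphStruct (↥Vs) E) {k : ℕ} (w : Fin (k + 1) → E) : ℕ → S :=
  fun i => if h : i < k + 1 then (G.src (w ⟨i, h⟩) : S) else (G.dst (w (Fin.last k)) : S)

theorem vpt_lt {Vs : Set S} {E : Type} (G : DigraphStruct (↥Vs) E) {k : ℕ} (w : Fin (k + 1) → E)
    (i : Fin (k + 1)) : vpt G w i = G.src (w i) := by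
  simp only [vpt, i.2, dif_pos]

theorem vpt_succ {Vs : Set S} {E : Type} (G : DigraphStruct (↥Vs) E) {o : ↥Vs} {k : ℕ}
    {w : Fin (k + 1) → E} (hw : PrefixPath G o w) (i : Fin (k + 1)) :
    vpt G w (i + 1) = G.dst (w i) := by
  by_cases h : (i : ℕ) + 1 < k + 1
  · rw [vpt, dif_pos h, ← hw.2 i h]
  · rw [vpt, dif_neg h]
    have : i = Fin.last k := by
      apply Fin.ext
      have := i.2
      simp only [Fin.val_last]
      omega
    rw [this]

theorem cyl_vpt {Vs : Set S} {E : Type} (G : DigraphStruct (↥Vs) E) {o : ↥Vs} {k : ℕ}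
    {w : Fin (k + 1) → E} (hw : PrefixPath G o w) (ω : ℕ → S) :
    ω ∈ cyl (vpt G w) (k + 1) ↔ ∀ i : Fin (k + 1), prs ω i = ety G (w i) := by
  constructor
  · intro h i
    have := i.2
    unfold prs ety
    rw [h i (by omega), h (i + 1) (by omega), vpt_lt, vpt_succ G hw]
  · intro h i hi
    by_cases hi' : i < k + 1
    · have := h ⟨i, hi'⟩
      simp only [prs, ety, Prod.mk.injEq] at this
      rw [this.1, ← vpt_lt]
    · have hik : i = k + 1 := by omega
      subst hik
      have := h (Fin.last k)
      simp only [prs, ety, Prod.mk.injEq, Fin.val_last] at this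
      rw [this.2, ← vpt_succ G hw]
      rfl

theorem vpt_finEquiv {Vs : Set S} {E : Type} (G : DigraphStruct (↥Vs) E) {o : ↥Vs} {k : ℕ}
    {w w' : Fin (k + 1) → E} (hw : PrefixPath G o w) (hw' : PrefixPath G o w')
    (hi : Function.Injective w) (hi' : Function.Injective w') (hr : Set.range w = Set.range w') :
    FinEquiv (vpt G w) (vpt G w') (k + 1) := by
  have key : ∀ (w : Fin (k + 1) → E), PrefixPath G o w → Function.Injective w → ∀ u v,
      transCount (vpt G w) (k + 1) u v =
        Set.ncard {e | e ∈ Set.range w ∧ (G.src e : S) = u ∧ (G.dst e : S) = v} := by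
    intro w hw hi u v
    unfold transCount
    have e1 : {i : ℕ | i < k + 1 ∧ vpt G w i = u ∧ vpt G w (i + 1) = v} =
        (fun i : Fin (k + 1) => (i : ℕ)) '' {i | (G.src (w i) : S) = u ∧ (G.dst (w i) : S) = v} := by
      ext i
      simp only [Set.mem_ofPred_eq, Set.mem_image]
      constructor
      · rintro ⟨h, h1, h2⟩
        refine ⟨⟨i, h⟩, ⟨?_, ?_⟩, rfl⟩
        · rw [← vpt_lt]; exact h1
        · rw [← vpt_succ G hw]; exact h2
      · rintro ⟨j, ⟨h1, h2⟩, rfl⟩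
        refine ⟨j.2, ?_, ?_⟩
        · rw [vpt_lt]; exact h1
        · rw [vpt_succ G hw]; exact h2
    have e2 : {e | e ∈ Set.range w ∧ (G.src e : S) = u ∧ (G.dst e : S) = v} =
        w '' {i | (G.src (w i) : S) = u ∧ (G.dst (w i) : S) = v} := by
      ext e
      simp only [Set.mem_ofPred_eq, Set.mem_image, Set.mem_range]
      constructor
      · rintro ⟨⟨i, rfl⟩, h⟩
        exact ⟨i, h, rfl⟩
      · rintro ⟨i, h, rfl⟩
        exact ⟨⟨i, rfl⟩, h⟩
    rw [e1, e2, Set.ncard_image_of_injective _ Fin.val_injective,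
      Set.ncard_image_of_injective _ hi]
  refine ⟨?_, fun u v => ?_⟩
  · have h1 := vpt_lt G w 0
    have h2 := vpt_lt G w' 0
    have h3 := hw.1 (by omega)
    have h4 := hw'.1 (by omega)
    simp only [Fin.coe_ofNat_eq_mod, Nat.zero_mod] at h1 h2
    rw [h1, h2]
    exact congrArg Subtype.val (h3.trans h4.symm)
  · rw [key w hw hi, key w' hw' hi', hr]

theorem gibbs_of [Countable S] [MeasurableSpace S] [DiscreteMeasurableSpace S]
    {E : Type} [mE : MeasurableSpace E] {Vs : Set S} (G : DigraphStruct (↥Vs) E) (o : ↥Vs)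
    (hmE : mE = MeasurableSpace.comap (ety G) inferInstance)
    {μ : Measure (ℕ → S)} (hprob : μ univ = 1) (hPE : PartiallyExchangeable μ)
    (L : (ℕ → S) → ℕ → E) (T : Set (ℕ → S)) (hT : MeasurableSet T) (hTae : ∀ᵐ ω ∂μ, ω ∈ T)
    (c : ℕ → E) (hLc : ∀ ω, ω ∉ T → L ω = c)
    (hL0 : ∀ ω ∈ T, ω 0 = o) (hLb : ∀ ω ∈ T, Function.Bijective (L ω))
    (hLt : ∀ ω ∈ T, ∀ i, ety G (L ω i) = (ω i, ω (i + 1))) :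
    ∃ μp : Measure (ℕ → E), ProperGibbs G o μp ∧ ∀ A : Set (ℕ → S), MeasurableSet A →
        μ A = μp ((fun (γ : ℕ → E) (i : ℕ) => ((G.src (γ i) : S))) ⁻¹' A) := by
  have hp : IsProbabilityMeasure μ := ⟨hprob⟩
  set Q : (ℕ → E) → ℕ → S × S := fun γ i => ety G (γ i) with hQ
  have hpi : (MeasurableSpace.pi : MeasurableSpace (ℕ → E)) = MeasurableSpace.comap Q inferInstance := by
    subst hmE
    unfold MeasurableSpace.pi
    rw [MeasurableSpace.comap_iSup]
    congr 1
    funext i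
    rw [MeasurableSpace.comap_comp, MeasurableSpace.comap_comp]
    rfl
  have hety : Measurable (ety G) := by
    rw [hmE]; exact comap_measurable _
  have hQm : Measurable Q := measurable_pi_lambda _ (fun i => hety.comp (measurable_pi_apply i))
  have hQL : ∀ ω ∈ T, Q (L ω) = prs ω := by
    intro ω hω
    funext i
    exact hLt ω hω i
  have hLm : Measurable L := by
    have h1 : Measurable (Q ∘ L) := by
      have : Q ∘ L = T.piecewise prs (fun _ => Q c) := by
        funext ω
        by_cases hω : ω ∈ T
        · rw [Set.piecewise_eq_of_mem _ _ _ hω]; exact hQL ω hω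
        · rw [Set.piecewise_eq_of_notMem _ _ _ hω, Function.comp, hLc ω hω]
      rw [this]
      exact prs_meas.piecewise hT measurable_const
    intro A hA
    rw [hpi] at hA
    obtain ⟨A0, hA0, rfl⟩ := hA
    exact h1 hA0
  have hsat : ∀ A : Set (ℕ → E), MeasurableSet A → ∃ A0, MeasurableSet A0 ∧ Q ⁻¹' A0 = A := by
    intro A hA
    rw [hpi] at hA
    exact hA
  refine ⟨μ.map L, ⟨?_, ?_, ?_⟩, ?_⟩
  · rw [Measure.map_apply hLm MeasurableSet.univ, Set.preimage_univ, hprob]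
  · refine le_antisymm ?_ ?_
    · refine (measure_mono (subset_univ _)).trans ?_
      rw [Measure.map_apply hLm MeasurableSet.univ, Set.preimage_univ, hprob]
    · set X : Set (ℕ → E) := {γ | (∀ i : ℕ, G.dst (γ i) = G.src (γ (i + 1))) ∧ G.src (γ 0) = o ∧
        Function.Bijective γ} with hX
      rw [← measure_toMeasurable, Measure.map_apply hLm (measurableSet_toMeasurable _ _)]
      rw [← (mem_ae_iff_prob_eq_one hT).1 hTae]
      refine measure_mono (fun ω hω => ?_)
      refine subset_toMeasurable _ _ ?_
      have ht := hLt ω hω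
      refine ⟨fun i => ?_, ?_, hLb ω hω⟩
      · apply Subtype.ext
        rw [show (G.dst (L ω i) : S) = ω (i + 1) from congrArg Prod.snd (ht i),
          show (G.src (L ω (i + 1)) : S) = ω (i + 1) from congrArg Prod.fst (ht (i + 1))]
      · apply Subtype.ext
        rw [show (G.src (L ω 0) : S) = ω 0 from congrArg Prod.fst (ht 0), hL0 ω hω]
  · have main : ∀ (n : ℕ) (w w' : Fin n → E), Function.Injective w → Function.Injective w' →
        Set.range w = Set.range w' → PrefixPath G o w → PrefixPath G o w' →
        ∀ B : Set (ℕ → E),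
          (μ.map L) {γ | (∀ i : Fin n, γ (i : ℕ) = w' i) ∧ (fun t : ℕ => γ (n + t)) ∈ B} ≤
          (μ.map L) {γ | (∀ i : Fin n, γ (i : ℕ) = w i) ∧ (fun t : ℕ => γ (n + t)) ∈ B} := by
      intro n w w' hi hi' hr hw hw' B
      cases n with
      | zero =>
        have : w = w' := Subsingleton.elim _ _
        rw [this]
      | succ k =>
      set Tw : Set (ℕ → E) := {γ | (∀ i : Fin (k + 1), γ (i : ℕ) = w i) ∧
        (fun t : ℕ => γ (k + 1 + t)) ∈ B} with hTw
      set A := toMeasurable (μ.map L) Tw with hA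
      have hAm : MeasurableSet A := measurableSet_toMeasurable _ _
      obtain ⟨A0, hA0, hAA⟩ := hsat A hAm
      set qw : ℕ → S × S := fun i => if h : i < k + 1 then ety G (w ⟨i, h⟩) else ety G (w 0) with hqw
      set A1 : Set (ℕ → S × S) := {z | glue qw (k + 1) z ∈ A0} with hA1
      have hA1m : MeasurableSet A1 := by
        have : Measurable (fun z : ℕ → S × S => glue qw (k + 1) z) := by
          refine measurable_pi_lambda _ (fun i => ?_)
          unfold glue
          by_cases h : i < k + 1
          · simp only [h, if_true]; exact measurable_const
          · simp only [h, if_false]; exact measurable_pi_apply _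
        exact this hA0
      set A2 : Set (ℕ → S × S) := {q | (∀ i : Fin (k + 1), q i = ety G (w' i)) ∧
        (fun t => q (k + 1 + t)) ∈ A1} with hA2
      have hA2m : MeasurableSet A2 := by
        have : A2 = (⋂ i : Fin (k + 1), (fun q : ℕ → S × S => q i) ⁻¹' {ety G (w' i)}) ∩
            (sh (k + 1)) ⁻¹' A1 := by
          ext q
          simp only [hA2, Set.mem_ofPred_eq, Set.mem_inter_iff, Set.mem_iInter, Set.mem_preimage,
            Set.mem_singleton_iff]
          rfl
        rw [this]
        exact (MeasurableSet.iInter fun i => measurable_pi_apply _ (MeasurableSet.singleton _)).inter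
          (sh_meas _ hA1m)
      have hsub : {γ : ℕ → E | (∀ i : Fin (k + 1), γ (i : ℕ) = w' i) ∧
          (fun t : ℕ => γ (k + 1 + t)) ∈ B} ⊆ Q ⁻¹' A2 := by
        rintro γ ⟨h1, h2⟩
        refine ⟨fun i => ?_, ?_⟩
        · change ety G (γ i) = _
          rw [h1]
        · change glue qw (k + 1) _ ∈ A0
          set γ2 : ℕ → E := fun i => if h : i < k + 1 then w ⟨i, h⟩ else γ i with hγ2
          have h3 : γ2 ∈ Tw := by
            refine ⟨fun i => ?_, ?_⟩
            · simp only [hγ2, i.2, dif_pos]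
            · have : (fun t : ℕ => γ2 (k + 1 + t)) = fun t : ℕ => γ (k + 1 + t) := by
                funext t
                have : ¬ (k + 1 + t < k + 1) := by omega
                simp only [hγ2, this, dif_neg, not_false_eq_true]
              rw [this]; exact h2
          have h4 : γ2 ∈ A := subset_toMeasurable _ _ h3
          rw [← hAA] at h4
          have h5 : Q γ2 = glue qw (k + 1) (fun t => Q γ (k + 1 + t)) := by
            funext i
            unfold glue
            by_cases h : i < k + 1
            · simp only [hQ, hγ2, hqw, h, dif_pos, if_true]
            · have : k + 1 + (i - (k + 1)) = i := by omega
              simp only [hQ, hγ2, h, dif_neg, if_false, not_false_eq_true, this]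
          rw [← h5]; exact h4
      set C : Set (ℕ → S) := prs ⁻¹' A1 with hC
      have hCm : MeasurableSet C := prs_meas hA1m
      calc (μ.map L) _ ≤ (μ.map L) (Q ⁻¹' A2) := measure_mono hsub
        _ = μ (L ⁻¹' (Q ⁻¹' A2)) := Measure.map_apply hLm (hQm hA2m)
        _ ≤ μ (sh (k + 1) ⁻¹' C ∩ cyl (vpt G w') (k + 1)) := by
          refine measure_mono_ae ?_
          filter_upwards [hTae] with ω hω hmem
          have h1 : Q (L ω) ∈ A2 := hmem
          rw [hQL ω hω] at h1
          exact ⟨h1.2, (cyl_vpt G hw' ω).2 h1.1⟩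
        _ = μ (sh (k + 1) ⁻¹' C ∩ cyl (vpt G w) (k + 1)) :=
          (swap hPE (vpt_finEquiv G hw hw' hi hi' hr) C hCm).symm
        _ ≤ μ (L ⁻¹' A) := by
          refine measure_mono_ae ?_
          filter_upwards [hTae] with ω hω hmem
          obtain ⟨h1, h2⟩ := hmem
          have h2' := (cyl_vpt G hw ω).1 h2
          change L ω ∈ A
          rw [← hAA]
          change Q (L ω) ∈ A0
          rw [hQL ω hω]
          have h3 : glue qw (k + 1) (prs (sh (k + 1) ω)) ∈ A0 := h1
          convert h3 using 1
          funext i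
          unfold glue
          by_cases h : i < k + 1
          · simp only [h, if_true, hqw, dif_pos]
            exact h2' ⟨i, h⟩
          · simp only [h, if_false, prs, sh]
            have e1 : k + 1 + (i - (k + 1)) = i := by omega
            have e2 : k + 1 + (i - (k + 1) + 1) = i + 1 := by omega
            rw [e1, e2]
        _ = (μ.map L) A := (Measure.map_apply hLm hAm).symm
        _ = (μ.map L) Tw := measure_toMeasurable _
    intro n w w' hi hi' hr hw hw' B
    exact le_antisymm (main n w' w hi' hi hr.symm hw' hw B) (main n w w' hi hi' hr hw hw' B)
  · intro A hA
    have hm : Measurable (fun (γ : ℕ → E) (i : ℕ) => ((G.src (γ i) : S))) :=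
      measurable_pi_lambda _ (fun i => (measurable_fst.comp hety).comp (measurable_pi_apply i))
    rw [Measure.map_apply hLm (hm hA)]
    refine measure_congr ?_
    filter_upwards [hTae] with ω hω
    apply propext
    have e : (fun (i : ℕ) => ((G.src (L ω i) : S))) = ω := by
      funext i
      exact congrArg Prod.fst (hLt ω hω i)
    change ω ∈ A ↔ (fun (i : ℕ) => ((G.src (L ω i) : S))) ∈ A
    rw [e]

/-- the digraph of the transitions of a sequence -/
def trailG (ω0 : ℕ → S) : DigraphStruct (↥(Set.range ω0)) ℕ where
  src i := ⟨ω0 i, i, rfl⟩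
  dst i := ⟨ω0 (i + 1), i + 1, rfl⟩

theorem trailG_euler (ω0 : ℕ → S) (h : Transient ω0) :
    (trailG ω0).IsSourcedEulerian ⟨ω0 0, 0, rfl⟩ := by
  have hout : ∀ v : ↥(Set.range ω0), (trailG ω0).outEdges v = {i | ω0 i = v} := by
    intro v; ext i
    exact Subtype.ext_iff
  have hin : ∀ v : ↥(Set.range ω0), (trailG ω0).inEdges v = {i | ω0 (i + 1) = v} := by
    intro v; ext i
    exact Subtype.ext_iff
  have hfo : ∀ s, {i | ω0 i = s}.Finite := h
  have hfi : ∀ s, {i | ω0 (i + 1) = s}.Finite := fun s =>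
    (hfo s).preimage (f := fun t => t + 1) ((add_left_injective 1).injOn)
  have hdeg : ∀ s, {i | ω0 i = s}.ncard = {i | ω0 (i + 1) = s}.ncard + if s = ω0 0 then 1 else 0 := by
    intro s
    have e : {i | ω0 i = s} = (fun i => i + 1) '' {i | ω0 (i + 1) = s} ∪
        (if s = ω0 0 then {0} else ∅) := by
      ext i
      simp only [Set.mem_ofPred_eq, Set.mem_union, Set.mem_image]
      cases i with
      | zero =>
        by_cases hs : s = ω0 0
        · simp [hs]
        · simp [hs, Ne.symm hs]
      | succ i =>
        have : (i + 1) ∉ (if s = ω0 0 then {0} else ∅ : Set ℕ) := by split_ifs <;> simp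
        simp [this]
    rw [e, Set.ncard_union_eq ?_ ((hfi s).image _) (by split_ifs <;> simp),
      Set.ncard_image_of_injective _ (add_left_injective 1)]
    · split_ifs <;> simp
    · rw [Set.disjoint_left]
      rintro i ⟨j, _, rfl⟩
      split_ifs <;> simp
  refine ⟨?_, fun v => ?_, ?_, fun v hv => ?_, ?_⟩
  · rw [Set.infinite_coe_iff]
    intro hfin
    have : (Set.univ : Set ℕ).Finite := by
      have h1 : (Set.univ : Set ℕ) = ⋃ s ∈ Set.range ω0, {i | ω0 i = s} := by
        ext i; simp
      rw [h1]
      exact hfin.biUnion (fun s _ => hfo s)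
    exact Set.infinite_univ this
  · rw [hout, hin]
    exact ⟨hfo _, hfi _⟩
  · have h0 : ∀ i : ℕ, Relation.ReflTransGen (trailG ω0).undirAdj ⟨ω0 0, 0, rfl⟩ ⟨ω0 i, i, rfl⟩ := by
      intro i
      induction i with
      | zero => exact Relation.ReflTransGen.refl
      | succ i ih => exact ih.tail ⟨i, Or.inl ⟨rfl, rfl⟩⟩
    have h0' : ∀ i : ℕ, Relation.ReflTransGen (trailG ω0).undirAdj ⟨ω0 i, i, rfl⟩ ⟨ω0 0, 0, rfl⟩ := by
      intro i
      induction i with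
      | zero => exact Relation.ReflTransGen.refl
      | succ i ih => exact Relation.ReflTransGen.head ⟨i, Or.inr ⟨rfl, rfl⟩⟩ ih
    rintro ⟨_, i, rfl⟩ ⟨_, j, rfl⟩
    exact (h0' i).trans (h0 j)
  · unfold DigraphStruct.inDeg DigraphStruct.outDeg
    rw [hin, hout, hdeg]
    have : (v : S) ≠ ω0 0 := fun hc => hv (Subtype.ext hc)
    simp [this]
  · unfold DigraphStruct.inDeg DigraphStruct.outDeg
    rw [hin, hout, hdeg]
    simp

theorem exists_label {o : S} {M : S → S → ℕ∞} {ω ω0 : ℕ → S} (h : Good o M ω) (h0 : Good o M ω0) :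
    ∃ g : ℕ → ℕ, Function.Bijective g ∧ ∀ i, (ω0 (g i), ω0 (g i + 1)) = (ω i, ω (i + 1)) := by
  have key : ∀ p : S × S, Nonempty ({i : ℕ // prs ω i = p} ≃ {i : ℕ // prs ω0 i = p}) := by
    rintro ⟨u, v⟩
    have e : ∀ ω : ℕ → S, {i : ℕ | prs ω i = (u, v)} = {i | ω i = u ∧ ω (i + 1) = v} := by
      intro ω; ext i; simp [prs]
    have f : ∀ ω : ℕ → S, Transient ω → {i : ℕ | prs ω i = (u, v)}.Finite := by
      intro ω hω
      rw [e]
      exact (hω u).subset (fun i hi => hi.1)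
    have f1 := f ω h.2.2
    have f2 := f ω0 h0.2.2
    have hc : {i : ℕ | prs ω i = (u, v)}.encard = {i : ℕ | prs ω0 i = (u, v)}.encard := by
      rw [e, e]
      exact (h.2.1 u v).trans (h0.2.1 u v).symm
    have i1 : Finite {i : ℕ // prs ω i = (u, v)} := f1
    have i2 : Finite {i : ℕ // prs ω0 i = (u, v)} := f2
    have hn : Nat.card {i : ℕ // prs ω i = (u, v)} = Nat.card {i : ℕ // prs ω0 i = (u, v)} :=
      congrArg ENat.toNat hc
    have j1 := Fintype.ofFinite {i : ℕ // prs ω i = (u, v)}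
    have j2 := Fintype.ofFinite {i : ℕ // prs ω0 i = (u, v)}
    rw [Nat.card_eq_fintype_card, Nat.card_eq_fintype_card] at hn
    exact ⟨Fintype.equivOfCardEq hn⟩
  choose g hg using fun p => (key p).elim (fun e => (⟨e, trivial⟩ : ∃ _ : ({i : ℕ // prs ω i = p} ≃
    {i : ℕ // prs ω0 i = p}), True))
  let F : ℕ ≃ ℕ := (Equiv.sigmaFiberEquiv (prs ω)).symm.trans
    ((Equiv.sigmaCongrRight g).trans (Equiv.sigmaFiberEquiv (prs ω0)))
  refine ⟨F, F.bijective, fun i => ?_⟩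
  exact (g (prs ω i) ⟨i, rfl⟩).2

theorem two_three [Countable S] [MeasurableSpace S] [DiscreteMeasurableSpace S]
    {μ : Measure (ℕ → S)} (hprob : μ univ = 1) (hPE : PartiallyExchangeable μ)
    {o : S} {M : S → S → ℕ∞} (hg : ∀ᵐ ω ∂μ, Good o M ω) : IsGibbsVertexLaw μ := by
  have hp : IsProbabilityMeasure μ := ⟨hprob⟩
  obtain ⟨ω0, h0⟩ := hg.exists
  let L : (ℕ → S) → ℕ → ℕ := fun ω => if h : Good o M ω then (exists_label h h0).choose else id
  refine ⟨Set.range ω0, ℕ, MeasurableSpace.comap (ety (trailG ω0)) inferInstance, trailG ω0,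
    ⟨ω0 0, 0, rfl⟩, inferInstance, trailG_euler ω0 h0.2.2, ?_⟩
  refine @gibbs_of S _ _ _ ℕ (MeasurableSpace.comap (ety (trailG ω0)) inferInstance) _ (trailG ω0)
    ⟨ω0 0, 0, rfl⟩ rfl μ hprob hPE L {ω | Good o M ω} (good_meas o M) hg id ?_ ?_ ?_ ?_
  · intro ω hω
    exact dif_neg hω
  · intro ω hω
    exact hω.1.trans h0.1.symm
  · intro ω hω
    have : L ω = (exists_label hω h0).choose := dif_pos hω
    rw [this]
    exact (exists_label hω h0).choose_spec.1
  · intro ω hω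
    have : L ω = (exists_label hω h0).choose := dif_pos hω
    rw [this]
    exact (exists_label hω h0).choose_spec.2

theorem stmt4_aux {S : Type} [Countable S] [Nonempty S] [MeasurableSpace S]
    [DiscreteMeasurableSpace S] (μ : Measure (ℕ → S)) (hprob : μ Set.univ = 1)
    (hPE : PartiallyExchangeable μ)
    (htrans : μ {x : ℕ → S | ∀ s : S, {i : ℕ | x i = s}.Finite} = 1) :
    (IsExtremePE μ ↔
      ∃ (s0 : S) (M : S → S → ℕ∞),
        μ {x | x 0 = s0 ∧ ∀ u v : S, transNum x u v = M u v} = 1) ∧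
    ((∃ (s0 : S) (M : S → S → ℕ∞),
        μ {x | x 0 = s0 ∧ ∀ u v : S, transNum x u v = M u v} = 1) ↔
      IsGibbsVertexLaw μ) := by
  have hgood : ∀ (s0 : S) (M : S → S → ℕ∞),
      μ {x | x 0 = s0 ∧ ∀ u v : S, transNum x u v = M u v} = 1 → ∀ᵐ ω ∂μ, Good s0 M ω := by
    intro s0 M h
    filter_upwards [ae_of_one hprob (tn_meas s0 M) h, ae_of_one hprob transient_meas htrans]
      with ω h1 h2
    exact ⟨h1.1, h1.2, h2⟩
  refine ⟨⟨one_two, ?_⟩, ⟨?_, three_two hprob⟩⟩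
  · rintro ⟨s0, M, h⟩
    exact two_one hprob hPE (hgood s0 M h)
  · rintro ⟨s0, M, h⟩
    exact two_three hprob hPE (hgood s0 M h)

end

/-- For a transient partially exchangeable probability measure `μ` on `S^ℕ`,
the following are equivalent: (1) `μ` is extremal among partially exchangeable probability
measures; (2) `μ` has constant initial state and constant transition numbers; (3) `μ` is the
law of the vertex sequence of the unique proper Gibbs measure on Eulerian paths from `o` to `∞`
on some sourced Eulerian digraph whose vertex set is a subset of `S`. -/
theorem stmt4 {S : Type} [Countable S] [Nonempty S] [MeasurableSpace S]
    [DiscreteMeasurableSpace S]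
    (μ : Measure (ℕ → S)) (hprob : μ Set.univ = 1)
    (hPE : PartiallyExchangeable μ)
    (htrans : μ {x | ∀ s : S, {i : ℕ | x i = s}.Finite} = 1) :
    (IsExtremePE μ ↔
      ∃ (s0 : S) (M : S → S → ℕ∞),
        μ {x | x 0 = s0 ∧ ∀ u v : S, transNum x u v = M u v} = 1) ∧
    ((∃ (s0 : S) (M : S → S → ℕ∞),
        μ {x | x 0 = s0 ∧ ∀ u v : S, transNum x u v = M u v} = 1) ↔
      IsGibbsVertexLaw μ) := by
  exact stmt4_aux μ hprob hPE htrans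

end DF
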